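/- Let N ≥ 2. There exists an absolute constant C > 0 such that: if Ω ⊂ ℝ^N is an open bounded convex set of diameter D, Π is an affine subspace of ℝ^N of dimension k ≤ N, ω ⊆ Ω ∩ Π is a relatively open convex subset of Ω ∩ Π of diameter d > 0, and p ∈ L^∞(ω) is a positive weight of the form p = h·u₁², where u₁ is the first Dirichlet eigenfunction of Ω and h : ω → (0,+∞) is a (1/m)-concave function (m ∈ ℕ \ {0}), then μ₁(ω, p) ≥ 3π²/D² + C(D − d)³/D⁵. -/

import Mathlib

open MeasureTheory Real Set Filter Bornology
open scoped ENNReal RealInnerProductSpace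

noncomputable section

/-- Dirichlet Rayleigh quotient of `u` on `Ω ⊆ ℝ^N`. -/
def dRayleigh {N : ℕ} (Ω : Set (EuclideanSpace ℝ (Fin N)))
    (u : EuclideanSpace ℝ (Fin N) → ℝ) : ℝ≥0∞ :=
  (∫⁻ x in Ω, ENNReal.ofReal (‖fderiv ℝ u x‖ ^ 2)) /
    ∫⁻ x in Ω, ENNReal.ofReal ((u x) ^ 2)

/-- The `k`-th Dirichlet Laplacian eigenvalue of `Ω`, via the Courant–Fischer min-max
over `k`-dimensional subspaces of (a core of) `H¹₀(Ω)`. -/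
def dirEV {N : ℕ} (Ω : Set (EuclideanSpace ℝ (Fin N))) (k : ℕ) : ℝ≥0∞ :=
  ⨅ (S : Submodule ℝ (EuclideanSpace ℝ (Fin N) → ℝ))
    (_ : Module.finrank ℝ S = k ∧ ∀ u ∈ S, ContDiff ℝ 1 u ∧ tsupport u ⊆ Ω),
    ⨆ (u : EuclideanSpace ℝ (Fin N) → ℝ) (_ : u ∈ S ∧ u ≠ 0), dRayleigh Ω u

/-- Weighted Rayleigh quotient of `u` on `Ω` with weight `p`. -/
def wRayleigh {N : ℕ} (Ω : Set (EuclideanSpace ℝ (Fin N)))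
    (p u : EuclideanSpace ℝ (Fin N) → ℝ) : ℝ≥0∞ :=
  (∫⁻ x in Ω, ENNReal.ofReal (‖fderiv ℝ u x‖ ^ 2 * p x)) /
    ∫⁻ x in Ω, ENNReal.ofReal ((u x) ^ 2 * p x)

/-- Admissibility of `u` for the weighted Neumann eigenvalue `μ₁(Ω, p)`:
`u ∈ H¹_loc(Ω) ∩ L²(Ω, p dx)`, `u ≠ 0`, with zero `p`-mean. -/
def wAdm {N : ℕ} (Ω : Set (EuclideanSpace ℝ (Fin N)))
    (p u : EuclideanSpace ℝ (Fin N) → ℝ) : Prop :=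
  ContDiffOn ℝ 1 u Ω ∧
    (∫⁻ x in Ω, ENNReal.ofReal ((u x) ^ 2 * p x)) ≠ 0 ∧
    (∫⁻ x in Ω, ENNReal.ofReal ((u x) ^ 2 * p x)) ≠ ∞ ∧
    (∫ x in Ω, u x * p x) = 0

/-- `μ₁(Ω, p)`, the first nontrivial weighted Neumann eigenvalue of `Ω`.
For `p ≡ 1` this is the first nontrivial Neumann Laplacian eigenvalue. -/
def wEV {N : ℕ} (Ω : Set (EuclideanSpace ℝ (Fin N)))
    (p : EuclideanSpace ℝ (Fin N) → ℝ) : ℝ≥0∞ :=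
  ⨅ (u : EuclideanSpace ℝ (Fin N) → ℝ) (_ : wAdm Ω p u), wRayleigh Ω p u

/-- The width of `Ω`: the minimal distance between two parallel supporting hyperplanes,
i.e. the infimum over unit directions of the breadth of `Ω` in that direction. -/
def width {N : ℕ} (Ω : Set (EuclideanSpace ℝ (Fin N))) : ℝ :=
  ⨅ v : Metric.sphere (0 : EuclideanSpace ℝ (Fin N)) 1,
    (sSup ((fun x => ⟪x, (v : EuclideanSpace ℝ (Fin N))⟫) '' Ω) -
      sInf ((fun x => ⟪x, (v : EuclideanSpace ℝ (Fin N))⟫) '' Ω))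

/-- `u` is a first Dirichlet eigenfunction of `Ω` (positive, `L²`-normalized):
it lies in (an avatar of) `H¹₀(Ω)` and achieves `λ₁(Ω)` as a Rayleigh quotient. -/
def IsFirstDirichletEF {N : ℕ} (Ω : Set (EuclideanSpace ℝ (Fin N)))
    (u : EuclideanSpace ℝ (Fin N) → ℝ) : Prop :=
  Continuous u ∧ (∀ x ∉ Ω, u x = 0) ∧ ContDiffOn ℝ 1 u Ω ∧
    (∫⁻ x in Ω, ENNReal.ofReal (‖fderiv ℝ u x‖ ^ 2)) ≠ ∞ ∧
    (∀ x ∈ Ω, 0 < u x) ∧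
    (∫⁻ x in Ω, ENNReal.ofReal ((u x) ^ 2)) = 1 ∧
    dRayleigh Ω u = dirEV Ω 1

/-- `u2` is a second Dirichlet eigenfunction of `Ω` (`L²`-normalized, orthogonal to the
first eigenfunction `u1`), achieving `λ₂(Ω)` as a Rayleigh quotient. -/
def IsSecondDirichletEF {N : ℕ} (Ω : Set (EuclideanSpace ℝ (Fin N)))
    (u1 u2 : EuclideanSpace ℝ (Fin N) → ℝ) : Prop :=
  Continuous u2 ∧ (∀ x ∉ Ω, u2 x = 0) ∧ ContDiffOn ℝ 1 u2 Ω ∧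
    (∫⁻ x in Ω, ENNReal.ofReal (‖fderiv ℝ u2 x‖ ^ 2)) ≠ ∞ ∧
    (∫ x in Ω, u1 x * u2 x) = 0 ∧
    (∫⁻ x in Ω, ENNReal.ofReal ((u2 x) ^ 2)) = 1 ∧
    dRayleigh Ω u2 = dirEV Ω 2

/-- Rayleigh quotient along a `k`-dimensional affine subspace with direction `V`:
gradients are taken along `V` and the reference measure is the `k`-dimensional
Hausdorff measure. -/
def tangRQ {N : ℕ} (k : ℕ) (V : Submodule ℝ (EuclideanSpace ℝ (Fin N)))
    (ω : Set (EuclideanSpace ℝ (Fin N)))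
    (p u : EuclideanSpace ℝ (Fin N) → ℝ) : ℝ≥0∞ :=
  (∫⁻ x in ω, ENNReal.ofReal (‖(fderiv ℝ u x).comp V.subtypeL‖ ^ 2 * p x) ∂μH[(k : ℝ)]) /
    ∫⁻ x in ω, ENNReal.ofReal ((u x) ^ 2 * p x) ∂μH[(k : ℝ)]

/-- Admissibility for the weighted Neumann eigenvalue on a (possibly lower-dimensional)
convex set `ω`, with reference measure `μH^k`. -/
def tangAdm {N : ℕ} (k : ℕ) (ω : Set (EuclideanSpace ℝ (Fin N)))
    (p u : EuclideanSpace ℝ (Fin N) → ℝ) : Prop :=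
  (∀ x ∈ ω, DifferentiableAt ℝ u x) ∧
    (∫⁻ x in ω, ENNReal.ofReal ((u x) ^ 2 * p x) ∂μH[(k : ℝ)]) ≠ 0 ∧
    (∫⁻ x in ω, ENNReal.ofReal ((u x) ^ 2 * p x) ∂μH[(k : ℝ)]) ≠ ∞ ∧
    (∫ x in ω, u x * p x ∂μH[(k : ℝ)]) = 0

/-- `μ₁(ω, p)` for a convex set `ω` contained in a `k`-dimensional affine subspace with
direction `V`. -/
def tangEV {N : ℕ} (k : ℕ) (V : Submodule ℝ (EuclideanSpace ℝ (Fin N)))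
    (ω : Set (EuclideanSpace ℝ (Fin N)))
    (p : EuclideanSpace ℝ (Fin N) → ℝ) : ℝ≥0∞ :=
  ⨅ (u : EuclideanSpace ℝ (Fin N) → ℝ) (_ : tangAdm k ω p u), tangRQ k V ω p u

/-- Wronskian-type function used in the model function. -/
lemma modelW_pos (s : ℝ) (hs0 : 0 ≤ s) (hs1 : s < 1) (θ : ℝ) (h0 : 0 ≤ θ)
    (h1 : θ < π / 2 - π * s / 2) :
    (2 + s ^ 3 / 3) * θ < π ∧
    0 < Real.sin ((2 + s ^ 3 / 3) * θ) * Real.sin θ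
      + (2 + s ^ 3 / 3) * Real.cos ((2 + s ^ 3 / 3) * θ) * Real.cos θ := by
  set e := s ^ 3 / 3 with he
  set δ := π * s / 2 with hδ
  set φ := π / 2 - δ with hφ
  have hpi := Real.pi_pos
  have hpi3 := Real.pi_gt_three
  have hpi4 : π < 3.15 := Real.pi_lt_d2
  have hs3 : 0 ≤ s ^ 3 := by positivity
  have he0 : 0 ≤ e := by positivity
  have hs31 : s ^ 3 ≤ s := by nlinarith [mul_nonneg hs0 hs0]
  have hδ0 : 0 ≤ δ := by positivity
  have hδ1 : δ < π / 2 := by rw [hδ]; nlinarith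
  have hφ0 : 0 < φ := by linarith
  have hφ2 : φ ≤ π / 2 := by linarith
  have haφ : (2 + e) * φ ≤ π := by
    have : e * φ ≤ 2 * δ := by
      have h1 : e * φ ≤ (s/3) * (π/2) := by
        apply mul_le_mul _ hφ2 hφ0.le (by positivity)
        rw [he]; linarith
      have : 2 * δ = π * s := by rw [hδ]; ring
      nlinarith
    have : (2+e) * φ = π - 2 * δ + e * φ := by rw [hφ]; ring
    linarith
  have hlt : ∀ t, 0 ≤ t → t < φ → (2+e) * t < π := by
    intro t ht htφ
    have : (2+e) * t < (2+e) * φ := by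
      apply mul_lt_mul_of_pos_left htφ; linarith
    linarith
  refine ⟨hlt θ h0 h1, ?_⟩
  let W : ℝ → ℝ := fun t => Real.sin ((2+e) * t) * Real.sin t + (2+e) * Real.cos ((2+e) * t) * Real.cos t
  have hWd : ∀ t, HasDerivAt W ((1 - (2+e)^2) * (Real.sin ((2+e) * t) * Real.cos t)) t := by
    intro t
    have hl : HasDerivAt (fun t : ℝ => (2+e) * t) (2+e) t := by
      simpa using (hasDerivAt_id t).const_mul (2+e)
    have h := (hl.sin.mul (Real.hasDerivAt_sin t)).add ((hl.cos.const_mul (2+e)).mul (Real.hasDerivAt_cos t))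
    exact h.congr_deriv (by ring)
  have hanti : StrictAntiOn W (Icc 0 φ) := by
    apply strictAntiOn_of_deriv_neg (convex_Icc 0 φ)
    · exact fun t _ => (hWd t).continuousAt.continuousWithinAt
    · intro t ht
      rw [interior_Icc] at ht
      rw [(hWd t).deriv]
      have h1 : 0 < Real.sin ((2+e) * t) :=
        Real.sin_pos_of_pos_of_lt_pi (by have := ht.1; positivity) (hlt t ht.1.le ht.2)
      have h2 : 0 < Real.cos t := Real.cos_pos_of_mem_Ioo ⟨by linarith [ht.1], by linarith [ht.2]⟩
      have h3 : (1 - (2+e)^2) < 0 := by nlinarith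
      exact mul_neg_of_neg_of_pos h3 (mul_pos h1 h2)
  have hWφ : 0 ≤ W φ := by
    have e1 : (2+e) * φ = π - (2 * δ - e * φ) := by rw [hφ]; ring
    have hW : W φ = Real.sin (2*δ - e * φ) * Real.cos δ - (2+e) * Real.cos (2*δ - e*φ) * Real.sin δ := by
      simp only [W]
      rw [e1, Real.sin_pi_sub, Real.cos_pi_sub, hφ, Real.sin_pi_div_two_sub, Real.cos_pi_div_two_sub]
      ring
    have heφ : 0 ≤ e * φ := by positivity
    have b1 : Real.sin (2*δ) - e*φ ≤ Real.sin (2*δ - e * φ) := by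
      have := Real.abs_sin_sub_sin_le (2*δ) (2*δ - e*φ)
      rw [show 2*δ - (2*δ - e*φ) = e * φ by ring, abs_of_nonneg heφ] at this
      linarith [(abs_le.1 this).2]
    have b2 : Real.cos (2*δ - e*φ) ≤ Real.cos (2*δ) + e*φ := by
      have := Real.abs_cos_sub_cos_le (2*δ) (2*δ - e*φ)
      rw [show 2*δ - (2*δ - e*φ) = e * φ by ring, abs_of_nonneg heφ] at this
      linarith [(abs_le.1 this).1]
    have hsδ : s ≤ Real.sin δ := by
      have := Real.mul_le_sin (x := δ) hδ0 hδ1.le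
      rw [hδ] at this ⊢
      have h2 : 2 / π * (π * s / 2) = s := by field_simp
      linarith
    have hcδ : 0 ≤ Real.cos δ := Real.cos_nonneg_of_mem_Icc ⟨by linarith, by linarith⟩
    have hc1 : Real.cos δ ≤ 1 := Real.cos_le_one _
    have hsin0 : 0 ≤ Real.sin δ := by linarith
    have hsin1 : Real.sin δ ≤ 1 := Real.sin_le_one _
    have hcub : s^3 ≤ Real.sin δ ^ 3 := by gcongr
    have hsq := Real.sin_sq_add_cos_sq δ
    have hk : Real.sin (2*δ) * Real.cos δ - 2 * Real.cos (2*δ) * Real.sin δ = 2 * Real.sin δ ^ 3 := by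
      rw [Real.sin_two_mul, Real.cos_two_mul]
      have : Real.cos δ ^ 2 = 1 - Real.sin δ ^ 2 := by linarith
      calc _ = 2 * Real.sin δ * Real.cos δ ^ 2 - 2 * (2 * Real.cos δ ^ 2 - 1) * Real.sin δ := by ring
        _ = _ := by rw [this]; ring
    have t1 : (Real.sin (2*δ) - e*φ) * Real.cos δ ≤ Real.sin (2*δ - e * φ) * Real.cos δ :=
      mul_le_mul_of_nonneg_right b1 hcδ
    have t2 : Real.cos (2*δ - e*φ) * Real.sin δ ≤ (Real.cos (2*δ) + e*φ) * Real.sin δ :=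
      mul_le_mul_of_nonneg_right b2 hsin0
    have t3 : e * (Real.cos (2*δ - e*φ) * Real.sin δ) ≤ e * 1 := by
      apply mul_le_mul_of_nonneg_left _ he0
      have := Real.cos_le_one (2*δ - e*φ)
      nlinarith
    have t4 : e * φ * Real.cos δ ≤ e * φ := by nlinarith
    have t5 : e * φ * Real.sin δ ≤ e * φ := by nlinarith
    have t6 : e * φ ≤ e * (5/3) := mul_le_mul_of_nonneg_left (by linarith) he0
    rw [hW]
    have : s ^ 3 = 3 * e := by rw [he]; ring
    linarith
  have := hanti ⟨h0, h1.le⟩ ⟨hφ0.le, le_refl _⟩ h1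
  exact lt_of_le_of_lt hWφ this

/-- The model function. -/
lemma model_fn (D d μ R : ℝ) (hd : 0 < d) (hdD : d ≤ D) (hμ0 : 0 < μ)
    (hμ : μ < 3 * π ^ 2 / D ^ 2 + 1 * (D - d) ^ 3 / D ^ 5) (hR : 0 ≤ R) (hRd : R < d / 2) :
    ∃ χ χ1 χ2 : ℝ → ℝ, χ 0 = 0 ∧ ∀ r ∈ Icc 0 R, HasDerivAt χ (χ1 r) r ∧ HasDerivAt χ1 (χ2 r) r ∧
      0 < χ1 r ∧ χ2 r - 2 * (π / D) * (Real.sin (π / D * r) / Real.cos (π / D * r)) * χ1 r + μ * χ r < 0 := by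
  have hD : 0 < D := by linarith
  have hpi := Real.pi_pos
  have hpi3 := Real.pi_gt_three
  have hpi4 : π < 3.15 := Real.pi_lt_d2
  set s := (D - d) / D with hs
  have hs0 : 0 ≤ s := div_nonneg (by linarith) hD.le
  have hs1 : s < 1 := by rw [hs, div_lt_one hD]; linarith
  set k := π / D with hk
  have hk0 : 0 < k := by positivity
  set a := 2 + s ^ 3 / 3 with ha
  have hs3 : 0 ≤ s ^ 3 := by positivity
  have hθ : ∀ r ∈ Icc 0 R, 0 ≤ k * r ∧ k * r < π / 2 - π * s / 2 := by
    intro r hr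
    refine ⟨mul_nonneg hk0.le hr.1, ?_⟩
    have h1 : k * r < k * (d / 2) := by
      apply mul_lt_mul_of_pos_left _ hk0
      linarith [hr.2]
    have h2 : k * (d/2) = π / 2 - π * s / 2 := by
      rw [hk, hs]; field_simp; ring
    linarith
  let W : ℝ → ℝ := fun t => Real.sin (a * t) * Real.sin t + a * Real.cos (a * t) * Real.cos t
  have hWpos : ∀ r ∈ Icc 0 R, 0 < W (k * r) := fun r hr => (modelW_pos s hs0 hs1 _ (hθ r hr).1 (hθ r hr).2).2
  have hWc : Continuous fun r => W (k * r) := by fun_prop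
  obtain ⟨r0, hr0, hmin⟩ := isCompact_Icc.exists_isMinOn (nonempty_Icc.2 hR) hWc.continuousOn
  set η := W (k * r0) / 16 with hη
  have hη0 : 0 < η := by have := hWpos r0 hr0; positivity
  have hWη : ∀ r ∈ Icc 0 R, 16 * η ≤ W (k * r) := by
    intro r hr
    have : W (k * r0) ≤ W (k * r) := hmin hr
    rw [hη]; linarith
  let Y : ℝ → ℝ := fun t => Real.sin (a * t) - η * t ^ 2
  let Y1 : ℝ → ℝ := fun t => a * Real.cos (a * t) - η * (2 * t)
  let Y2 : ℝ → ℝ := fun t => - a^2 * Real.sin (a * t) - η * 2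
  have hl : ∀ t, HasDerivAt (fun t : ℝ => a * t) a t := by
    intro t; simpa using (hasDerivAt_id t).const_mul a
  have hY : ∀ t, HasDerivAt Y (Y1 t) t := by
    intro t
    have := (hl t).sin.sub (((hasDerivAt_id t).pow 2).const_mul η)
    exact this.congr_deriv (by simp [Y1]; ring)
  have hY1 : ∀ t, HasDerivAt Y1 (Y2 t) t := by
    intro t
    have := ((hl t).cos.const_mul a).sub (((hasDerivAt_id t).const_mul 2).const_mul η)
    exact this.congr_deriv (by simp [Y2]; ring)
  let X : ℝ → ℝ := fun t => Y t / Real.cos t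
  let X1 : ℝ → ℝ := fun t => (Y1 t * Real.cos t + Y t * Real.sin t) / Real.cos t ^ 2
  let X2 : ℝ → ℝ := fun t => (Y2 t + Y t) / Real.cos t + 2 * (Real.sin t / Real.cos t) * X1 t
  have hX : ∀ t, Real.cos t ≠ 0 → HasDerivAt X (X1 t) t := by
    intro t ht
    have := (hY t).div (Real.hasDerivAt_cos t) ht
    exact this.congr_deriv (by simp only [X1]; ring)
  have hX1 : ∀ t, Real.cos t ≠ 0 → HasDerivAt X1 (X2 t) t := by
    intro t ht
    have := (((hY1 t).mul (Real.hasDerivAt_cos t)).add ((hY t).mul (Real.hasDerivAt_sin t))).div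
      ((Real.hasDerivAt_cos t).pow 2) (pow_ne_zero 2 ht)
    refine this.congr_deriv ?_
    simp only [X2, X1, Pi.mul_apply, Pi.add_apply, Pi.pow_apply]
    field_simp
    push_cast
    ring
  have hlk : ∀ t, HasDerivAt (fun t : ℝ => k * t) k t := by
    intro t; simpa using (hasDerivAt_id t).const_mul k
  refine ⟨fun r => X (k * r), fun r => k * X1 (k * r), fun r => k^2 * X2 (k * r), by simp [X, Y], ?_⟩
  intro r hr
  obtain ⟨ht0, ht1⟩ := hθ r hr
  set t := k * r with ht
  have hps : 0 ≤ π * s := by positivity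
  have hcos : 0 < Real.cos t := Real.cos_pos_of_mem_Ioo ⟨by linarith, by linarith⟩
  have hsin : 0 ≤ Real.sin t := Real.sin_nonneg_of_nonneg_of_le_pi ht0 (by linarith)
  have hsina : 0 ≤ Real.sin (a * t) := by
    apply Real.sin_nonneg_of_nonneg_of_le_pi (by positivity)
    exact (modelW_pos s hs0 hs1 _ ht0 ht1).1.le
  refine ⟨?_, ?_, ?_, ?_⟩
  · have := (hX t hcos.ne').comp r (hlk r)
    rw [mul_comm] at this
    exact this
  · have := ((hX1 t hcos.ne').comp r (hlk r)).const_mul k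
    exact this.congr_deriv (by ring)
  · apply mul_pos hk0
    apply div_pos _ (by positivity)
    have h1 : Y1 t * Real.cos t + Y t * Real.sin t = W t - η * (2 * t * Real.cos t + t^2 * Real.sin t) := by
      simp only [Y1, Y, W]; ring
    rw [h1]
    have h2 := hWη r hr
    have ht2 : t ≤ 2 := by linarith
    have h3 : 2 * t * Real.cos t ≤ 4 := by
      have := Real.cos_le_one t
      nlinarith
    have h4 : t^2 * Real.sin t ≤ 4 := by
      have := Real.sin_le_one t
      have : t^2 ≤ 4 := by nlinarith
      nlinarith
    have : η * (2 * t * Real.cos t + t^2 * Real.sin t) ≤ η * 8 := by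
      apply mul_le_mul_of_nonneg_left _ hη0.le; linarith
    linarith
  · have hμk : μ < k^2 * (3 + s^3/π^2) := by
      have : k^2 * (3 + s^3/π^2) = 3 * π ^ 2 / D ^ 2 + 1 * (D - d) ^ 3 / D ^ 5 := by
        rw [hk, hs]; field_simp
      linarith
    have e1 : k^2 * X2 t - 2 * k * (Real.sin t / Real.cos t) * (k * X1 t) + μ * X t
      = (k^2 * (Y2 t + Y t) + μ * Y t) / Real.cos t := by
      simp only [X2, X]; field_simp; ring
    rw [e1]
    apply div_neg_of_neg_of_pos _ hcos
    have e2 : k^2 * (Y2 t + Y t) + μ * Y t = -(k^2 * (a^2 - 1) - μ) * Real.sin (a * t) - k^2 * η * 2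
        - (k^2 + μ) * η * t^2 := by
      simp only [Y2, Y]; ring
    rw [e2]
    have h1 : 0 ≤ k^2 * (a^2 - 1) - μ := by
      have : 3 + s^3/π^2 ≤ a^2 - 1 := by
        have h5 : s^3/π^2 ≤ s^3 := by
          apply div_le_self hs3; nlinarith only [hpi3]
        have h6 : a^2 = 4+4*(s^3/3)+(s^3/3)^2 := by rw [ha]; ring
        have h7 := sq_nonneg (s^3/3)
        rw [h6]; linarith
      have : k^2 * (3 + s^3/π^2) ≤ k^2 * (a^2-1) := by gcongr
      linarith
    have h2 : 0 < k^2 * η * 2 := by positivity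
    have h3 : 0 ≤ (k^2 + μ) * η * t^2 := by positivity
    have h4 := mul_nonneg h1 hsina
    linarith

lemma clip_abs_le (B x : ℝ) (hB : 0 ≤ B) : |max (-B) (min B x)| ≤ |x| ∧ |max (-B) (min B x)| ≤ B := by
  constructor
  · rcases le_total 0 x with h | h
    · rw [abs_of_nonneg h, abs_of_nonneg (le_max_of_le_right (le_min hB h))]
      exact max_le (by linarith) (min_le_right _ _)
    · rw [abs_of_nonpos h, abs_of_nonpos (max_le (by linarith) (le_trans (min_le_right _ _) h))]
      have : min B x = x := min_eq_right (by linarith)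
      rw [this]; linarith [le_max_right (-B) x]
  · exact abs_le.2 ⟨le_max_left _ _, max_le (by linarith) (min_le_left _ _)⟩

lemma clip_lip (B x y : ℝ) : |max (-B) (min B x) - max (-B) (min B y)| ≤ |x - y| := by
  refine (abs_max_sub_max_le_max _ _ _ _).trans ?_
  simp only [sub_self, abs_zero]
  refine max_le (abs_nonneg _) ((abs_min_sub_min_le_max _ _ _ _).trans ?_)
  simp

lemma clip_of_abs_le (B x : ℝ) (h : |x| ≤ B) : max (-B) (min B x) = x := by
  obtain ⟨h1, h2⟩ := abs_le.1 h
  rw [min_eq_right h2, max_eq_right h1]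

lemma linODE (q : ℝ → ℝ) (hq : Continuous q) (hqp : ∀ t, 0 < q t) (μ α β : ℝ) (hμ : 0 < μ) (hαβ : α ≤ β) :
    ∃ w σ : ℝ → ℝ, w α = -1 ∧ σ α = 0 ∧ ∀ t ∈ Icc α β, HasDerivAt w (σ t / q t) t ∧
      HasDerivAt σ (- μ * q t * w t) t := by
  have hI : IsCompact (Icc (α-1) (β+1)) := isCompact_Icc
  obtain ⟨K1, hK1⟩ := hI.exists_bound_of_continuousOn (f := fun t => 1 / q t)
    (continuous_const.div hq (fun t => (hqp t).ne')).continuousOn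
  obtain ⟨K2, hK2⟩ := hI.exists_bound_of_continuousOn (f := fun t => μ * q t)
    (continuous_const.mul hq).continuousOn
  set K : ℝ := max (max K1 K2) 0 with hK
  have hK0 : 0 ≤ K := le_max_right _ _
  have hKa : ∀ t ∈ Icc (α-1) (β+1), 1 / q t ≤ K := fun t ht =>
    ((le_abs_self _).trans (hK1 t ht)).trans ((le_max_left _ _).trans (le_max_left _ _))
  have hKb : ∀ t ∈ Icc (α-1) (β+1), μ * q t ≤ K := fun t ht =>
    ((le_abs_self _).trans (hK2 t ht)).trans ((le_max_right _ _).trans (le_max_left _ _))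
  set B : ℝ := Real.exp (K * (β - α)) with hB
  have hB0 : 0 ≤ B := (Real.exp_pos _).le
  let cl : ℝ → ℝ := fun x => max (-B) (min B x)
  let f : ℝ → ℝ × ℝ → ℝ × ℝ := fun t x => (cl x.2 / q t, - μ * q t * cl x.1)
  have hfn : ∀ t ∈ Icc (α-1) (β+1), ∀ x, ‖f t x‖ ≤ K * ‖x‖ ∧ ‖f t x‖ ≤ K * B := by
    intro t ht x
    have hqt := hqp t
    have n1 : ‖cl x.2 / q t‖ = 1 / q t * |cl x.2| := by
      rw [Real.norm_eq_abs, abs_div, abs_of_pos hqt]; ring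
    have n2 : ‖-μ * q t * cl x.1‖ = μ * q t * |cl x.1| := by
      rw [Real.norm_eq_abs, abs_mul, abs_mul, abs_neg, abs_of_pos hqt, abs_of_pos hμ]
    have c1 := clip_abs_le B x.1 hB0
    have c2 := clip_abs_le B x.2 hB0
    have m1 : |x.1| ≤ ‖x‖ := norm_fst_le x
    have m2 : |x.2| ≤ ‖x‖ := norm_snd_le x
    rw [Prod.norm_def]
    refine ⟨max_le ?_ ?_, max_le ?_ ?_⟩
    · rw [n1]; exact mul_le_mul (hKa t ht) (c2.1.trans m2) (abs_nonneg _) hK0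
    · rw [n2]; exact mul_le_mul (hKb t ht) (c1.1.trans m1) (abs_nonneg _) hK0
    · rw [n1]; exact mul_le_mul (hKa t ht) c2.2 (abs_nonneg _) hK0
    · rw [n2]; exact mul_le_mul (hKb t ht) c1.2 (abs_nonneg _) hK0
  let KN : NNReal := ⟨K, hK0⟩
  let LN : NNReal := ⟨K * B, by positivity⟩
  let aN : NNReal := ⟨K * B * (β - α + 1), by have : 0 ≤ β - α := by linarith
                                              positivity⟩
  have hmem : α ∈ Icc (α-1) (β+1) := ⟨by linarith, by linarith⟩
  have hPL : IsPicardLindelof f (⟨α, hmem⟩ : Icc (α-1) (β+1)) ((-1 : ℝ), (0:ℝ)) aN 0 LN KN := by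
    refine ⟨?_, ?_, ?_, ?_⟩
    · intro t ht
      refine LipschitzWith.lipschitzOnWith (LipschitzWith.of_dist_le_mul ?_)
      intro x y
      have hqt := hqp t
      have m1 : |x.1 - y.1| ≤ dist x y := by rw [Prod.dist_eq]; exact le_max_left _ _
      have m2 : |x.2 - y.2| ≤ dist x y := by rw [Prod.dist_eq]; exact le_max_right _ _
      change max (dist (cl x.2 / q t) (cl y.2 / q t)) (dist (-μ * q t * cl x.1) (-μ * q t * cl y.1)) ≤ K * dist x y
      rw [Real.dist_eq, Real.dist_eq]
      refine max_le ?_ ?_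
      · rw [← sub_div, abs_div, abs_of_pos hqt, div_eq_mul_one_div, mul_comm]
        exact mul_le_mul (hKa t ht) ((clip_lip B _ _).trans m2) (abs_nonneg _) hK0
      · rw [← mul_sub, abs_mul, abs_mul, abs_neg, abs_of_pos hqt, abs_of_pos hμ]
        exact mul_le_mul (hKb t ht) ((clip_lip B _ _).trans m1) (abs_nonneg _) hK0
    · intro x _
      have : ∀ t, q t ≠ 0 := fun t => (hqp t).ne'
      apply Continuous.continuousOn
      refine Continuous.prodMk (continuous_const.div hq this) ?_
      fun_prop
    · intro t ht x _
      exact (hfn t ht x).2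
    · have : max (β + 1 - α) (α - (α - 1)) = β - α + 1 := by
        rw [max_eq_left (by linarith)]; ring
      simp only [NNReal.coe_zero, sub_zero]
      rw [this]
      exact le_refl _
  obtain ⟨x, hx0, hx⟩ := hPL.exists_eq_forall_mem_Icc_hasDerivWithinAt₀
  have hx0' : x α = (-1, 0) := hx0
  have hd : ∀ t ∈ Icc α β, HasDerivAt x (f t (x t)) t := fun t ht =>
    (hx t ⟨by linarith [ht.1], by linarith [ht.2]⟩).hasDerivAt (Icc_mem_nhds (by linarith [ht.1]) (by linarith [ht.2]))
  have hbd : ∀ t ∈ Icc α β, ‖x t‖ ≤ B := by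
    intro t ht
    have := norm_le_gronwallBound_of_norm_deriv_right_le (f := x) (f' := fun t => f t (x t)) (δ := 1) (K := K) (ε := 0)
      (a := α) (b := β) (fun t ht => (hd t ht).continuousAt.continuousWithinAt)
      (fun t ht => (hd t ⟨ht.1, ht.2.le⟩).hasDerivWithinAt)
      (by rw [hx0']; simp) (fun t ht => by
        rw [add_zero]; exact (hfn t ⟨by linarith [ht.1], by linarith [ht.2]⟩ (x t)).1) t ht
    rw [gronwallBound_ε0, one_mul] at this
    refine this.trans (Real.exp_le_exp.2 (mul_le_mul_of_nonneg_left (by linarith [ht.2]) hK0))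
  refine ⟨fun t => (x t).1, fun t => (x t).2, by simp [hx0'], by simp [hx0'], fun t ht => ?_⟩
  have h1 : cl (x t).1 = (x t).1 := clip_of_abs_le _ _ ((norm_fst_le (x t)).trans (hbd t ht))
  have h2 : cl (x t).2 = (x t).2 := clip_of_abs_le _ _ ((norm_snd_le (x t)).trans (hbd t ht))
  have h := hd t ht
  have e : f t (x t) = ((x t).2 / q t, -μ * q t * (x t).1) := by simp only [f, h1, h2]
  rw [e] at h
  exact ⟨h.fst, h.snd⟩

lemma lift_quot (F v : ℝ → ℝ) (a b : ℝ) (hv : Continuous v)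
    (hF : ∀ t ∈ Icc a b, HasDerivAt F (v t) t) (x y : ℝ) (hx : x ∈ Icc a b) (hy : y ∈ Icc a b) :
    (x - y) * ∫ s in (0:ℝ)..1, v (y + (x - y) * s) = F x - F y := by
  rw [intervalIntegral.mul_integral_comp_add_mul]
  simp only [mul_zero, add_zero, mul_one, add_sub_cancel]
  apply intervalIntegral.integral_eq_sub_of_hasDerivAt
  · intro t ht
    exact hF t ((uIcc_subset_Icc hy hx) ht)
  · exact hv.intervalIntegrable _ _

lemma hasDerivAt_mul_cont (f g : ℝ → ℝ) (f' : ℝ) (hf : HasDerivAt f f' 0) (h0 : f 0 = 0)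
    (hg : ContinuousAt g 0) : HasDerivAt (fun h => f h * g h) (f' * g 0) 0 := by
  rw [hasDerivAt_iff_tendsto_slope] at hf ⊢
  have := hf.mul (hg.tendsto.mono_left (nhdsWithin_le_nhds (s := {0}ᶜ)))
  refine this.congr' ?_
  filter_upwards [self_mem_nhdsWithin] with h _
  simp only [slope_def_field, h0, zero_mul, sub_zero]
  ring

/-- final local contradiction -/
lemma local_contra (q w σ χ χ1 : ℝ → ℝ) (hq : Continuous q) (hqp : ∀ t, 0 < q t) (μ α γ k κ r x0 y0 chiTwo : ℝ)
    (hk : 0 < k) (hκ : 0 < κ) (hy0 : α < y0) (hyx : y0 ≤ x0) (hx0 : x0 < γ) (hr : r = (x0 - y0) / 2)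
    (hkR : k * ((γ - α) / 2) < π / 2)
    (h4 : ∀ x y x' y', α ≤ y → y ≤ y' → y' ≤ x' → x' ≤ x → x ≤ γ → x + y = x' + y' →
      q x * q y * Real.cos (k * ((x' - y') / 2)) ^ 4 ≤ q x' * q y' * Real.cos (k * ((x - y) / 2)) ^ 4)
    (hw : ∀ t ∈ Icc α γ, HasDerivAt w (σ t / q t) t ∧ HasDerivAt σ (- μ * q t * w t) t)
    (hχ : ∀ t ∈ Icc 0 ((γ - α) / 2), HasDerivAt χ (χ1 t) t)
    (hχ1 : HasDerivAt χ1 chiTwo r) (hχp : 0 < χ1 r)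
    (hineq : chiTwo - 2 * k * (Real.sin (k * r) / Real.cos (k * r)) * χ1 r + μ * χ r < 0)
    (hle : ∀ x y, α ≤ y → y ≤ x → x ≤ γ → w x - w y ≤ 2 * κ * χ ((x - y) / 2))
    (heq : w x0 - w y0 = 2 * κ * χ r)
    (hvx : σ x0 / q x0 = κ * χ1 r) (hvy : σ y0 / q y0 = κ * χ1 r) : False := by
  have hr0 : 0 ≤ r := by rw [hr]; linarith
  set V := κ * χ1 r with hV
  have hV0 : 0 < V := mul_pos hκ hχp
  have hsx : σ x0 = V * q x0 := by rw [← hvx]; field_simp [(hqp x0).ne']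
  have hsy : σ y0 = V * q y0 := by rw [← hvy]; field_simp [(hqp y0).ne']
  have hcos : ∀ t, 0 ≤ t → t ≤ (γ - α)/2 → 0 < Real.cos (k * t) := by
    intro t h0 h1
    have : k * t ≤ k * ((γ - α)/2) := by gcongr
    apply Real.cos_pos_of_mem_Ioo ⟨by have := mul_nonneg hk.le h0; linarith [Real.pi_pos], by linarith⟩
  have hcr := hcos r hr0 (by rw [hr]; linarith)
  let E : ℝ → ℝ := fun h => 2 * V * (Real.cos (k * r) / Real.cos (k * (r + h))) ^ 2 - 2 * κ * χ1 (r + h)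
    + (σ (x0 + h) - σ x0) * (q (x0 + h))⁻¹ + (σ (y0 - h) - σ y0) * (q (y0 - h))⁻¹
  have hE0 : E 0 = 0 := by
    simp only [E, add_zero, sub_zero, sub_self, zero_mul]
    rw [div_self hcr.ne', hV]; ring
  have hE' : HasDerivAt E (2 * κ * (2 * k * (Real.sin (k * r) / Real.cos (k * r)) * χ1 r - chiTwo - μ * χ r)) 0 := by
    have hadd : ∀ c : ℝ, HasDerivAt (fun h : ℝ => c + h) 1 0 := fun c => by
      simpa using (hasDerivAt_id (0:ℝ)).const_add c
    have hsub : ∀ c : ℝ, HasDerivAt (fun h : ℝ => c - h) (-1) 0 := fun c => by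
      simpa using (hasDerivAt_id (0:ℝ)).const_sub c
    have d1 : HasDerivAt (fun h => Real.cos (k * (r + h))) (-Real.sin (k * r) * k) 0 := by
      have := ((hadd r).const_mul k).cos
      simpa using this
    have d2 := (((hasDerivAt_const (0:ℝ) (Real.cos (k * r))).div d1 (by simpa using hcr.ne')).pow 2).const_mul (2 * V)
    have d3 : HasDerivAt (fun h => 2 * κ * χ1 (r + h)) (2 * κ * chiTwo) 0 := by
      have h1 : HasDerivAt χ1 chiTwo (r + 0) := by simpa using hχ1
      have := (h1.comp 0 (hadd r)).const_mul (2 * κ)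
      simpa using this
    have d4 : HasDerivAt (fun h => (σ (x0 + h) - σ x0) * (q (x0 + h))⁻¹) ((-μ * q x0 * w x0) * (q (x0+0))⁻¹) 0 := by
      apply hasDerivAt_mul_cont (fun h => (σ (x0 + h) - σ x0)) (fun h => (q (x0 + h))⁻¹)
      · have h1 : HasDerivAt σ (-μ * q x0 * w x0) (x0 + 0) := by
          simpa using (hw x0 ⟨by linarith, by linarith⟩).2
        have := (h1.comp 0 (hadd x0)).sub_const (σ x0)
        simpa using this
      · simp
      · apply ContinuousAt.inv₀
        · fun_prop
        · exact (hqp _).ne'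
    have d5 : HasDerivAt (fun h => (σ (y0 - h) - σ y0) * (q (y0 - h))⁻¹) ((μ * q y0 * w y0) * (q (y0-0))⁻¹) 0 := by
      apply hasDerivAt_mul_cont (fun h => (σ (y0 - h) - σ y0)) (fun h => (q (y0 - h))⁻¹)
      · have h1 : HasDerivAt σ (-μ * q y0 * w y0) (y0 - 0) := by
          simpa using (hw y0 ⟨by linarith, by linarith⟩).2
        have := (h1.comp 0 (hsub y0)).sub_const (σ y0)
        simpa using this
      · simp
      · apply ContinuousAt.inv₀
        · fun_prop
        · exact (hqp _).ne'
    have d := ((d2.sub d3).add d4).add d5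
    refine d.congr_deriv ?_
    have q1 := (hqp x0).ne'
    have q2 := (hqp y0).ne'
    have e1 : -μ * q x0 * w x0 * (q x0)⁻¹ + μ * q y0 * w y0 * (q y0)⁻¹ = - μ * (w x0 - w y0) := by
      field_simp; ring
    simp only [add_zero, sub_zero, Pi.div_apply, Pi.pow_apply]
    rw [add_assoc, e1, heq, hV]
    field_simp
    push_cast
    ring
  have hEpos : ∀ᶠ h in nhdsWithin 0 (Ioi 0), 0 < E h := by
    have hpos : 0 < 2 * κ * (2 * k * (Real.sin (k * r) / Real.cos (k * r)) * χ1 r - chiTwo - μ * χ r) := by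
      apply mul_pos (by positivity); linarith
    have := (hasDerivAt_iff_tendsto_slope.1 hE').eventually (lt_mem_nhds hpos)
    have h2 : ∀ᶠ h in nhdsWithin (0:ℝ) (Ioi 0), 0 < slope E 0 h :=
      this.filter_mono (nhdsWithin_mono _ (fun x (hx : 0 < x) => hx.ne'))
    filter_upwards [h2, self_mem_nhdsWithin] with h hh (h0 : 0 < h)
    rw [slope_def_field, hE0, sub_zero, sub_zero] at hh
    exact (div_pos_iff_of_pos_right h0).1 hh
  obtain ⟨ε, hε0, hε⟩ := (mem_nhdsGT_iff_exists_Ioo_subset.1 hEpos)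
  have hε0 : 0 < ε := hε0
  set δ := min (ε / 2) (min (γ - x0) (y0 - α)) with hδ
  have hδ0 : 0 < δ := lt_min (by linarith) (lt_min (by linarith) (by linarith))
  have hδ1 : δ < ε := lt_of_le_of_lt (min_le_left _ _) (by linarith)
  have hδ2 : δ ≤ γ - x0 := (min_le_right _ _).trans (min_le_left _ _)
  have hδ3 : δ ≤ y0 - α := (min_le_right _ _).trans (min_le_right _ _)
  let Dd : ℝ → ℝ := fun h => w (x0 + h) - w (y0 - h) - 2 * κ * χ (r + h)
  have hDd : ∀ h ∈ Icc 0 δ, HasDerivAt Dd (σ (x0+h) / q (x0+h) + σ (y0-h) / q (y0-h) - 2 * κ * χ1 (r + h)) h := by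
    intro h hh
    have hadd : ∀ c : ℝ, HasDerivAt (fun h : ℝ => c + h) 1 h := fun c => by
      simpa using (hasDerivAt_id h).const_add c
    have hsub : ∀ c : ℝ, HasDerivAt (fun h : ℝ => c - h) (-1) h := fun c => by
      simpa using (hasDerivAt_id h).const_sub c
    have d1 := (hw (x0+h) ⟨by linarith [hh.1], by linarith [hh.2]⟩).1.comp h (hadd x0)
    have d2 := (hw (y0-h) ⟨by linarith [hh.2], by linarith [hh.1]⟩).1.comp h (hsub y0)
    have d3 := ((hχ (r+h) ⟨by linarith [hh.1], by rw [hr]; linarith [hh.2]⟩).comp h (hadd r)).const_mul (2 * κ)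
    exact ((d1.sub d2).sub d3).congr_deriv (by ring)
  have hmono : StrictMonoOn Dd (Icc 0 δ) := by
    apply strictMonoOn_of_deriv_pos (convex_Icc _ _)
    · exact fun h hh => (hDd h hh).continuousAt.continuousWithinAt
    · intro h hh
      rw [interior_Icc] at hh
      rw [(hDd h ⟨hh.1.le, hh.2.le⟩).deriv]
      have hEh : 0 < E h := hε ⟨hh.1, by linarith [hh.2]⟩
      refine lt_of_lt_of_le hEh ?_
      have hh1 := hh.1
      have hh2 := hh.2
      have hcrh := hcos (r+h) (by linarith) (by rw [hr]; linarith)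
      have q1 := hqp (x0+h)
      have q2 := hqp (y0-h)
      have key := h4 (x0+h) (y0-h) x0 y0 (by linarith) (by linarith) hyx (by linarith) (by linarith) (by ring)
      rw [show (x0 + h - (y0 - h))/2 = r + h by rw [hr]; ring, ← hr] at key
      -- AM-GM
      set c := (Real.cos (k * r) / Real.cos (k * (r + h))) ^ 2 with hc
      have hc0 : 0 ≤ c := sq_nonneg _
      set A := q x0 * (q (x0+h))⁻¹ with hA
      set B := q y0 * (q (y0-h))⁻¹ with hB
      have hA0 : 0 < A := mul_pos (hqp _) (inv_pos.2 q1)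
      have hB0 : 0 < B := mul_pos (hqp _) (inv_pos.2 q2)
      have hAB : c ^ 2 ≤ A * B := by
        have : c^2 = Real.cos (k * r)^4 / Real.cos (k * (r + h))^4 := by rw [hc]; rw [div_pow, div_pow]; ring
        rw [this, hA, hB, div_le_iff₀ (by positivity)]
        have : q x0 * (q (x0 + h))⁻¹ * (q y0 * (q (y0 - h))⁻¹) * Real.cos (k * (r + h)) ^ 4
          = (q x0 * q y0 * Real.cos (k * (r + h)) ^ 4) / (q (x0+h) * q (y0-h)) := by
          field_simp
        rw [this, le_div_iff₀ (by positivity)]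
        linarith
      have hsum : 2 * c ≤ A + B := by
        by_contra hcon
        push Not at hcon
        nlinarith [sq_nonneg (A - B)]
      have e1 : σ (x0+h) / q (x0+h) = V * A + (σ (x0+h) - σ x0) * (q (x0+h))⁻¹ := by
        rw [hA, hsx]; field_simp; ring
      have e2 : σ (y0-h) / q (y0-h) = V * B + (σ (y0-h) - σ y0) * (q (y0-h))⁻¹ := by
        rw [hB, hsy]; field_simp; ring
      rw [e1, e2]
      have := mul_le_mul_of_nonneg_left hsum hV0.le
      simp only [E]
      linarith
  have hpos := hmono ⟨le_refl _, hδ0.le⟩ ⟨hδ0.le, le_refl _⟩ hδ0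
  have h0 : Dd 0 = 0 := by simp only [Dd, add_zero, sub_zero]; linarith
  have hle' := hle (x0 + δ) (y0 - δ) (by linarith) (by linarith) (by linarith)
  rw [show (x0 + δ - (y0 - δ))/2 = r + δ by rw [hr]; ring] at hle'
  rw [h0] at hpos
  simp only [Dd] at hpos
  linarith

lemma sigma_pos (q w σ χ χ1 χ2 : ℝ → ℝ) (hq : Continuous q) (hqp : ∀ t, 0 < q t) (μ α β k : ℝ)
    (hk : 0 < k) (hμ : 0 < μ)
    (hkR : k * ((β - α) / 2) < π / 2)
    (h4 : ∀ x y x' y', α ≤ y → y ≤ y' → y' ≤ x' → x' ≤ x → x ≤ β → x + y = x' + y' →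
      q x * q y * Real.cos (k * ((x' - y') / 2)) ^ 4 ≤ q x' * q y' * Real.cos (k * ((x - y) / 2)) ^ 4)
    (hwα : w α = -1) (hσα : σ α = 0)
    (hw : ∀ t ∈ Icc α β, HasDerivAt w (σ t / q t) t ∧ HasDerivAt σ (- μ * q t * w t) t)
    (hχ0 : χ 0 = 0)
    (hχ : ∀ r ∈ Icc 0 ((β - α) / 2), HasDerivAt χ (χ1 r) r ∧ HasDerivAt χ1 (χ2 r) r ∧
      0 < χ1 r ∧ χ2 r - 2 * k * (Real.sin (k * r) / Real.cos (k * r)) * χ1 r + μ * χ r < 0) :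
    ∀ t ∈ Ioc α β, 0 < σ t := by
  by_contra hcon
  push Not at hcon
  obtain ⟨t1, ht1, hσt1⟩ := hcon
  have hαβ : α < β := lt_of_lt_of_le ht1.1 ht1.2
  have hσc : ContinuousOn σ (Icc α β) := fun t ht => (hw t ht).2.continuousAt.continuousWithinAt
  -- positivity near α
  have hnear : ∀ᶠ t in nhdsWithin α (Ioi α), 0 < σ t := by
    have hd := (hw α ⟨le_refl _, hαβ.le⟩).2
    rw [hwα] at hd
    have hpos : 0 < -μ * q α * (-1) := by have := hqp α; nlinarith
    have := (hasDerivAt_iff_tendsto_slope.1 hd).eventually (lt_mem_nhds hpos)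
    have h2 : ∀ᶠ h in nhdsWithin α (Ioi α), 0 < slope σ α h :=
      this.filter_mono (nhdsWithin_mono _ (fun x (hx : α < x) => hx.ne'))
    filter_upwards [h2, self_mem_nhdsWithin] with h hh (h0 : α < h)
    rw [slope_def_field, hσα, sub_zero] at hh
    exact (div_pos_iff_of_pos_right (by linarith)).1 hh
  obtain ⟨a1, ha1, hna⟩ := (mem_nhdsGT_iff_exists_Ioo_subset.1 hnear)
  have ha1 : α < a1 := ha1
  set a2 := (α + a1) / 2 with ha2
  have hb : α < a2 := by rw [ha2]; linarith
  have hb' : a2 < a1 := by rw [ha2]; linarith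
  have ha2t : a2 < t1 := by
    by_contra h
    push Not at h
    have : 0 < σ t1 := hna ⟨ht1.1, by linarith⟩
    linarith
  obtain ⟨γ, hγm, hγl⟩ : ∃ γ, IsLeast (Icc a2 β ∩ {t | σ t ≤ 0}) γ := by
    apply IsCompact.exists_isLeast
    · have hc : ContinuousOn σ (Icc a2 β) := hσc.mono (Icc_subset_Icc_left hb.le)
      exact isCompact_Icc.of_isClosed_subset (hc.preimage_isClosed_of_isClosed isClosed_Icc isClosed_Iic) inter_subset_left
    · exact ⟨t1, ⟨ha2t.le, ht1.2⟩, hσt1⟩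
  have hγ1 : a2 ≤ γ := hγm.1.1
  have hγβ : γ ≤ β := hγm.1.2
  have hσγ : σ γ ≤ 0 := hγm.2
  have hαγ : α < γ := by linarith
  have hσp : ∀ t ∈ Ioo α γ, 0 < σ t := by
    intro t ht
    by_contra h
    push Not at h
    rcases lt_or_ge t a1 with h1 | h1
    · exact absurd (hna ⟨ht.1, h1⟩) (not_lt.2 h)
    · have := hγl ⟨⟨by linarith, by linarith [ht.2]⟩, h⟩
      linarith [ht.2]
  set R := (γ - α) / 2 with hR
  have hRle : R ≤ (β - α) / 2 := by rw [hR]; linarith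
  have hR0 : 0 < R := by rw [hR]; linarith
  have hχ' : ∀ r ∈ Icc 0 R, HasDerivAt χ (χ1 r) r ∧ HasDerivAt χ1 (χ2 r) r ∧
      0 < χ1 r ∧ χ2 r - 2 * k * (Real.sin (k * r) / Real.cos (k * r)) * χ1 r + μ * χ r < 0 :=
    fun r hr => hχ r ⟨hr.1, hr.2.trans hRle⟩
  -- global extensions
  let cl : ℝ → ℝ := fun t => max α (min t γ)
  have hclm : ∀ t, cl t ∈ Icc α γ := fun t => ⟨le_max_left _ _, max_le hαγ.le (min_le_right _ _)⟩
  have hclid : ∀ t ∈ Icc α γ, cl t = t := fun t ht => by simp only [cl]; rw [min_eq_left ht.2, max_eq_right ht.1]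
  have hclc : Continuous cl := by fun_prop
  let v : ℝ → ℝ := fun t => σ (cl t) / q t
  have hvc : Continuous v := by
    refine Continuous.div ?_ hq (fun t => (hqp t).ne')
    exact hσc.comp_continuous hclc (fun t => ⟨(hclm t).1, (hclm t).2.trans hγβ⟩)
  have hwv : ∀ t ∈ Icc α γ, HasDerivAt w (v t) t := by
    intro t ht
    have := (hw t ⟨ht.1, ht.2.trans hγβ⟩).1
    simp only [v, hclid t ht]; exact this
  let cr : ℝ → ℝ := fun t => max 0 (min t R)
  have hcrm : ∀ t, cr t ∈ Icc 0 R := fun t => ⟨le_max_left _ _, max_le hR0.le (min_le_right _ _)⟩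
  have hcrid : ∀ t ∈ Icc 0 R, cr t = t := fun t ht => by simp only [cr]; rw [min_eq_left ht.2, max_eq_right ht.1]
  have hcrc : Continuous cr := by fun_prop
  let ψ : ℝ → ℝ := fun t => χ1 (cr t)
  have hψc : Continuous ψ := by
    have : ContinuousOn χ1 (Icc 0 R) := fun t ht => (hχ' t ht).2.1.continuousAt.continuousWithinAt
    exact this.comp_continuous hcrc hcrm
  have hψp : ∀ t, 0 < ψ t := fun t => (hχ' _ (hcrm t)).2.2.1
  have hχψ : ∀ t ∈ Icc 0 R, HasDerivAt χ (ψ t) t := by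
    intro t ht
    simp only [ψ, hcrid t ht]; exact (hχ' t ht).1
  let Nn : ℝ × ℝ → ℝ := fun p => ∫ s in (0:ℝ)..1, v (p.2 + (p.1 - p.2) * s)
  let M : ℝ → ℝ := fun r => ∫ s in (0:ℝ)..1, ψ (0 + (r - 0) * s)
  have hNc : Continuous Nn := by
    apply intervalIntegral.continuous_parametric_intervalIntegral_of_continuous'
    fun_prop
  have hMc : Continuous M := by
    apply intervalIntegral.continuous_parametric_intervalIntegral_of_continuous'
    fun_prop
  have hMp : ∀ r, 0 < M r := by
    intro r
    apply intervalIntegral.intervalIntegral_pos_of_pos _ (fun s => hψp _) one_pos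
    apply Continuous.intervalIntegrable
    fun_prop
  let Φ : ℝ × ℝ → ℝ := fun p => Nn p / M ((p.1 - p.2) / 2)
  have hΦc : Continuous Φ := by
    refine hNc.div ?_ (fun p => (hMp _).ne')
    exact hMc.comp (by fun_prop)
  let T : Set (ℝ × ℝ) := (Icc α γ ×ˢ Icc α γ) ∩ {p | p.2 ≤ p.1}
  have hTc : IsCompact T := (isCompact_Icc.prod isCompact_Icc).inter_right (isClosed_le continuous_snd continuous_fst)
  set mid := (α + γ) / 2 with hmid
  have hm1 : α < mid := by rw [hmid]; linarith
  have hm2 : mid < γ := by rw [hmid]; linarith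
  have hmT : (mid, mid) ∈ T := ⟨⟨⟨hm1.le, hm2.le⟩, ⟨hm1.le, hm2.le⟩⟩, le_refl mid⟩
  obtain ⟨⟨x0, y0⟩, hxyT, hmax⟩ := hTc.exists_isMaxOn ⟨_, hmT⟩ hΦc.continuousOn
  set κ := Φ (x0, y0) with hκ
  have hx0 : x0 ∈ Icc α γ := hxyT.1.1
  have hy0 : y0 ∈ Icc α γ := hxyT.1.2
  have hyx : y0 ≤ x0 := hxyT.2
  have hdiag : ∀ t, Nn (t, t) = v t := by intro t; simp [Nn]
  have hM0 : M 0 = ψ 0 := by simp [M]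
  have hκ0 : 0 < κ := by
    have h1 : Φ (mid, mid) ≤ κ := hmax hmT
    refine lt_of_lt_of_le ?_ h1
    apply div_pos _ (hMp _)
    rw [hdiag]
    simp only [v]
    rw [hclid mid ⟨hm1.le, hm2.le⟩]
    exact div_pos (hσp mid ⟨hm1, hm2⟩) (hqp _)
  have hNw : ∀ x y, x ∈ Icc α γ → y ∈ Icc α γ → (x - y) * Nn (x, y) = w x - w y :=
    fun x y hx hy => lift_quot w v α γ hvc hwv x y hx hy
  have hMχ : ∀ r ∈ Icc 0 R, r * M r = χ r := by
    intro r hr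
    have := lift_quot χ ψ 0 R hψc hχψ r 0 hr ⟨le_refl _, hR0.le⟩
    rw [hχ0, sub_zero, sub_zero] at this
    simpa [M] using this
  have hle : ∀ x y, α ≤ y → y ≤ x → x ≤ γ → w x - w y ≤ 2 * κ * χ ((x - y) / 2) := by
    intro x y h1 h2 h3
    have hx : x ∈ Icc α γ := ⟨by linarith, h3⟩
    have hy : y ∈ Icc α γ := ⟨h1, by linarith⟩
    have hΦ : Φ (x, y) ≤ κ := hmax (show (x,y) ∈ T from ⟨⟨hx, hy⟩, h2⟩)
    have h5 : Nn (x, y) ≤ κ * M ((x - y) / 2) := by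
      rwa [← div_le_iff₀ (hMp _)]
    rw [← hNw x y hx hy, ← hMχ ((x-y)/2) ⟨by linarith, by rw [hR]; linarith⟩]
    have := mul_le_mul_of_nonneg_left h5 (show 0 ≤ x - y by linarith)
    linarith
  set r := (x0 - y0) / 2 with hr
  have hrm : r ∈ Icc 0 R := ⟨by rw [hr]; linarith, by rw [hr, hR]; linarith [hx0.2, hy0.1]⟩
  have hNκ : Nn (x0, y0) = κ * M r := by
    rw [hκ]; simp only [Φ]; rw [← hr, div_mul_cancel₀ _ (hMp _).ne']
  have heq : w x0 - w y0 = 2 * κ * χ r := by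
    rw [← hNw x0 y0 hx0 hy0, hNκ, ← hMχ r hrm, hr]; ring
  have hchiOne : 0 < χ1 r := (hχ' r hrm).2.2.1
  have hvγ : v γ ≤ 0 := by
    simp only [v]; rw [hclid γ ⟨hαγ.le, le_refl _⟩]
    exact div_nonpos_of_nonpos_of_nonneg hσγ (hqp _).le
  have hvα : v α = 0 := by
    simp only [v]; rw [hclid α ⟨le_refl _, hαγ.le⟩, hσα, zero_div]
  have hκχ : 0 < κ * χ1 r := mul_pos hκ0 hchiOne
  have main : α < y0 ∧ x0 < γ ∧ v x0 = κ * χ1 r ∧ v y0 = κ * χ1 r := by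
    rcases eq_or_lt_of_le hyx with h | h
    · have hr0 : r = 0 := by rw [hr, h]; simp
      have hv : v x0 = κ * χ1 r := by
        have := hNκ
        rw [h, hdiag, hr0, hM0] at this
        rw [this, hr0]
        simp only [ψ]; rw [hcrid 0 ⟨le_refl _, hR0.le⟩]
      have h1 : x0 ≠ γ := by rintro h'; rw [h'] at hv; linarith
      have h2 : x0 ≠ α := by rintro h'; rw [h'] at hv; linarith
      exact ⟨by rw [h]; exact lt_of_le_of_ne hx0.1 h2.symm, lt_of_le_of_ne hx0.2 h1, hv, by rw [h]; exact hv⟩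
    · -- derivative in x
      have dx : HasDerivAt (fun x => w x - w y0 - 2 * κ * χ ((x - y0) / 2)) (v x0 - κ * χ1 r) x0 := by
        have h1 : HasDerivAt (fun x : ℝ => (x - y0) / 2) (1/2) x0 := ((hasDerivAt_id x0).sub_const y0).div_const 2
        have h2 := (((hχ' r hrm).1).comp x0 h1).const_mul (2 * κ)
        exact (((hwv x0 hx0).sub_const (w y0)).sub h2).congr_deriv (by ring)
      have dy : HasDerivAt (fun y => w x0 - w y - 2 * κ * χ ((x0 - y) / 2)) (-v y0 + κ * χ1 r) y0 := by
        have h1 : HasDerivAt (fun y : ℝ => (x0 - y) / 2) (-1/2) y0 := ((hasDerivAt_id y0).const_sub x0).div_const 2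
        have h2 := (((hχ' r hrm).1).comp y0 h1).const_mul (2 * κ)
        exact (((hwv y0 hy0).const_sub (w x0)).sub h2).congr_deriv (by ring)
      have vx_ge : κ * χ1 r ≤ v x0 := by
        by_contra hc
        push Not at hc
        -- negative derivative: value positive slightly left
        have := (hasDerivAt_iff_tendsto_slope.1 dx).eventually (gt_mem_nhds (show v x0 - κ * χ1 r < 0 by linarith))
        have h2 : ∀ᶠ x in nhdsWithin x0 (Iio x0), slope (fun x => w x - w y0 - 2 * κ * χ ((x - y0) / 2)) x0 x < 0 :=
          this.filter_mono (nhdsWithin_mono _ (fun x (hx : x < x0) => hx.ne))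
        have h3 : ∀ᶠ x in nhdsWithin x0 (Iio x0), y0 < x := nhdsWithin_le_nhds (lt_mem_nhds h)
        obtain ⟨x, ⟨hx1, hx2⟩, hx3⟩ := ((h2.and h3).and self_mem_nhdsWithin).exists
        have hx3 : x < x0 := hx3
        rw [slope_def_field, ← hr, heq, sub_self, sub_zero] at hx1
        have h6 := (div_neg_iff.1 hx1).resolve_right (fun h => by linarith [h.2])
        have := hle x y0 hy0.1 hx2.le (hx3.le.trans hx0.2)
        linarith [h6.1]
      have vy_ge : κ * χ1 r ≤ v y0 := by
        by_contra hc
        push Not at hc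
        have := (hasDerivAt_iff_tendsto_slope.1 dy).eventually (lt_mem_nhds (show 0 < -v y0 + κ * χ1 r by linarith))
        have h2 : ∀ᶠ y in nhdsWithin y0 (Ioi y0), 0 < slope (fun y => w x0 - w y - 2 * κ * χ ((x0 - y) / 2)) y0 y :=
          this.filter_mono (nhdsWithin_mono _ (fun x (hx : y0 < x) => hx.ne'))
        have h3 : ∀ᶠ x in nhdsWithin y0 (Ioi y0), x < x0 := nhdsWithin_le_nhds (gt_mem_nhds h)
        obtain ⟨y, ⟨hx1, hx2⟩, hx3⟩ := ((h2.and h3).and self_mem_nhdsWithin).exists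
        have hx3 : y0 < y := hx3
        rw [slope_def_field, ← hr, heq, sub_self, sub_zero] at hx1
        have h6 := (div_pos_iff_of_pos_right (by linarith)).1 hx1
        have := hle x0 y (hy0.1.trans hx3.le) hx2.le hx0.2
        linarith
      have h1 : x0 ≠ γ := by rintro h'; rw [h'] at vx_ge; linarith
      have h2 : y0 ≠ α := by rintro h'; rw [h'] at vy_ge; linarith
      have h1' : x0 < γ := lt_of_le_of_ne hx0.2 h1
      have h2' : α < y0 := lt_of_le_of_ne hy0.1 h2.symm
      have mx : IsLocalMax (fun x => w x - w y0 - 2 * κ * χ ((x - y0) / 2)) x0 := by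
        filter_upwards [gt_mem_nhds h1', lt_mem_nhds h] with x hx1 hx2
        rw [← hr, heq, sub_self]
        linarith [hle x y0 hy0.1 hx2.le hx1.le]
      have my : IsLocalMax (fun y => w x0 - w y - 2 * κ * χ ((x0 - y) / 2)) y0 := by
        filter_upwards [gt_mem_nhds h, lt_mem_nhds h2'] with y hx1 hx2
        rw [← hr, heq, sub_self]
        linarith [hle x0 y hx2.le hx1.le hx0.2]
      have z1 := mx.hasDerivAt_eq_zero dx
      have z2 := my.hasDerivAt_eq_zero dy
      exact ⟨h2', h1', by linarith, by linarith⟩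
  obtain ⟨m1, m2, m3, m4⟩ := main
  simp only [v] at m3 m4
  rw [hclid x0 hx0] at m3
  rw [hclid y0 hy0] at m4
  refine local_contra q w σ χ χ1 hq hqp μ α γ k κ r x0 y0 (χ2 r) hk hκ0 m1 hyx m2 hr ?_ ?_ ?_ ?_
    (hχ' r hrm).2.1 hchiOne (hχ' r hrm).2.2.2 hle heq m3 m4
  · exact lt_of_le_of_lt (mul_le_mul_of_nonneg_left hRle hk.le) hkR
  · intro x y x' y' a1 a2 a3 a4 a5 a6
    exact h4 x y x' y' a1 a2 a3 a4 (a5.trans hγβ) a6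
  · exact fun t ht => hw t ⟨ht.1, ht.2.trans hγβ⟩
  · exact fun t ht => (hχ' t ht).1

lemma picone (q w σ g g' : ℝ → ℝ) (hq : Continuous q) (hqp : ∀ t, 0 < q t) (μ a b : ℝ) (hμ : 0 < μ) (hab : a < b)
    (hw : ∀ t ∈ Icc a b, HasDerivAt w (σ t / q t) t ∧ HasDerivAt σ (- μ * q t * w t) t)
    (hσ : ∀ t ∈ Icc a b, 0 < σ t)
    (hg : ∀ t, HasDerivAt g (g' t) t) (hg' : Continuous g') :
    μ * ((∫ t in a..b, g t ^ 2 * q t) * (∫ t in a..b, q t) - (∫ t in a..b, g t * q t) ^ 2) ≤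
      (∫ t in a..b, q t) * (∫ t in a..b, g' t ^ 2 * q t) := by
  have hgc : Continuous g := continuous_iff_continuousAt.2 fun t => (hg t).continuousAt
  set Q0 := ∫ t in a..b, q t with hQ0
  have hQ0p : 0 < Q0 := intervalIntegral.intervalIntegral_pos_of_pos (hq.intervalIntegrable _ _) hqp hab
  set m := (∫ t in a..b, g t * q t) / Q0 with hm
  let S : ℝ → ℝ := fun t => ∫ s in a..t, (g s - m) * q s
  have hintg : Continuous fun s => (g s - m) * q s := by fun_prop
  have hS : ∀ t, HasDerivAt S ((g t - m) * q t) t := fun t =>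
    intervalIntegral.integral_hasDerivAt_right (hintg.intervalIntegrable _ _) (hintg.stronglyMeasurableAtFilter _ _) hintg.continuousAt
  have hSc : Continuous S := continuous_iff_continuousAt.2 fun t => (hS t).continuousAt
  have hSa : S a = 0 := by simp [S]
  have hSb : S b = 0 := by
    simp only [S]
    have : (fun s => (g s - m) * q s) = fun s => g s * q s - m * q s := by ext; ring
    rw [this, intervalIntegral.integral_sub, intervalIntegral.integral_const_mul, ← hQ0, hm]
    · field_simp; ring
    · exact (hgc.mul hq).intervalIntegrable _ _
    · exact (continuous_const.mul hq).intervalIntegrable _ _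
  set P := ∫ t in a..b, (g t - m) ^ 2 * q t with hP
  set Q := ∫ t in a..b, S t ^ 2 / q t with hQ
  set G := ∫ t in a..b, g' t ^ 2 * q t with hG
  have hqne : ∀ t, q t ≠ 0 := fun t => (hqp t).ne'
  have cP : Continuous fun t => (g t - m) ^ 2 * q t := by fun_prop
  have cQ : Continuous fun t => S t ^ 2 / q t := (hSc.pow 2).div hq hqne
  have cG : Continuous fun t => g' t ^ 2 * q t := by fun_prop
  have hPval : P * Q0 = (∫ t in a..b, g t ^ 2 * q t) * Q0 - (∫ t in a..b, g t * q t) ^ 2 := by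
    have e1 : P = (∫ t in a..b, g t ^ 2 * q t) - 2 * m * (∫ t in a..b, g t * q t) + m^2 * Q0 := by
      rw [hP]
      have : (fun t => (g t - m) ^ 2 * q t) = fun t => (g t ^ 2 * q t - 2 * m * (g t * q t)) + m^2 * q t := by
        ext; ring
      rw [this, intervalIntegral.integral_add, intervalIntegral.integral_sub, intervalIntegral.integral_const_mul,
        intervalIntegral.integral_const_mul]
      all_goals (apply Continuous.intervalIntegrable; fun_prop)
    rw [e1, hm]; field_simp; ring
  -- (i)
  have h1 : μ * Q ≤ P := by
    let F : ℝ → ℝ := fun t => w t * S t ^ 2 / σ t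
    let F' : ℝ → ℝ := fun t => S t ^ 2 / q t + 2 * w t * S t * ((g t - m) * q t) / σ t + μ * q t * (w t) ^ 2 * S t ^ 2 / σ t ^ 2
    have hF : ∀ t ∈ Icc a b, HasDerivAt F (F' t) t := by
      intro t ht
      have hs := (hσ t ht).ne'
      have hqt := hqne t
      have := (((hw t ht).1.mul ((hS t).pow 2))).div (hw t ht).2 hs
      refine this.congr_deriv ?_
      simp only [F', Pi.mul_apply, Pi.pow_apply]
      field_simp
      push_cast
      ring
    have hwc : ContinuousOn w (Icc a b) := fun t ht => (hw t ht).1.continuousAt.continuousWithinAt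
    have hσc : ContinuousOn σ (Icc a b) := fun t ht => (hw t ht).2.continuousAt.continuousWithinAt
    have cF' : ContinuousOn F' (Icc a b) := by
      have e1 : ContinuousOn (fun t => 2 * w t * S t * ((g t - m) * q t) / σ t) (Icc a b) :=
        ContinuousOn.div (((continuousOn_const.mul hwc).mul hSc.continuousOn).mul hintg.continuousOn) hσc
          (fun t ht => (hσ t ht).ne')
      have e2 : ContinuousOn (fun t => μ * q t * (w t) ^ 2 * S t ^ 2 / σ t ^ 2) (Icc a b) :=
        ContinuousOn.div ((((continuous_const.mul hq).continuousOn).mul (hwc.pow 2)).mul (hSc.pow 2).continuousOn)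
          (hσc.pow 2) (fun t ht => pow_ne_zero 2 (hσ t ht).ne')
      exact (cQ.continuousOn.add e1).add e2
    have iF' : IntervalIntegrable F' volume a b := by
      apply ContinuousOn.intervalIntegrable; rwa [uIcc_of_le hab.le]
    have hF0 : ∫ t in a..b, F' t = 0 := by
      rw [intervalIntegral.integral_eq_sub_of_hasDerivAt (f := F) _ iF']
      · simp [F, hSa, hSb]
      · intro t ht; rw [uIcc_of_le hab.le] at ht; exact hF t ht
    have hge : 0 ≤ ∫ t in a..b, ((g t - m) ^ 2 * q t - μ * (S t ^ 2 / q t)) + μ * F' t := by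
      apply intervalIntegral.integral_nonneg hab.le
      intro t ht
      have hs := (hσ t ht).ne'
      have hqt := hqne t
      have : ((g t - m) ^ 2 * q t - μ * (S t ^ 2 / q t)) + μ * F' t
        = ((g t - m) * q t + μ * q t * w t * S t / σ t) ^ 2 / q t := by
        simp only [F']; field_simp; ring
      rw [this]
      exact div_nonneg (sq_nonneg _) (hqp t).le
    rw [intervalIntegral.integral_add, intervalIntegral.integral_sub, intervalIntegral.integral_const_mul,
      intervalIntegral.integral_const_mul, hF0] at hge
    · linarith
    · exact cP.intervalIntegrable _ _
    · exact (continuous_const.mul cQ).intervalIntegrable _ _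
    · exact (cP.intervalIntegrable _ _).sub ((continuous_const.mul cQ).intervalIntegrable _ _)
    · exact iF'.const_mul _
  -- (ii)
  have h2 : P = - ∫ t in a..b, S t * g' t := by
    have e := intervalIntegral.integral_mul_deriv_eq_deriv_mul (a := a) (b := b) (u := fun t => g t - m) (v := S)
      (u' := g') (v' := fun t => (g t - m) * q t) (fun t _ => (hg t).sub_const m) (fun t _ => hS t)
      (hg'.intervalIntegrable _ _) (hintg.intervalIntegrable _ _)
    rw [hSa, hSb] at e
    have e2 : P = ∫ t in a..b, (g t - m) * ((g t - m) * q t) := by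
      rw [hP]; congr 1; ext; ring
    rw [e2, e]
    simp only [mul_zero, sub_zero, zero_sub]
    congr 2; ext; ring
  have h3 : 2 * P ≤ μ * Q + G / μ := by
    have : 2 * P = ∫ t in a..b, (-2) * (S t * g' t) := by
      rw [intervalIntegral.integral_const_mul, h2]; ring
    rw [this, hQ, hG, ← intervalIntegral.integral_const_mul, ← intervalIntegral.integral_div, ← intervalIntegral.integral_add]
    · apply intervalIntegral.integral_mono_on hab.le
      · apply Continuous.intervalIntegrable; fun_prop
      · exact ((continuous_const.mul cQ).add (cG.div_const _)).intervalIntegrable _ _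
      · intro t _
        have hqt := hqp t
        have : μ * (S t ^ 2 / q t) + g' t ^ 2 * q t / μ - (-2) * (S t * g' t) = (μ * S t + g' t * q t) ^ 2 / (μ * q t) := by
          field_simp; ring
        have h5 : 0 ≤ (μ * S t + g' t * q t) ^ 2 / (μ * q t) := by positivity
        linarith
    · exact (continuous_const.mul cQ).intervalIntegrable _ _
    · exact (cG.div_const _).intervalIntegrable _ _
  have h4 : μ * P ≤ G := by
    have : P ≤ G / μ := by linarith
    rwa [le_div_iff₀ hμ, mul_comm] at this
  rw [← hPval]
  have := mul_le_mul_of_nonneg_left h4 hQ0p.le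
  linarith

theorem oneD (q g g' : ℝ → ℝ) (a b D d μ : ℝ) (hab : a < b) (hd : 0 < d) (hbd : b - a ≤ d) (hdD : d ≤ D)
    (hμ0 : 0 < μ) (hμ : μ < 3 * π ^ 2 / D ^ 2 + 1 * (D - d) ^ 3 / D ^ 5)
    (hqc : ContinuousOn q (Ioo a b)) (hqp : ∀ t ∈ Ioo a b, 0 < q t) (hqi : IntegrableOn q (Ioo a b))
    (h4 : ∀ x y x' y', a < y → y ≤ y' → y' ≤ x' → x' ≤ x → x < b → x + y = x' + y' →
      q x * q y * Real.cos (π / D * ((x' - y') / 2)) ^ 4 ≤ q x' * q y' * Real.cos (π / D * ((x - y) / 2)) ^ 4)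
    (hg : ∀ t, HasDerivAt g (g' t) t) (hg' : Continuous g') :
    μ * ((∫ t in Ioo a b, g t ^ 2 * q t) * (∫ t in Ioo a b, q t) - (∫ t in Ioo a b, g t * q t) ^ 2) ≤
      (∫ t in Ioo a b, q t) * (∫ t in Ioo a b, g' t ^ 2 * q t) := by
  have hgc : Continuous g := continuous_iff_continuousAt.2 fun t => (hg t).continuousAt
  have hD : 0 < D := by linarith
  have hpi := Real.pi_pos
  have hk : 0 < π / D := by positivity
  have hcomp : ∀ α1 β, a < α1 → α1 < β → β < b →
      μ * ((∫ t in Icc α1 β, g t ^ 2 * q t) * (∫ t in Icc α1 β, q t) - (∫ t in Icc α1 β, g t * q t) ^ 2) ≤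
      (∫ t in Icc α1 β, q t) * (∫ t in Icc α1 β, g' t ^ 2 * q t) := by
    intro α1 β h1 h2 h3
    set α := (a + α1) / 2 with hα
    have ha1 : a < α := by rw [hα]; linarith
    have ha2 : α < α1 := by rw [hα]; linarith
    let cl : ℝ → ℝ := fun t => max α (min t β)
    have hclm : ∀ t, cl t ∈ Icc α β := fun t => ⟨le_max_left _ _, max_le (by linarith) (min_le_right _ _)⟩
    have hclid : ∀ t ∈ Icc α β, cl t = t := fun t ht => by simp only [cl]; rw [min_eq_left ht.2, max_eq_right ht.1]
    have hclI : ∀ t, cl t ∈ Ioo a b := fun t => ⟨by linarith [(hclm t).1], by linarith [(hclm t).2]⟩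
    have hclc : Continuous cl := by fun_prop
    let q' : ℝ → ℝ := fun t => q (cl t)
    have hq'c : Continuous q' := hqc.comp_continuous hclc hclI
    have hq'p : ∀ t, 0 < q' t := fun t => hqp _ (hclI t)
    have hq'e : ∀ t ∈ Icc α β, q' t = q t := fun t ht => by simp only [q', hclid t ht]
    obtain ⟨w, σ, hw0, hσ0, hw⟩ := linODE q' hq'c hq'p μ α β hμ0 (by linarith)
    obtain ⟨χ, χ1, χ2, hχ0, hχ⟩ := model_fn D d μ ((β - α)/2) hd hdD hμ0 hμ (by linarith) (by linarith)
    have hkR : π / D * ((β - α) / 2) < π / 2 := by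
      have : π / D * ((β - α) / 2) < π / D * (D / 2) := by
        apply mul_lt_mul_of_pos_left _ hk; linarith
      have h5 : π / D * (D / 2) = π / 2 := by field_simp
      linarith
    have hσ := sigma_pos q' w σ χ χ1 χ2 hq'c hq'p μ α β (π / D) hk hμ0 hkR (by
      intro x y x' y' c1 c2 c3 c4 c5 c6
      rw [hq'e x ⟨by linarith, c5⟩, hq'e y ⟨c1, by linarith⟩, hq'e x' ⟨by linarith, by linarith⟩, hq'e y' ⟨by linarith, by linarith⟩]
      exact h4 x y x' y' (by linarith) c2 c3 c4 (by linarith) c6) hw0 hσ0 hw hχ0 hχ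
    have := picone q' w σ g g' hq'c hq'p μ α1 β hμ0 h2 (fun t ht => hw t ⟨by linarith [ht.1], ht.2⟩)
      (fun t ht => hσ t ⟨by linarith [ht.1], ht.2⟩) hg hg'
    have conv : ∀ f : ℝ → ℝ, ∫ t in α1..β, f t * q' t = ∫ t in Icc α1 β, f t * q t := by
      intro f
      rw [intervalIntegral.integral_of_le h2.le, ← integral_Icc_eq_integral_Ioc]
      apply setIntegral_congr_fun measurableSet_Icc
      intro t ht
      simp only [hq'e t ⟨by linarith [ht.1], ht.2⟩]
    have conv1 : ∫ t in α1..β, q' t = ∫ t in Icc α1 β, q t := by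
      simpa using conv (fun _ => 1)
    rw [conv, conv, conv (fun t => g' t ^ 2), conv1] at this
    exact this
  let u : ℕ → ℝ := fun n => a + (b - a) / (n + 3)
  let v : ℕ → ℝ := fun n => b - (b - a) / (n + 3)
  have hlim : Tendsto (fun n : ℕ => (b - a) / ((n : ℝ) + 3)) atTop (nhds 0) := by
    apply Tendsto.div_atTop tendsto_const_nhds
    exact tendsto_atTop_add_const_right _ _ tendsto_natCast_atTop_atTop
  have hu : Tendsto u atTop (nhds a) := by simpa using hlim.const_add a
  have hv : Tendsto v atTop (nhds b) := by simpa using hlim.const_sub b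
  have hcov := aecover_Ioo_of_Icc (μ := (volume : Measure ℝ)) hu hv
  have hpos : ∀ n : ℕ, 0 < (b - a) / ((n:ℝ) + 3) := fun n => div_pos (by linarith) (by positivity)
  have hlt : ∀ n : ℕ, (b - a) / ((n:ℝ) + 3) < (b - a) / 2 := fun n => by
    apply div_lt_div_of_pos_left (by linarith) (by norm_num); have : (0:ℝ) ≤ n := n.cast_nonneg; linarith
  have hsub : ∀ n, Icc (u n) (v n) ⊆ Ioo a b := fun n t ht =>
    ⟨by have := hpos n; have := ht.1; simp only [u] at this; linarith,
     by have := hpos n; have := ht.2; simp only [v] at this; linarith⟩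
  have hT : ∀ f : ℝ → ℝ, Continuous f → IntegrableOn (fun t => f t * q t) (Ioo a b) ∧
      Tendsto (fun n => ∫ t in Icc (u n) (v n), f t * q t) atTop (nhds (∫ t in Ioo a b, f t * q t)) := by
    intro f hf
    obtain ⟨C, hC⟩ := (isCompact_Icc (a := a) (b := b)).exists_bound_of_continuousOn hf.continuousOn
    have hi : IntegrableOn (fun t => f t * q t) (Ioo a b) := by
      apply Integrable.bdd_mul (c := C) hqi hf.aestronglyMeasurable
      rw [ae_restrict_iff' measurableSet_Ioo]
      exact Eventually.of_forall fun t ht => hC t ⟨ht.1.le, ht.2.le⟩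
    refine ⟨hi, ?_⟩
    have := hcov.integral_tendsto_of_countably_generated hi
    refine this.congr (fun n => ?_)
    rw [Measure.restrict_restrict measurableSet_Icc, inter_eq_left.2 (hsub n)]
  have t1 := (hT (fun t => g t ^ 2) (by fun_prop)).2
  have t2 : Tendsto (fun n => ∫ t in Icc (u n) (v n), q t) atTop (nhds (∫ t in Ioo a b, q t)) := by
    simpa using (hT (fun _ => 1) continuous_const).2
  have t3 := (hT g hgc).2
  have t4 := (hT (fun t => g' t ^ 2) (by fun_prop)).2
  refine le_of_tendsto_of_tendsto' (((t1.mul t2).sub (t3.pow 2)).const_mul μ) (t2.mul t4) (fun n => ?_)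
  refine hcomp (u n) (v n) ?_ ?_ ?_
  · have := hpos n; simp only [u]; linarith
  · have := hlt n; simp only [u, v]; linarith
  · have := hpos n; simp only [v]; linarith

section

/-- test function inequality -/
lemma rayleigh_le {N : ℕ} (Ω : Set (EuclideanSpace ℝ (Fin N)))
    (v : EuclideanSpace ℝ (Fin N) → ℝ) (hv : ContDiff ℝ 1 v) (hs : tsupport v ⊆ Ω) :
    dirEV Ω 1 * (∫⁻ x in Ω, ENNReal.ofReal ((v x) ^ 2)) ≤ ∫⁻ x in Ω, ENNReal.ofReal (‖fderiv ℝ v x‖ ^ 2) := by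
  by_cases h0 : v = 0
  · simp [h0]
  have h1 : dirEV Ω 1 ≤ dRayleigh Ω v := by
    unfold dirEV
    refine iInf₂_le_of_le (Submodule.span ℝ {v}) ⟨finrank_span_singleton h0, ?_⟩ ?_
    · intro w hw
      obtain ⟨c, rfl⟩ := Submodule.mem_span_singleton.1 hw
      refine ⟨contDiff_const.smul hv, ?_⟩
      exact (closure_mono (Function.support_const_smul_subset c v)).trans hs
    · refine iSup₂_le ?_
      rintro w ⟨hw, hw0⟩
      obtain ⟨c, rfl⟩ := Submodule.mem_span_singleton.1 hw
      have hc : c ≠ 0 := by rintro rfl; simp at hw0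
      have hc2 : ENNReal.ofReal (c^2) ≠ 0 := (ENNReal.ofReal_pos.2 (by positivity)).ne'
      unfold dRayleigh
      have e1 : ∀ x, ENNReal.ofReal (‖fderiv ℝ (c • v) x‖ ^ 2) = ENNReal.ofReal (c^2) * ENNReal.ofReal (‖fderiv ℝ v x‖ ^ 2) := by
        intro x
        rw [fderiv_const_smul (hv.differentiable (by norm_num) x), norm_smul, mul_pow, Real.norm_eq_abs, sq_abs,
          ENNReal.ofReal_mul (sq_nonneg _)]
      have e2 : ∀ x, ENNReal.ofReal (((c • v) x) ^ 2) = ENNReal.ofReal (c^2) * ENNReal.ofReal ((v x) ^ 2) := by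
        intro x
        rw [Pi.smul_apply, smul_eq_mul, mul_pow, ENNReal.ofReal_mul (sq_nonneg _)]
      simp_rw [e1, e2]
      rw [lintegral_const_mul' _ _ ENNReal.ofReal_ne_top, lintegral_const_mul' _ _ ENNReal.ofReal_ne_top,
        ENNReal.mul_div_mul_left _ _ hc2 ENNReal.ofReal_ne_top]
  exact ENNReal.mul_le_of_le_div h1

/-- truncation function -/
def trF (s : ℝ) : ℝ := s * Real.smoothTransition (s - 1)

lemma trF_contDiff : ContDiff ℝ 1 trF := by
  unfold trF
  exact contDiff_id.mul (Real.smoothTransition.contDiff.comp (contDiff_id.sub contDiff_const))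

lemma trF_zero {s : ℝ} (h : s ≤ 1) : trF s = 0 := by
  unfold trF; rw [Real.smoothTransition.zero_of_nonpos (by linarith), mul_zero]

lemma trF_id {s : ℝ} (h : 2 ≤ s) : trF s = s := by
  unfold trF; rw [Real.smoothTransition.one_of_one_le (by linarith), mul_one]

lemma trF_abs (s : ℝ) : |trF s| ≤ |s| := by
  unfold trF
  rw [abs_mul, abs_of_nonneg (Real.smoothTransition.nonneg _)]
  exact mul_le_of_le_one_right (abs_nonneg _) (Real.smoothTransition.le_one _)

lemma trF_deriv_one {s : ℝ} (h : 2 < s) : deriv trF s = 1 := by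
  have : trF =ᶠ[nhds s] id := by
    filter_upwards [lt_mem_nhds h] with t ht
    exact trF_id (le_of_lt ht)
  rw [this.deriv_eq, deriv_id]

lemma trF_deriv_bound : ∃ C : ℝ, 0 ≤ C ∧ ∀ s, 0 ≤ s → |deriv trF s| ≤ C := by
  have hc : Continuous (deriv trF) := trF_contDiff.continuous_deriv (by norm_num)
  obtain ⟨C, hC⟩ := (isCompact_Icc (a := (0:ℝ)) (b := 3)).exists_bound_of_continuousOn hc.continuousOn
  refine ⟨max C 1, le_max_of_le_right zero_le_one, fun s hs => ?_⟩
  rcases le_or_gt s 3 with h | h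
  · exact (hC s ⟨hs, h⟩).trans (le_max_left _ _)
  · rw [trF_deriv_one (by linarith), abs_one]; exact le_max_right _ _

variable {N : ℕ}

abbrev EN (N : ℕ) := EuclideanSpace ℝ (Fin N)

lemma norm_gradient_eq (f : EN N → ℝ) (x : EN N) : ‖gradient f x‖ = ‖fderiv ℝ f x‖ := by
  unfold gradient; exact LinearIsometryEquiv.norm_map _ _

lemma measurable_gradient (f : EN N → ℝ) : Measurable (gradient f) := by
  unfold gradient
  exact (LinearIsometryEquiv.continuous _).measurable.comp (measurable_fderiv ℝ f)

theorem weak_eq (Ω : Set (EN N)) (hΩ : IsOpen Ω) (hb : IsBounded Ω) (u : EN N → ℝ)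
    (hu : IsFirstDirichletEF Ω u) :
    ∃ lam : ℝ, 0 ≤ lam ∧ ∀ φ : EN N → ℝ, ContDiff ℝ 1 φ → tsupport φ ⊆ Ω →
      ∫ x in Ω, ⟪gradient u x, gradient φ x⟫ = lam * ∫ x in Ω, u x * φ x := by
  obtain ⟨huc, hu0, huC1, hufin, hupos, hu1, huR⟩ := hu
  have hmΩ : MeasurableSet Ω := hΩ.measurableSet
  have hΩfin : volume Ω ≠ ∞ := hb.measure_lt_top.ne
  have hGm := measurable_gradient u
  have hGi : IntegrableOn (fun x => ‖gradient u x‖ ^ 2) Ω := by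
    refine ⟨(hGm.norm.pow_const 2).aestronglyMeasurable, ?_⟩
    rw [hasFiniteIntegral_iff_ofReal (Eventually.of_forall fun x => sq_nonneg _)]
    simp_rw [norm_gradient_eq]
    exact lt_top_iff_ne_top.2 hufin
  set lam := ∫ x in Ω, ‖gradient u x‖ ^ 2 with hlam
  have hlam0 : 0 ≤ lam := integral_nonneg fun x => sq_nonneg _
  have hEV : dirEV Ω 1 = ENNReal.ofReal lam := by
    rw [← huR, dRayleigh, hu1, div_one, hlam, ofReal_integral_eq_lintegral_ofReal hGi (Eventually.of_forall fun x => sq_nonneg _)]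
    simp_rw [norm_gradient_eq]
  have hcb : IsCompact (closure Ω) := Metric.isCompact_of_isClosed_isBounded isClosed_closure hb.closure
  -- integrability of continuous functions
  have hci : ∀ f : EN N → ℝ, Continuous f → IntegrableOn f Ω := fun f hf =>
    (hf.continuousOn.integrableOn_compact hcb).mono_set subset_closure
  have hu2i : IntegrableOn (fun x => u x ^ 2) Ω := hci _ (huc.pow 2)
  have hu2 : ∫ x in Ω, u x ^ 2 = 1 := by
    rw [integral_eq_lintegral_of_nonneg_ae (Eventually.of_forall fun x => sq_nonneg _) (huc.pow 2).aestronglyMeasurable, hu1]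
    simp
  -- real test inequality
  have htest : ∀ v : EN N → ℝ, ContDiff ℝ 1 v → tsupport v ⊆ Ω →
      lam * ∫ x in Ω, v x ^ 2 ≤ ∫ x in Ω, ‖gradient v x‖ ^ 2 := by
    intro v hv hvs
    have h := rayleigh_le Ω v hv hvs
    have c2 : Continuous fun x => ‖gradient v x‖ ^ 2 := by
      simp_rw [norm_gradient_eq]
      exact ((hv.continuous_fderiv (by norm_num)).norm).pow 2
    simp_rw [← norm_gradient_eq] at h
    rw [hEV, ← ofReal_integral_eq_lintegral_ofReal (hci (fun x => v x ^ 2) (hv.continuous.pow 2)) (Eventually.of_forall fun x => sq_nonneg _),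
      ← ofReal_integral_eq_lintegral_ofReal (hci _ c2) (Eventually.of_forall fun x => sq_nonneg _),
      ← ENNReal.ofReal_mul hlam0] at h
    exact (ENNReal.ofReal_le_ofReal_iff (integral_nonneg fun x => sq_nonneg _)).1 h
  refine ⟨lam, hlam0, fun φ hφ hφs => ?_⟩
  have hφc := hφ.continuous
  have hGφ : Continuous (gradient φ) := by
    unfold gradient
    exact (LinearIsometryEquiv.continuous _).comp (hφ.continuous_fderiv (by norm_num))
  obtain ⟨C, hC0, hC⟩ := trF_deriv_bound
  have hunn : ∀ x, 0 ≤ u x := fun x => by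
    by_cases hx : x ∈ Ω
    · exact (hupos x hx).le
    · rw [hu0 x hx]
  have hud : ∀ x ∈ Ω, DifferentiableAt ℝ u x := fun x hx =>
    ((huC1 x hx).contDiffAt (hΩ.mem_nhds hx)).differentiableAt (by norm_num)
  -- perturbed inequality
  have hpert : ∀ t : ℝ, lam * ∫ x in Ω, (u x + t * φ x) ^ 2 ≤ ∫ x in Ω, ‖gradient u x + t • gradient φ x‖ ^ 2 := by
    intro t
    let ε : ℕ → ℝ := fun n => 1 / ((n:ℝ) + 1)
    have hε : ∀ n, 0 < ε n := fun n => by positivity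
    have hεl : Tendsto ε atTop (nhds 0) := tendsto_one_div_add_atTop_nhds_zero_nat
    let v : ℕ → EN N → ℝ := fun n x => ε n * trF (u x / ε n) + t * φ x
    have hv1 : ∀ n, ContDiff ℝ 1 (v n) := by
      intro n
      refine ContDiff.add ?_ (contDiff_const.mul hφ)
      rw [contDiff_iff_contDiffAt]
      intro x
      by_cases hx : x ∈ Ω
      · have h1 : ContDiffAt ℝ 1 u x := (huC1 x hx).contDiffAt (hΩ.mem_nhds hx)
        exact contDiffAt_const.mul (trF_contDiff.contDiffAt.comp x (h1.div_const _))
      · have : (fun x => ε n * trF (u x / ε n)) =ᶠ[nhds x] fun _ => 0 := by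
          have h1 : ∀ᶠ y in nhds x, u y < ε n := huc.continuousAt.eventually_lt_const (by rw [hu0 x hx]; exact hε n)
          filter_upwards [h1] with y hy
          rw [trF_zero ((div_le_one (hε n)).2 hy.le), mul_zero]
        exact contDiffAt_const.congr_of_eventuallyEq this
    have hvs : ∀ n, tsupport (v n) ⊆ Ω := by
      intro n
      have h1 : Function.support (v n) ⊆ {x | ε n ≤ u x} ∪ tsupport φ := by
        intro x hx
        by_contra hcon
        rw [mem_union, not_or] at hcon
        apply hx
        have h2 : u x < ε n := not_le.1 hcon.1
        have h3 : φ x = 0 := image_eq_zero_of_notMem_tsupport hcon.2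
        simp only [v, h3, trF_zero ((div_le_one (hε n)).2 h2.le)]
        simp
      have h2 : IsClosed ({x | ε n ≤ u x} ∪ tsupport φ) :=
        (isClosed_le continuous_const huc).union (isClosed_tsupport φ)
      refine (closure_minimal h1 h2).trans (union_subset ?_ hφs)
      intro x hx
      by_contra hx'
      have : ε n ≤ u x := hx
      rw [hu0 x hx'] at this
      linarith [hε n]
    have hgv : ∀ n, ∀ x ∈ Ω, gradient (v n) x = deriv trF (u x / ε n) • gradient u x + t • gradient φ x := by
      intro n x hx
      have h1 : HasFDerivAt (v n) (deriv trF (u x / ε n) • fderiv ℝ u x + t • fderiv ℝ φ x) x := by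
        have a1 := (hud x hx).hasFDerivAt
        have a2 := (trF_contDiff.differentiable (by norm_num) (u x / ε n)).hasDerivAt
        have a3 : HasFDerivAt (fun y => u y / ε n) ((ε n)⁻¹ • fderiv ℝ u x) x := by
          simpa [div_eq_inv_mul] using a1.const_mul (ε n)⁻¹
        have a4 := (a2.comp_hasFDerivAt x a3).const_mul (ε n)
        have a5 := ((hφ.differentiable (by norm_num) x).hasFDerivAt).const_mul t
        have a6 := a4.add a5
        refine a6.congr_fderiv ?_
        rw [smul_smul, smul_smul]
        congr 2
        field_simp [(hε n).ne']
      unfold gradient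
      rw [h1.fderiv]
      simp
    have hineq : ∀ n, lam * ∫ x in Ω, v n x ^ 2 ≤ ∫ x in Ω, ‖deriv trF (u x / ε n) • gradient u x + t • gradient φ x‖ ^ 2 := by
      intro n
      refine (htest (v n) (hv1 n) (hvs n)).trans (le_of_eq ?_)
      apply setIntegral_congr_fun hmΩ
      intro x hx
      simp only [hgv n x hx]
    have hsmall : ∀ x ∈ Ω, ∀ᶠ n in atTop, 2 < u x / ε n := by
      intro x hx
      have h1 : ∀ᶠ n in atTop, ε n < u x / 2 := hεl.eventually_lt_const (by have := hupos x hx; linarith)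
      filter_upwards [h1] with n hn
      rw [lt_div_iff₀ (hε n)]; linarith
    have l1 : Tendsto (fun n => ∫ x in Ω, v n x ^ 2) atTop (nhds (∫ x in Ω, (u x + t * φ x) ^ 2)) := by
      apply tendsto_integral_of_dominated_convergence (fun x => (u x + |t * φ x|) ^ 2)
      · exact fun n => ((hv1 n).continuous.pow 2).aestronglyMeasurable
      · exact hci _ (by fun_prop)
      · intro n
        refine Eventually.of_forall fun x => ?_
        rw [Real.norm_eq_abs, abs_pow]
        have : |v n x| ≤ u x + |t * φ x| := by
          refine (abs_add_le _ _).trans (add_le_add ?_ le_rfl)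
          rw [abs_mul, abs_of_pos (hε n)]
          have h1 := trF_abs (u x / ε n)
          rw [abs_of_nonneg (div_nonneg (hunn x) (hε n).le)] at h1
          calc ε n * |trF (u x / ε n)| ≤ ε n * (u x / ε n) := mul_le_mul_of_nonneg_left h1 (hε n).le
            _ = u x := by field_simp [(hε n).ne']
        gcongr
      · rw [ae_restrict_iff' hmΩ]
        refine Eventually.of_forall fun x hx => ?_
        refine tendsto_const_nhds.congr' ?_
        filter_upwards [hsmall x hx] with n hn
        simp only [v, trF_id hn.le]
        rw [mul_div_cancel₀ _ (hε n).ne']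
    have l2 : Tendsto (fun n => ∫ x in Ω, ‖deriv trF (u x / ε n) • gradient u x + t • gradient φ x‖ ^ 2) atTop
        (nhds (∫ x in Ω, ‖gradient u x + t • gradient φ x‖ ^ 2)) := by
      apply tendsto_integral_of_dominated_convergence (fun x => 2 * C^2 * ‖gradient u x‖ ^ 2 + 2 * ‖t • gradient φ x‖ ^ 2)
      · intro n
        have hm1 : Measurable fun x => deriv trF (u x / ε n) := (measurable_deriv trF).comp (huc.measurable.div_const _)
        exact ((hm1.smul hGm).add (hGφ.measurable.const_smul t)).norm.pow_const 2 |>.aestronglyMeasurable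
      · exact (hGi.const_mul _).add (hci _ (by fun_prop))
      · intro n
        refine Eventually.of_forall fun x => ?_
        rw [Real.norm_eq_abs, abs_pow, abs_norm]
        have h1 : ‖deriv trF (u x / ε n) • gradient u x‖ ≤ C * ‖gradient u x‖ := by
          rw [norm_smul]
          exact mul_le_mul_of_nonneg_right (hC _ (div_nonneg (hunn x) (hε n).le)) (norm_nonneg _)
        have h2 := norm_add_le (deriv trF (u x / ε n) • gradient u x) (t • gradient φ x)
        have h3 : ‖deriv trF (u x / ε n) • gradient u x + t • gradient φ x‖ ≤ C * ‖gradient u x‖ + ‖t • gradient φ x‖ := by linarith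
        calc _ ≤ (C * ‖gradient u x‖ + ‖t • gradient φ x‖)^2 := by gcongr
          _ ≤ _ := by nlinarith [sq_nonneg (C * ‖gradient u x‖ - ‖t • gradient φ x‖)]
      · rw [ae_restrict_iff' hmΩ]
        refine Eventually.of_forall fun x hx => ?_
        refine tendsto_const_nhds.congr' ?_
        filter_upwards [hsmall x hx] with n hn
        rw [trF_deriv_one hn, one_smul]
    exact le_of_tendsto_of_tendsto' (l1.const_mul lam) l2 hineq
  -- expand
  have i1 : IntegrableOn (fun x => ⟪gradient u x, gradient φ x⟫) Ω := by
    have hdom : IntegrableOn (fun x => ‖gradient u x‖ ^ 2 + ‖gradient φ x‖ ^ 2) Ω := hGi.add (hci _ (by fun_prop))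
    refine hdom.mono' (hGm.inner hGφ.measurable).aestronglyMeasurable (Eventually.of_forall fun x => ?_)
    refine (norm_inner_le_norm _ _).trans ?_
    nlinarith [sq_nonneg (‖gradient u x‖ - ‖gradient φ x‖), sq_nonneg ‖gradient u x‖, sq_nonneg ‖gradient φ x‖]
  have i2 : IntegrableOn (fun x => ‖gradient φ x‖ ^ 2) Ω := hci _ (by fun_prop)
  have i3 : IntegrableOn (fun x => u x * φ x) Ω := hci _ (by fun_prop)
  have i4 : IntegrableOn (fun x => φ x ^ 2) Ω := hci _ (by fun_prop)
  set a := ∫ x in Ω, ⟪gradient u x, gradient φ x⟫ with ha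
  set b := ∫ x in Ω, u x * φ x with hb'
  set A := ∫ x in Ω, ‖gradient φ x‖ ^ 2 with hA
  set B := ∫ x in Ω, φ x ^ 2 with hB
  have hquad : ∀ t : ℝ, 0 ≤ 2 * t * (a - lam * b) + t ^ 2 * (A - lam * B) := by
    intro t
    have h := hpert t
    have e1 : ∫ x in Ω, (u x + t * φ x) ^ 2 = 1 + 2 * t * b + t^2 * B := by
      have : (fun x => (u x + t * φ x) ^ 2) = fun x => (u x ^ 2 + 2 * t * (u x * φ x)) + t^2 * φ x ^ 2 := by
        ext; ring
      have e3 : Integrable (fun x => 2 * t * (u x * φ x)) (volume.restrict Ω) := i3.const_mul _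
      have e4 : Integrable (fun x => t^2 * φ x ^ 2) (volume.restrict Ω) := i4.const_mul _
      have e5 : Integrable (fun x => u x ^ 2) (volume.restrict Ω) := hu2i
      have e6 : Integrable (fun x => u x ^ 2 + 2 * t * (u x * φ x)) (volume.restrict Ω) := e5.add e3
      rw [this, integral_add e6 e4, integral_add e5 e3,
        integral_const_mul, integral_const_mul, hu2]
    have e2 : ∫ x in Ω, ‖gradient u x + t • gradient φ x‖ ^ 2 = lam + 2 * t * a + t^2 * A := by
      have : (fun x => ‖gradient u x + t • gradient φ x‖ ^ 2) =
          fun x => (‖gradient u x‖ ^ 2 + 2 * t * ⟪gradient u x, gradient φ x⟫) + t^2 * ‖gradient φ x‖ ^ 2 := by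
        ext x
        rw [norm_add_sq_real, inner_smul_right, norm_smul, mul_pow, Real.norm_eq_abs, sq_abs]; ring
      have e3 : Integrable (fun x => 2 * t * ⟪gradient u x, gradient φ x⟫) (volume.restrict Ω) := i1.const_mul _
      have e4 : Integrable (fun x => t^2 * ‖gradient φ x‖ ^ 2) (volume.restrict Ω) := i2.const_mul _
      have e5 : Integrable (fun x => ‖gradient u x‖ ^ 2) (volume.restrict Ω) := hGi
      have e6 : Integrable (fun x => ‖gradient u x‖ ^ 2 + 2 * t * ⟪gradient u x, gradient φ x⟫) (volume.restrict Ω) := e5.add e3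
      rw [this, integral_add e6 e4, integral_add e5 e3,
        integral_const_mul, integral_const_mul]
    rw [e1, e2] at h
    linarith
  have : a - lam * b = 0 := by
    set X := a - lam * b
    set Y := A - lam * B
    by_contra hne
    have hX2 : 0 < X ^ 2 := by positivity
    have h1 := hquad (-X / (|Y| + 1))
    have hY1 : 0 < |Y| + 1 := by positivity
    have h2 : 2 * (-X / (|Y| + 1)) * X + (-X / (|Y| + 1)) ^ 2 * Y = X^2 / (|Y|+1)^2 * (Y - 2 * (|Y| + 1)) := by
      field_simp; ring
    rw [h2] at h1
    have h3 : Y - 2 * (|Y| + 1) < 0 := by have := le_abs_self Y; have := abs_nonneg Y; linarith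
    have h4 : 0 < X^2 / (|Y|+1)^2 := by positivity
    nlinarith
  linarith

end

section

variable {N : ℕ}

/-- the averaging weight -/
def bw (z : EN N) : ℝ := max 0 (1 - ‖z‖ ^ 2)
/-- its primitive -/
def bE (z : EN N) : ℝ := (max 0 (1 - ‖z‖ ^ 2)) ^ 2 / 4
/-- normalising constant -/
def bc (N : ℕ) : ℝ := ∫ z : EN N, bE z

lemma bw_cont : Continuous (bw (N := N)) := by unfold bw; fun_prop
lemma bE_cont : Continuous (bE (N := N)) := by unfold bE; fun_prop
lemma bw_nonneg (z : EN N) : 0 ≤ bw z := le_max_left _ _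
lemma bE_nonneg (z : EN N) : 0 ≤ bE z := by unfold bE; positivity
lemma bw_zero {z : EN N} (h : 1 ≤ ‖z‖) : bw z = 0 := by
  unfold bw; apply max_eq_left; nlinarith
lemma bE_zero {z : EN N} (h : 1 ≤ ‖z‖) : bE z = 0 := by
  unfold bE; rw [max_eq_left (by nlinarith)]; norm_num
lemma bw_le (z : EN N) : bw z ≤ 1 := by
  unfold bw; apply max_le zero_le_one; nlinarith [sq_nonneg ‖z‖]
lemma bw_supp : Function.support (bw (N := N)) ⊆ Metric.closedBall 0 1 := by
  intro z hz
  rw [mem_closedBall_zero_iff]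
  by_contra h
  exact hz (bw_zero (le_of_lt (not_le.1 h)))
lemma bE_supp : Function.support (bE (N := N)) ⊆ Metric.closedBall 0 1 := by
  intro z hz
  rw [mem_closedBall_zero_iff]
  by_contra h
  exact hz (bE_zero (le_of_lt (not_le.1 h)))

lemma sqmax_deriv (s : ℝ) : HasDerivAt (fun s : ℝ => (max 0 s) ^ 2 / 4) (max 0 s / 2) s := by
  rcases lt_trichotomy s 0 with h | h | h
  · rw [max_eq_left h.le, zero_div]
    refine (hasDerivAt_const s (0:ℝ)).congr_of_eventuallyEq ?_
    filter_upwards [gt_mem_nhds h] with t ht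
    rw [max_eq_left (le_of_lt ht)]; norm_num
  · subst h
    rw [max_self, zero_div]
    have h1 : HasDerivAt (fun s : ℝ => s ^ 2 / 4) 0 0 := by
      have := (hasDerivAt_pow 2 (0:ℝ)).div_const 4
      simpa using this
    rw [hasDerivAt_iff_isLittleO] at h1 ⊢
    refine (Asymptotics.IsBigO.of_bound 1 (Eventually.of_forall fun t => ?_)).trans_isLittleO h1
    simp only [sub_zero, max_self, smul_zero]
    rw [Real.norm_eq_abs, Real.norm_eq_abs, one_mul]
    norm_num
    rw [abs_of_nonneg (by positivity), abs_of_nonneg (by positivity)]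
    rcases le_total t 0 with h | h
    · rw [max_eq_left h]; nlinarith
    · rw [max_eq_right h]
  · rw [max_eq_right h.le]
    have h1 : HasDerivAt (fun s : ℝ => s ^ 2 / 4) (s/2) s := by
      have := (hasDerivAt_pow 2 s).div_const 4
      refine this.congr_deriv (by norm_num; ring)
    refine h1.congr_of_eventuallyEq ?_
    filter_upwards [lt_mem_nhds h] with t ht
    rw [max_eq_right (le_of_lt ht)]

lemma bE_fderiv (z : EN N) : HasFDerivAt (bE (N := N)) (-(bw z) • innerSL ℝ z) z := by
  have h1 : HasFDerivAt (fun z : EN N => 1 - ‖z‖ ^ 2) (-(2 • innerSL ℝ z)) z :=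
    (hasStrictFDerivAt_norm_sq z).hasFDerivAt.const_sub 1
  have h2 := (sqmax_deriv (1 - ‖z‖^2)).comp_hasFDerivAt z h1
  refine h2.congr_fderiv ?_
  ext v
  simp [bw]; ring

lemma bE_contDiff : ContDiff ℝ 1 (bE (N := N)) := by
  rw [contDiff_one_iff_hasFDerivAt]
  refine ⟨fun z => -(bw z) • innerSL ℝ z, ?_, bE_fderiv⟩
  have := bw_cont (N := N)
  fun_prop

lemma bE_compact : HasCompactSupport (bE (N := N)) :=
  HasCompactSupport.of_support_subset_isCompact (isCompact_closedBall 0 1) bE_supp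
lemma bw_compact : HasCompactSupport (bw (N := N)) :=
  HasCompactSupport.of_support_subset_isCompact (isCompact_closedBall 0 1) bw_supp

lemma bE_int : Integrable (bE (N := N)) := bE_cont.integrable_of_hasCompactSupport bE_compact

lemma bc_pos : 0 < bc N := by
  unfold bc
  refine bE_cont.integral_pos_of_hasCompactSupport_nonneg_nonzero bE_compact bE_nonneg (x := 0) ?_
  simp [bE]

lemma bw_mul_int (f : EN N → ℝ) (hf : ContinuousOn f (Metric.closedBall 0 1)) : Integrable (fun z => bw z * f z) := by
  rw [← integrableOn_iff_integrable_of_support_subset (s := Metric.closedBall 0 1)]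
  · exact (bw_cont.continuousOn.mul hf).integrableOn_compact (isCompact_closedBall 0 1)
  · exact (Function.support_mul_subset_left _ _).trans bw_supp

lemma bw_int : Integrable (bw (N := N)) := by
  simpa using bw_mul_int (fun _ : EN N => (1:ℝ)) continuousOn_const

lemma bw_inner_sq (e : EN N) : ∫ z, bw z * ⟪z, e⟫ ^ 2 = bc N * ‖e‖ ^ 2 := by
  have hf : ∀ z : EN N, HasFDerivAt (fun z : EN N => ⟪z, e⟫) (innerSL ℝ e) z := by
    intro z
    have := (innerSL ℝ e).hasFDerivAt (x := z)
    refine this.congr_of_eventuallyEq (Eventually.of_forall fun y => ?_)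
    simp [real_inner_comm]
  have hbE := bE_cont (N := N)
  have hbw := bw_cont (N := N)
  have h := integral_mul_fderiv_eq_neg_fderiv_mul_of_integrable (μ := (volume : Measure (EN N))) (𝕜 := ℝ) (v := e)
    (f := fun z : EN N => ⟪z, e⟫) (g := bE (N := N)) ?_ ?_ ?_ ?_ ?_
  · have hf' : ∀ z : EN N, fderiv ℝ (fun z : EN N => ⟪z, e⟫) z e = ‖e‖ ^ 2 := by
      intro z
      rw [(hf z).fderiv]; simp
    simp only [hf', (bE_fderiv _).fderiv] at h
    rw [integral_const_mul] at h
    have h2 : ∫ z : EN N, ⟪z, e⟫ * (-(bw z) • innerSL ℝ z) e = - ∫ z, bw z * ⟪z, e⟫ ^ 2 := by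
      rw [← integral_neg]; congr 1; ext z; simp; ring
    rw [h2] at h
    unfold bc; linarith
  · simp only [(hf _).fderiv]
    exact bE_int.const_mul _
  · simp only [(bE_fderiv _).fderiv]
    have : (fun z : EN N => ⟪z, e⟫ * (-(bw z) • innerSL ℝ z) e) = fun z => bw z * (-⟪z, e⟫ ^ 2) := by
      ext z; simp; ring
    rw [this]
    exact bw_mul_int _ (by fun_prop)
  · exact Continuous.integrable_of_hasCompactSupport (by fun_prop) bE_compact.mul_left
  · exact fun z _ => (hf z).differentiableAt
  · exact fun z _ => (bE_fderiv z).differentiableAt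

lemma bw_odd (f : EN N → ℝ) (hf : ∀ z, f (-z) = - f z) : ∫ z, bw z * f z = 0 := by
  have h := integral_neg_eq_self (fun z : EN N => bw z * f z) volume
  have h2 : (fun z : EN N => bw (-z) * f (-z)) = fun z => -(bw z * f z) := by
    ext z; rw [hf]; simp [bw]
  rw [h2, integral_neg] at h
  linarith

/-- averaged second order limit -/
def Avg (U : EN N → ℝ) (x : EN N) (L : ℝ) : Prop :=
  (∃ r > 0, ContinuousOn U (Metric.closedBall x r)) ∧
  Tendsto (fun ρ : ℝ => (ρ ^ 2)⁻¹ * ∫ z, bw z * (U (x + ρ • z) - U x)) (nhdsWithin 0 (Ioi 0)) (nhds L)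

lemma avg_int {U : EN N → ℝ} {x : EN N} {r ρ : ℝ} (hU : ContinuousOn U (Metric.closedBall x r)) (h0 : 0 ≤ ρ) (h1 : ρ ≤ r) :
    ContinuousOn (fun z => U (x + ρ • z)) (Metric.closedBall 0 1) := by
  refine hU.comp (by fun_prop) ?_
  intro z hz
  rw [mem_closedBall_zero_iff] at hz
  rw [mem_closedBall_iff_norm, add_sub_cancel_left, norm_smul, Real.norm_eq_abs, abs_of_nonneg h0]
  nlinarith

lemma avg_int' {U : EN N → ℝ} {x : EN N} {r ρ : ℝ} (hU : ContinuousOn U (Metric.closedBall x r)) (h0 : 0 ≤ ρ) (h1 : ρ ≤ r) :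
    Integrable (fun z => bw z * (U (x + ρ • z) - U x)) :=
  bw_mul_int _ ((avg_int hU h0 h1).sub continuousOn_const)

lemma Avg.add {U V : EN N → ℝ} {x : EN N} {L M : ℝ} (hU : Avg U x L) (hV : Avg V x M) :
    Avg (fun z => U z + V z) x (L + M) := by
  obtain ⟨⟨r, hr, hUc⟩, hUl⟩ := hU
  obtain ⟨⟨s, hs, hVc⟩, hVl⟩ := hV
  refine ⟨⟨min r s, lt_min hr hs, (hUc.mono (Metric.closedBall_subset_closedBall (min_le_left _ _))).add
    (hVc.mono (Metric.closedBall_subset_closedBall (min_le_right _ _)))⟩, ?_⟩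
  refine (hUl.add hVl).congr' ?_
  filter_upwards [Ioc_mem_nhdsGT (lt_min hr hs)] with ρ hρ
  have i1 := avg_int' hUc hρ.1.le (hρ.2.trans (min_le_left _ _))
  have i2 := avg_int' hVc hρ.1.le (hρ.2.trans (min_le_right _ _))
  rw [← mul_add, ← integral_add i1 i2]
  congr 2; ext z; ring

lemma Avg.const_mul {U : EN N → ℝ} {x : EN N} {L : ℝ} (k : ℝ) (hU : Avg U x L) :
    Avg (fun z => k * U z) x (k * L) := by
  obtain ⟨⟨r, hr, hUc⟩, hUl⟩ := hU
  refine ⟨⟨r, hr, continuousOn_const.mul hUc⟩, ?_⟩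
  refine (hUl.const_mul k).congr fun ρ => ?_
  have : (fun z => bw z * (k * U (x + ρ • z) - k * U x)) = fun z => k * (bw z * (U (x + ρ • z) - U x)) := by
    ext z; ring
  rw [this, integral_const_mul]; ring

lemma Avg.const (k : ℝ) (x : EN N) : Avg (fun _ => k) x 0 := by
  refine ⟨⟨1, one_pos, continuousOn_const⟩, ?_⟩
  simp

/-- reflection invariance -/
lemma Avg.comp_isometry {U : EN N → ℝ} {x : EN N} {L : ℝ} (R : EN N ≃ₗᵢ[ℝ] EN N) (hU : Avg U x L) :
    Avg (fun z => U (x + R z)) 0 L := by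
  obtain ⟨⟨r, hr, hUc⟩, hUl⟩ := hU
  refine ⟨⟨r, hr, ?_⟩, ?_⟩
  · refine hUc.comp (by fun_prop) ?_
    intro z hz
    simpa [mem_closedBall_iff_norm] using hz
  · refine hUl.congr fun ρ => ?_
    congr 1
    have := (R.measurePreserving).integral_comp (R.toHomeomorph.measurableEmbedding) (fun z => bw z * (U (x + ρ • z) - U x))
    rw [← this]
    congr 1; ext z
    simp [bw]

/-- Averages of functions with a local max are nonpositive. -/
lemma Avg.le_zero {U : EN N → ℝ} {x : EN N} {L : ℝ} (hU : Avg U x L) (hmax : ∀ᶠ y in nhds x, U y ≤ U x) : L ≤ 0 := by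
  obtain ⟨_, hUl⟩ := hU
  obtain ⟨r, hr, hm⟩ := Metric.eventually_nhds_iff.1 hmax
  refine le_of_tendsto hUl ?_
  filter_upwards [Ioo_mem_nhdsGT hr] with ρ hρ
  refine mul_nonpos_of_nonneg_of_nonpos (by positivity) (integral_nonpos fun z => ?_)
  by_cases hz : 1 ≤ ‖z‖
  · simp [bw_zero hz]
  · refine mul_nonpos_of_nonneg_of_nonpos (bw_nonneg z) (sub_nonpos.2 (hm ?_))
    rw [dist_eq_norm, add_sub_cancel_left, norm_smul, Real.norm_eq_abs, abs_of_pos hρ.1]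
    have := hρ.2; have := hρ.1; push Not at hz; nlinarith [norm_nonneg z]

lemma log_second (T : ℝ) (hT : |T| ≤ 1/2) : |log (1 + T) - T + T ^ 2 / 2| ≤ 2 * |T| ^ 3 := by
  have h := Real.abs_log_sub_add_sum_range_le (x := -T) (by rw [abs_neg]; linarith) 2
  simp only [Finset.sum_range_succ, Finset.sum_range_zero] at h
  norm_num at h
  have h3 : |T| ^ 3 / (1 - |T|) ≤ 2 * |T| ^ 3 := by
    rw [div_le_iff₀ (by linarith)]
    have : 0 ≤ |T| ^ 3 := by positivity
    nlinarith
  refine le_trans (le_of_eq ?_) (h.trans h3)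
  congr 1; ring

lemma Avg.log {U : EN N → ℝ} {x G : EN N} {L : ℝ} (hU : Avg U x L) (hpos : 0 < U x) (hG : HasGradientAt U G x) :
    Avg (fun z => Real.log (U z)) x (L / U x - bc N / 2 * (‖G‖ ^ 2 / U x ^ 2)) := by
  obtain ⟨⟨r, hr, hUc⟩, hUl⟩ := hU
  have hcx : ContinuousAt U x := hG.hasFDerivAt.continuousAt
  have hev : ∀ᶠ y in nhds x, 0 < U y := hcx.eventually_const_lt hpos
  obtain ⟨r1, hr1, hm⟩ := Metric.eventually_nhds_iff.1 hev
  have hlogc : ContinuousOn (fun z => Real.log (U z)) (Metric.closedBall x (min r (r1/2))) := by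
    refine ContinuousOn.log (hUc.mono (Metric.closedBall_subset_closedBall (min_le_left _ _))) fun y hy => ?_
    refine (hm ?_).ne'
    have := Metric.mem_closedBall.1 hy
    have := min_le_right r (r1/2)
    linarith
  refine ⟨⟨_, lt_min hr (half_pos hr1), hlogc⟩, ?_⟩
  -- Lipschitz bound at x
  obtain ⟨K, hK0, r2, hr2, hlip⟩ : ∃ K : ℝ, 0 < K ∧ ∃ r2 > 0, ∀ y, dist y x < r2 → |U y - U x| ≤ K * ‖y - x‖ := by
    have h1 := hG.hasFDerivAt.isBigO_sub
    obtain ⟨K, hK, hK2⟩ := h1.exists_pos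
    rw [Asymptotics.isBigOWith_iff] at hK2
    obtain ⟨r2, hr2, h⟩ := Metric.eventually_nhds_iff.1 hK2
    exact ⟨K, hK, r2, hr2, fun y hy => by simpa using h hy⟩
  set T : ℝ → EN N → ℝ := fun ρ z => (U (x + ρ • z) - U x) / U x with hT
  have hTb : ∀ ρ z, 0 < ρ → ρ < r2 → ‖z‖ < 1 → |T ρ z| ≤ ρ * (K / U x) := by
    intro ρ z h0 h1 hz
    have h2 := hlip (x + ρ • z) (by rw [dist_eq_norm, add_sub_cancel_left, norm_smul, Real.norm_eq_abs, abs_of_pos h0]; nlinarith [norm_nonneg z])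
    rw [add_sub_cancel_left, norm_smul, Real.norm_eq_abs, abs_of_pos h0] at h2
    simp only [hT]
    rw [abs_div, abs_of_pos hpos, div_le_iff₀ hpos]
    have : ρ * (K / U x) * U x = K * ρ := by field_simp
    rw [this]
    nlinarith [mul_pos hK0 h0]
  set r3 := min (min r (r1/2)) (min r2 (U x / (2 * K))) with hr3
  have hr3p : 0 < r3 := lt_min (lt_min hr (half_pos hr1)) (lt_min hr2 (by positivity))
  have hTh : ∀ ρ, ρ ∈ Ioo 0 r3 → ∀ z, ‖z‖ < 1 → |T ρ z| ≤ 1/2 := by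
    intro ρ hρ z hz
    have h1 := hTb ρ z hρ.1 (hρ.2.trans_le ((min_le_right _ _).trans (min_le_left _ _))) hz
    have h2 : ρ ≤ U x / (2 * K) := hρ.2.le.trans ((min_le_right _ _).trans (min_le_right _ _))
    refine h1.trans ?_
    calc ρ * (K / U x) ≤ U x / (2 * K) * (K / U x) := by gcongr
      _ = 1/2 := by field_simp
  have hUlog : ∀ ρ, ρ ∈ Ioo 0 r3 → ∀ z, ‖z‖ < 1 → Real.log (U (x + ρ • z)) - Real.log (U x) = Real.log (1 + T ρ z) := by
    intro ρ hρ z hz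
    have h1 := hTh ρ hρ z hz
    have h2 : U (x + ρ • z) = U x * (1 + T ρ z) := by simp only [hT]; field_simp; ring
    rw [h2, Real.log_mul hpos.ne' (by have := abs_le.1 h1; linarith)]
    ring
  -- the remainder
  have hrem : Tendsto (fun ρ : ℝ => ∫ z, (ρ^2)⁻¹ * (bw z * (Real.log (U (x + ρ • z)) - Real.log (U x) - T ρ z)))
      (nhdsWithin 0 (Ioi 0)) (nhds (∫ z, - (1 / (2 * U x ^ 2)) * (bw z * ⟪z, G⟫ ^ 2))) := by
    apply tendsto_integral_filter_of_dominated_convergence (fun z => bw z * (2 * (K / U x) ^ 2))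
    · filter_upwards [Ioo_mem_nhdsGT hr3p] with ρ hρ
      have hlt : ρ ≤ min r (r1/2) := hρ.2.le.trans (min_le_left _ _)
      refine ((bw_mul_int _ ?_).const_mul _).aestronglyMeasurable
      refine ((avg_int hlogc hρ.1.le hlt).sub continuousOn_const).sub ?_
      simp only [hT]
      exact ((avg_int hUc hρ.1.le (hlt.trans (min_le_left _ _))).sub continuousOn_const).div_const _
    · filter_upwards [Ioo_mem_nhdsGT hr3p] with ρ hρ
      refine Eventually.of_forall fun z => ?_
      by_cases hz : 1 ≤ ‖z‖
      · simp [bw_zero hz]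
      push Not at hz
      rw [hUlog ρ hρ z hz]
      have h1 := hTb ρ z hρ.1 (hρ.2.trans_le ((min_le_right _ _).trans (min_le_left _ _))) hz
      have h2 := hTh ρ hρ z hz
      have h3 := log_second _ h2
      have h4 : |Real.log (1 + T ρ z) - T ρ z| ≤ 2 * |T ρ z| ^ 2 := by
        have h5 : |T ρ z| ^ 3 ≤ |T ρ z| ^ 2 / 2 := by
          have : 0 ≤ |T ρ z| ^ 2 := by positivity
          nlinarith
        have h6 : |T ρ z ^ 2 / 2| = |T ρ z| ^ 2 / 2 := by rw [abs_div, abs_pow]; norm_num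
        have h7 := abs_sub (Real.log (1 + T ρ z) - T ρ z + T ρ z ^ 2 / 2) (T ρ z ^ 2 / 2)
        rw [add_sub_cancel_right] at h7
        nlinarith [sq_nonneg |T ρ z|]
      rw [norm_mul, norm_mul, Real.norm_eq_abs, Real.norm_eq_abs, Real.norm_eq_abs, abs_of_nonneg (bw_nonneg z), abs_inv, abs_of_nonneg (sq_nonneg ρ)]
      have hρ2 : 0 < ρ ^ 2 := by have := hρ.1; positivity
      rw [inv_mul_le_iff₀ hρ2]
      have h8 : |T ρ z| ^ 2 ≤ (ρ * (K / U x)) ^ 2 := by gcongr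
      calc bw z * |Real.log (1 + T ρ z) - T ρ z| ≤ bw z * (2 * (ρ * (K / U x)) ^ 2) :=
            mul_le_mul_of_nonneg_left (by linarith) (bw_nonneg z)
        _ = _ := by ring
    · exact bw_int.mul_const _
    · refine Eventually.of_forall fun z => ?_
      by_cases hz : 1 ≤ ‖z‖
      · simp [bw_zero hz]
      push Not at hz
      have hd : Tendsto (fun ρ : ℝ => T ρ z / ρ) (nhdsWithin 0 (Ioi 0)) (nhds (⟪z, G⟫ / U x)) := by
        have h1 : HasDerivAt (fun ρ : ℝ => U (x + ρ • z)) (⟪z, G⟫) 0 := by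
          have h2 : HasDerivAt (fun ρ : ℝ => x + ρ • z) z 0 := by
            simpa using ((hasDerivAt_id (0:ℝ)).smul_const z).const_add x
          have h3 : HasFDerivAt U ((InnerProductSpace.toDual ℝ (EN N)) G) (x + (0:ℝ) • z) := by simpa using hG.hasFDerivAt
          have := h3.comp_hasDerivAt (0:ℝ) h2
          exact this.congr_deriv (by simp [real_inner_comm])
        have h2 := h1.hasDerivWithinAt (s := Ioi 0)
        rw [hasDerivWithinAt_iff_tendsto_slope' (by simp)] at h2
        refine (h2.div_const (U x)).congr fun ρ => ?_
        simp only [slope_def_field, hT, sub_zero, zero_smul, add_zero]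
        ring
      have h1 : Tendsto (fun ρ : ℝ => bw z * (-(T ρ z / ρ) ^ 2 / 2)) (nhdsWithin 0 (Ioi 0)) (nhds (- (1 / (2 * U x ^ 2)) * (bw z * ⟪z, G⟫ ^ 2))) := by
        have := ((hd.pow 2).neg.div_const 2).const_mul (bw z)
        have e : bw z * (-(⟪z, G⟫ / U x) ^ 2 / 2) = - (1 / (2 * U x ^ 2)) * (bw z * ⟪z, G⟫ ^ 2) := by
          field_simp
        rw [e] at this
        exact this
      have h2 : Tendsto (fun ρ : ℝ => 2 * (K / U x) ^ 3 * ρ) (nhdsWithin 0 (Ioi 0)) (nhds 0) := by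
        have : Tendsto (fun ρ : ℝ => 2 * (K / U x) ^ 3 * ρ) (nhds 0) (nhds (2 * (K / U x) ^ 3 * 0)) := (continuous_const.mul continuous_id).tendsto 0
        rw [mul_zero] at this
        exact this.mono_left nhdsWithin_le_nhds
      refine tendsto_of_tendsto_of_dist h1 (squeeze_zero' (Eventually.of_forall fun _ => dist_nonneg) ?_ h2)
      filter_upwards [Ioo_mem_nhdsGT hr3p] with ρ hρ
      rw [hUlog ρ hρ z hz]
      have hb1 := hTb ρ z hρ.1 (hρ.2.trans_le ((min_le_right _ _).trans (min_le_left _ _))) hz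
      have h3 := log_second _ (hTh ρ hρ z hz)
      have hρ0 : 0 < ρ := hρ.1
      have hρ2 : 0 < ρ ^ 2 := by positivity
      rw [Real.dist_eq, abs_sub_comm]
      have e1 : (ρ ^ 2)⁻¹ * (bw z * (Real.log (1 + T ρ z) - T ρ z)) - bw z * (-(T ρ z / ρ) ^ 2 / 2) =
        (ρ ^ 2)⁻¹ * (bw z * (Real.log (1 + T ρ z) - T ρ z + T ρ z ^ 2 / 2)) := by field_simp; ring
      rw [e1, abs_mul, abs_mul, abs_of_nonneg (bw_nonneg z), abs_inv, abs_of_pos hρ2, inv_mul_le_iff₀ hρ2]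
      have h5 : |T ρ z| ^ 3 ≤ (ρ * (K / U x)) ^ 3 := by gcongr
      calc bw z * |Real.log (1 + T ρ z) - T ρ z + T ρ z ^ 2 / 2| ≤ 1 * (2 * (ρ * (K / U x)) ^ 3) :=
            mul_le_mul (bw_le z) (by linarith) (abs_nonneg _) zero_le_one
        _ = _ := by ring
  have hfin := (hUl.div_const (U x)).add hrem
  rw [integral_const_mul, bw_inner_sq] at hfin
  have e0 : L / U x + -(1 / (2 * U x ^ 2)) * (bc N * ‖G‖ ^ 2) = L / U x - bc N / 2 * (‖G‖ ^ 2 / U x ^ 2) := by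
    field_simp; ring
  rw [e0] at hfin
  refine hfin.congr' ?_
  filter_upwards [Ioo_mem_nhdsGT hr3p] with ρ hρ
  have hlt : ρ ≤ min r (r1/2) := hρ.2.le.trans (min_le_left _ _)
  have i1 := avg_int' hUc hρ.1.le (hlt.trans (min_le_left _ _))
  have i2 := avg_int' hlogc hρ.1.le hlt
  rw [integral_const_mul, mul_div_assoc, ← integral_div, ← mul_add]
  have i3 := i1.div_const (U x)
  have i4 : Integrable (fun z => bw z * (Real.log (U (x + ρ • z)) - Real.log (U x) - T ρ z)) := by
    refine (i2.sub i3).congr (Eventually.of_forall fun z => ?_)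
    simp only [hT, Pi.sub_apply]; ring
  rw [← integral_add i3 i4]
  congr 2; ext z
  simp only [hT]; ring

end

section

variable {N : ℕ}

lemma cos_quot : Tendsto (fun h : ℝ => (cos h - 1) / h ^ 2) (nhdsWithin 0 {0}ᶜ) (nhds (-(1/2))) := by
  have h1 : Tendsto (fun h : ℝ => h^2 * (5/96)) (nhdsWithin 0 {0}ᶜ) (nhds 0) := by
    have : Tendsto (fun h : ℝ => h^2 * (5/96)) (nhds 0) (nhds ((0:ℝ)^2 * (5/96))) := by
      apply Continuous.tendsto; fun_prop
    norm_num at this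
    exact this.mono_left nhdsWithin_le_nhds
  refine tendsto_of_tendsto_of_dist (tendsto_const_nhds (x := -(1/2:ℝ))) (squeeze_zero' (Eventually.of_forall fun _ => dist_nonneg) ?_ h1)
  have h2 : ∀ᶠ h : ℝ in nhdsWithin 0 {0}ᶜ, |h| ≤ 1 := by
    apply nhdsWithin_le_nhds
    have := Metric.closedBall_mem_nhds (0:ℝ) one_pos
    filter_upwards [this] with h hh
    simpa using hh
  filter_upwards [h2, self_mem_nhdsWithin] with h hh h0
  have h0' : h ≠ 0 := h0
  have hb := Real.cos_bound hh
  rw [Real.dist_eq]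
  have e : -(1/2) - (cos h - 1) / h^2 = - ((cos h - (1 - h^2/2)) / h^2) := by field_simp; ring
  have hp : 0 < h^2 := by positivity
  rw [e, abs_neg, abs_div, abs_of_pos hp, div_le_iff₀ hp]
  refine hb.trans (le_of_eq ?_)
  have : |h|^4 = h^4 := by rw [← abs_pow]; exact abs_of_nonneg (by positivity)
  rw [this]; ring

lemma Avg.cos (θ k : ℝ) (n x : EN N) :
    Avg (fun z => Real.cos (θ + k * ⟪z, n⟫)) x (-(bc N / 2) * k ^ 2 * ‖n‖ ^ 2 * Real.cos (θ + k * ⟪x, n⟫)) := by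
  refine ⟨⟨1, one_pos, by fun_prop⟩, ?_⟩
  have hrem : Tendsto (fun ρ : ℝ => ∫ z : EN N, (ρ^2)⁻¹ * (bw z * (Real.cos (ρ * (k * ⟪z, n⟫)) - 1)))
      (nhdsWithin 0 (Ioi 0)) (nhds (∫ z : EN N, - (k^2 / 2) * (bw z * ⟪z, n⟫ ^ 2))) := by
    apply tendsto_integral_filter_of_dominated_convergence (fun z => bw z * (k * ⟪z, n⟫)^2)
    · refine Eventually.of_forall fun ρ => ?_
      exact ((bw_mul_int _ (by fun_prop)).const_mul _).aestronglyMeasurable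
    · filter_upwards [self_mem_nhdsWithin] with ρ hρ
      have hρ0 : 0 < ρ := hρ
      refine Eventually.of_forall fun z => ?_
      have hρ2 : 0 < ρ^2 := by positivity
      rw [norm_mul, norm_mul, Real.norm_eq_abs, Real.norm_eq_abs, Real.norm_eq_abs, abs_of_nonneg (bw_nonneg z), abs_inv, abs_of_pos hρ2,
        inv_mul_le_iff₀ hρ2]
      have h1 : |Real.cos (ρ * (k * ⟪z, n⟫)) - 1| ≤ ρ^2 * (k * ⟪z, n⟫)^2 := by
        rw [abs_sub_comm, abs_of_nonneg (by linarith [Real.cos_le_one (ρ * (k * ⟪z, n⟫))])]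
        have := Real.one_sub_sq_div_two_le_cos (x := ρ * (k * ⟪z, n⟫))
        nlinarith [sq_nonneg (ρ * (k * ⟪z, n⟫))]
      calc _ ≤ bw z * (ρ^2 * (k * ⟪z, n⟫)^2) := mul_le_mul_of_nonneg_left h1 (bw_nonneg z)
        _ = _ := by ring
    · exact bw_mul_int _ (by fun_prop)
    · refine Eventually.of_forall fun z => ?_
      by_cases hz : k * ⟪z, n⟫ = 0
      · have h2 : - (k^2 / 2) * (bw z * ⟪z, n⟫ ^ 2) = 0 := by
          have : - (k^2 / 2) * (bw z * ⟪z, n⟫ ^ 2) = -(1/2) * bw z * (k * ⟪z, n⟫)^2 := by ring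
          rw [this, hz]; ring
        simp [hz, h2]
      have hl : Tendsto (fun ρ : ℝ => ρ * (k * ⟪z, n⟫)) (nhdsWithin 0 (Ioi 0)) (nhdsWithin 0 {0}ᶜ) := by
        apply tendsto_nhdsWithin_of_tendsto_nhds_of_eventually_within
        · have : Tendsto (fun ρ : ℝ => ρ * (k * ⟪z, n⟫)) (nhds 0) (nhds (0 * (k * ⟪z, n⟫))) := by
            apply Continuous.tendsto; fun_prop
          rw [zero_mul] at this
          exact this.mono_left nhdsWithin_le_nhds
        · filter_upwards [self_mem_nhdsWithin] with ρ hρ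
          exact mul_ne_zero (ne_of_gt hρ) hz
      have h1 := ((cos_quot.comp hl).const_mul (bw z * (k * ⟪z, n⟫)^2))
      have e : bw z * (k * ⟪z, n⟫)^2 * (-(1/2)) = - (k^2 / 2) * (bw z * ⟪z, n⟫ ^ 2) := by ring
      rw [e] at h1
      refine h1.congr' ?_
      filter_upwards [self_mem_nhdsWithin] with ρ hρ
      have hρ0 : ρ ≠ 0 := ne_of_gt hρ
      simp only [Function.comp]
      generalize k * ⟪z, n⟫ = q at hz ⊢
      field_simp
  have h2 := hrem.const_mul (Real.cos (θ + k * ⟪x, n⟫))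
  rw [integral_const_mul, bw_inner_sq] at h2
  have e : Real.cos (θ + k * ⟪x, n⟫) * (-(k ^ 2 / 2) * (bc N * ‖n‖ ^ 2)) = -(bc N / 2) * k ^ 2 * ‖n‖ ^ 2 * Real.cos (θ + k * ⟪x, n⟫) := by ring
  rw [e] at h2
  refine h2.congr fun ρ => ?_
  rw [integral_const_mul]
  have e1 : (fun z : EN N => bw z * (Real.cos (θ + k * ⟪x + ρ • z, n⟫) - Real.cos (θ + k * ⟪x, n⟫))) =
      fun z => Real.cos (θ + k * ⟪x, n⟫) * (bw z * (Real.cos (ρ * (k * ⟪z, n⟫)) - 1)) - Real.sin (θ + k * ⟪x, n⟫) * (bw z * Real.sin (ρ * (k * ⟪z, n⟫))) := by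
    ext z
    rw [inner_add_left, real_inner_smul_left]
    have : θ + k * (⟪x, n⟫ + ρ * ⟪z, n⟫) = (θ + k * ⟪x, n⟫) + ρ * (k * ⟪z, n⟫) := by ring
    rw [this, Real.cos_add]; ring
  rw [e1, integral_sub, integral_const_mul, integral_const_mul, bw_odd (fun z => Real.sin (ρ * (k * ⟪z, n⟫)))]
  · ring
  · intro z; rw [inner_neg_left, ← Real.sin_neg]; congr 1; ring
  · exact (bw_mul_int _ (by fun_prop)).const_mul _
  · exact (bw_mul_int _ (by fun_prop)).const_mul _

/-- eigenfunctions: averaged Laplacian -/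
lemma Avg.eigen (Ω : Set (EN N)) (hΩ : IsOpen Ω) (u : EN N → ℝ) (lam : ℝ) (hu : ContDiffOn ℝ 1 u Ω)
    (hw : ∀ φ : EN N → ℝ, ContDiff ℝ 1 φ → tsupport φ ⊆ Ω →
      ∫ x in Ω, ⟪gradient u x, gradient φ x⟫ = lam * ∫ x in Ω, u x * φ x) (x : EN N) (hx : x ∈ Ω) :
    Avg u x (-(bc N / 2) * lam * u x) := by
  obtain ⟨r, hr, hball⟩ := Metric.nhds_basis_closedBall.mem_iff.1 (hΩ.mem_nhds hx)
  have huc : ContinuousOn u (Metric.closedBall x r) := hu.continuousOn.mono hball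
  refine ⟨⟨r, hr, huc⟩, ?_⟩
  have hmem : ∀ ρ z, |ρ| ≤ r → ‖z‖ ≤ 1 → x + ρ • z ∈ Metric.closedBall x r := by
    intro ρ z h1 h2
    rw [mem_closedBall_iff_norm, add_sub_cancel_left, norm_smul, Real.norm_eq_abs]
    nlinarith [abs_nonneg ρ, norm_nonneg z]
  have hgc : ContinuousOn (gradient u) Ω := by
    unfold gradient
    exact (LinearIsometryEquiv.continuous _).comp_continuousOn (hu.continuousOn_fderiv_of_isOpen hΩ le_rfl)
  have hgc' := hgc.mono hball
  have hdiff : ∀ y ∈ Ω, HasGradientAt u (gradient u y) y := fun y hy =>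
    (((hu y hy).contDiffAt (hΩ.mem_nhds hy)).differentiableAt (by norm_num)).hasGradientAt
  obtain ⟨C, hC⟩ := (isCompact_closedBall x r).exists_bound_of_continuousOn hgc'
  have hcomp : ∀ ρ, |ρ| ≤ r → ContinuousOn (fun z : EN N => u (x + ρ • z)) (Metric.closedBall 0 1) := fun ρ hρ =>
    huc.comp (by fun_prop) (fun z hz => hmem ρ z hρ (mem_closedBall_zero_iff.1 hz))
  have hcompg : ∀ ρ, |ρ| ≤ r → ContinuousOn (fun z : EN N => ⟪gradient u (x + ρ • z), z⟫) (Metric.closedBall 0 1) := fun ρ hρ =>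
    ContinuousOn.inner (hgc'.comp (by fun_prop) (fun z hz => hmem ρ z hρ (mem_closedBall_zero_iff.1 hz))) continuousOn_id
  have hC0 : 0 ≤ C := (norm_nonneg _).trans (hC x (Metric.mem_closedBall_self hr.le))
  -- derivative of the average
  have hder : ∀ ρ, ρ ∈ Ioo 0 r → HasDerivAt (fun ρ => ∫ z, bw z * (u (x + ρ • z) - u x)) (∫ z, bw z * ⟪gradient u (x + ρ • z), z⟫) ρ := by
    intro ρ hρ
    have := hasDerivAt_integral_of_dominated_loc_of_deriv_le (μ := (volume : Measure (EN N))) (s := Ioo 0 r)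
      (F := fun ρ z => bw z * (u (x + ρ • z) - u x)) (x₀ := ρ)
      (F' := fun ρ z => bw z * ⟪gradient u (x + ρ • z), z⟫) (bound := fun z => bw z * C)
      (Ioo_mem_nhds hρ.1 hρ.2) ?_ ?_ ?_ ?_ ?_ ?_
    · exact this.2
    · filter_upwards [Ioo_mem_nhds hρ.1 hρ.2] with s hs
      exact (avg_int' huc hs.1.le hs.2.le).aestronglyMeasurable
    · exact avg_int' huc hρ.1.le hρ.2.le
    · exact (bw_mul_int _ (hcompg ρ (by rw [abs_of_pos hρ.1]; exact hρ.2.le))).aestronglyMeasurable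
    · refine Eventually.of_forall fun z s hs => ?_
      rw [norm_mul, Real.norm_eq_abs, abs_of_nonneg (bw_nonneg z)]
      by_cases hz : 1 ≤ ‖z‖
      · simp [bw_zero hz]
      push Not at hz
      refine mul_le_mul_of_nonneg_left ?_ (bw_nonneg z)
      have h1 := hC _ (hmem s z (by rw [abs_of_pos hs.1]; exact hs.2.le) hz.le)
      refine (norm_inner_le_norm _ _).trans ?_
      calc _ ≤ C * 1 := mul_le_mul h1 hz.le (norm_nonneg _) hC0
        _ = C := mul_one C
    · exact bw_int.mul_const _
    · refine Eventually.of_forall fun z s hs => ?_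
      by_cases hz : 1 ≤ ‖z‖
      · simp only [bw_zero hz, zero_mul]; exact hasDerivAt_const _ _
      push Not at hz
      have h1 := hdiff _ (hball (hmem s z (by rw [abs_of_pos hs.1]; exact hs.2.le) hz.le))
      have h2 : HasDerivAt (fun ρ : ℝ => x + ρ • z) z s := by
        simpa using ((hasDerivAt_id s).smul_const z).const_add x
      have h3 := h1.hasFDerivAt.comp_hasDerivAt s h2
      exact ((h3.sub_const (u x)).const_mul (bw z)).congr_deriv (by simp)
  -- weak equation
  have hweak : ∀ ρ, ρ ∈ Ioo 0 r → ∫ z, bw z * ⟪gradient u (x + ρ • z), z⟫ = - (lam * ρ * ∫ z, bE z * u (x + ρ • z)) := by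
    intro ρ hρ
    have hρ0 : 0 < ρ := hρ.1
    set φ : EN N → ℝ := fun y => bE (ρ⁻¹ • (y - x)) with hφ
    have hφC : ContDiff ℝ 1 φ := bE_contDiff.comp (by fun_prop)
    have hsupp : Function.support φ ⊆ Metric.closedBall x ρ := by
      intro y hy
      have := bE_supp (Function.mem_support.2 hy : bE (ρ⁻¹ • (y - x)) ≠ 0)
      rw [mem_closedBall_zero_iff, norm_smul, norm_inv, Real.norm_eq_abs, abs_of_pos hρ0, inv_mul_le_iff₀ hρ0, mul_one] at this
      rwa [mem_closedBall_iff_norm]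
    have hts : tsupport φ ⊆ Ω := (closure_minimal hsupp Metric.isClosed_closedBall).trans
      ((Metric.closedBall_subset_closedBall hρ.2.le).trans hball)
    have h := hw φ hφC hts
    have hgφ : ∀ y, gradient φ y = -(ρ⁻¹ * bw (ρ⁻¹ • (y - x))) • (ρ⁻¹ • (y - x)) := by
      intro y
      have h1 : HasFDerivAt (fun y : EN N => ρ⁻¹ • (y - x)) (ρ⁻¹ • ContinuousLinearMap.id ℝ (EN N)) y :=
        (((hasFDerivAt_id y).sub_const x).fun_const_smul ρ⁻¹)
      have h2 := (bE_fderiv (ρ⁻¹ • (y - x))).comp y h1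
      have h3 : HasGradientAt φ (-(ρ⁻¹ * bw (ρ⁻¹ • (y - x))) • (ρ⁻¹ • (y - x))) y := by
        rw [hasGradientAt_iff_hasFDerivAt]
        refine h2.congr_fderiv ?_
        ext v
        simp
        ring
      exact h3.gradient
    have e1 : ∫ y in Ω, ⟪gradient u y, gradient φ y⟫ = ∫ y, ⟪gradient u y, gradient φ y⟫ := by
      apply setIntegral_eq_integral_of_forall_compl_eq_zero
      intro y hy
      have : y ∉ tsupport φ := fun h => hy (hts h)
      have hz : gradient φ y = 0 := by
        have h4 : φ =ᶠ[nhds y] fun _ => 0 := notMem_tsupport_iff_eventuallyEq.1 this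
        unfold gradient
        rw [h4.fderiv_eq]; simp
      rw [hz, inner_zero_right]
    have e2 : ∫ y in Ω, u y * φ y = ∫ y, u y * φ y := by
      apply setIntegral_eq_integral_of_forall_compl_eq_zero
      intro y hy
      have : y ∉ tsupport φ := fun h => hy (hts h)
      rw [image_eq_zero_of_notMem_tsupport this, mul_zero]
    rw [e1, e2] at h
    have cv : ∀ f : EN N → ℝ, ∫ z, f (x + ρ • z) = (ρ ^ N)⁻¹ * ∫ y, f y := by
      intro f
      have h1 := Measure.integral_comp_smul (volume : Measure (EN N)) (fun z => f (x + z)) ρ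
      rw [integral_add_left_eq_self f x] at h1
      rw [h1]
      simp [abs_of_pos hρ0]
    have c1 := cv (fun y => ⟪gradient u y, gradient φ y⟫)
    have c2 := cv (fun y => u y * φ y)
    rw [h] at c1
    have c3 : ∫ z, ⟪gradient u (x + ρ • z), gradient φ (x + ρ • z)⟫ = lam * ∫ z, u (x + ρ • z) * φ (x + ρ • z) := by
      rw [c1, c2]; ring
    have e3 : ∀ z : EN N, ρ⁻¹ • (x + ρ • z - x) = z := by
      intro z; rw [add_sub_cancel_left, smul_smul, inv_mul_cancel₀ hρ0.ne', one_smul]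
    simp only [hgφ, e3, inner_smul_right] at c3
    simp only [hφ, e3] at c3
    have e4 : (fun z : EN N => -(ρ⁻¹ * bw z) * ⟪gradient u (x + ρ • z), z⟫) = fun z => -ρ⁻¹ * (bw z * ⟪gradient u (x + ρ • z), z⟫) := by
      ext z; ring
    rw [e4, integral_const_mul] at c3
    have e5 : (fun z : EN N => bE z * u (x + ρ • z)) = fun z => u (x + ρ • z) * bE z := by ext z; ring
    rw [e5]
    have : ∫ z, bw z * ⟪gradient u (x + ρ • z), z⟫ = -ρ * (-ρ⁻¹ * ∫ z, bw z * ⟪gradient u (x + ρ • z), z⟫) := by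
      field_simp
    rw [this, c3]; ring
  -- limit of the right-hand side
  have hlim : Tendsto (fun ρ : ℝ => ∫ z, bE z * u (x + ρ • z)) (nhdsWithin 0 (Ioi 0)) (nhds (∫ z : EN N, bE z * u x)) := by
    obtain ⟨M, hM⟩ := (isCompact_closedBall x r).exists_bound_of_continuousOn huc
    apply tendsto_integral_filter_of_dominated_convergence (fun z => bE z * M)
    · filter_upwards [Ioo_mem_nhdsGT hr] with ρ hρ
      have : Integrable (fun z => bE z * u (x + ρ • z)) := by
        rw [← integrableOn_iff_integrable_of_support_subset (s := Metric.closedBall 0 1)]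
        · exact (bE_cont.continuousOn.mul (avg_int huc hρ.1.le hρ.2.le)).integrableOn_compact (isCompact_closedBall 0 1)
        · exact (Function.support_mul_subset_left _ _).trans bE_supp
      exact this.aestronglyMeasurable
    · filter_upwards [Ioo_mem_nhdsGT hr] with ρ hρ
      refine Eventually.of_forall fun z => ?_
      rw [norm_mul, Real.norm_eq_abs, abs_of_nonneg (bE_nonneg z)]
      by_cases hz : 1 ≤ ‖z‖
      · simp [bE_zero hz]
      push Not at hz
      exact mul_le_mul_of_nonneg_left (hM _ (hmem ρ z (by rw [abs_of_pos hρ.1]; exact hρ.2.le) hz.le)) (bE_nonneg z)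
    · exact bE_int.mul_const _
    · refine Eventually.of_forall fun z => ?_
      have h1 : ContinuousAt u x := hu.continuousOn.continuousAt (hΩ.mem_nhds hx)
      have h2 : Tendsto (fun ρ : ℝ => x + ρ • z) (nhdsWithin 0 (Ioi 0)) (nhds x) := by
        have : Tendsto (fun ρ : ℝ => x + ρ • z) (nhds 0) (nhds (x + (0:ℝ) • z)) := by
          apply Continuous.tendsto; fun_prop
        rw [zero_smul, add_zero] at this
        exact this.mono_left nhdsWithin_le_nhds
      exact (h1.tendsto.comp h2).const_mul _
  rw [integral_mul_const] at hlim
  -- l'Hopital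
  have hlim0 : Tendsto (fun ρ : ℝ => ∫ z, bw z * (u (x + ρ • z) - u x)) (nhdsWithin 0 (Ioi 0)) (nhds 0) := by
    obtain ⟨M, hM⟩ := (isCompact_closedBall x r).exists_bound_of_continuousOn huc
    have h0 : Tendsto (fun ρ : ℝ => ∫ z, bw z * (u (x + ρ • z) - u x)) (nhdsWithin 0 (Ioi 0)) (nhds (∫ z : EN N, 0)) := by
      apply tendsto_integral_filter_of_dominated_convergence (fun z => bw z * (M + M))
      · filter_upwards [Ioo_mem_nhdsGT hr] with ρ hρ
        exact (avg_int' huc hρ.1.le hρ.2.le).aestronglyMeasurable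
      · filter_upwards [Ioo_mem_nhdsGT hr] with ρ hρ
        refine Eventually.of_forall fun z => ?_
        rw [norm_mul, Real.norm_eq_abs, abs_of_nonneg (bw_nonneg z)]
        by_cases hz : 1 ≤ ‖z‖
        · simp [bw_zero hz]
        push Not at hz
        refine mul_le_mul_of_nonneg_left ((norm_sub_le _ _).trans (add_le_add ?_ ?_)) (bw_nonneg z)
        · exact hM _ (hmem ρ z (by rw [abs_of_pos hρ.1]; exact hρ.2.le) hz.le)
        · exact hM _ (Metric.mem_closedBall_self hr.le)
      · exact bw_int.mul_const _
      · refine Eventually.of_forall fun z => ?_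
        have h1 : ContinuousAt u x := hu.continuousOn.continuousAt (hΩ.mem_nhds hx)
        have h2 : Tendsto (fun ρ : ℝ => x + ρ • z) (nhdsWithin 0 (Ioi 0)) (nhds x) := by
          have : Tendsto (fun ρ : ℝ => x + ρ • z) (nhds 0) (nhds (x + (0:ℝ) • z)) := by
            apply Continuous.tendsto; fun_prop
          rw [zero_smul, add_zero] at this
          exact this.mono_left nhdsWithin_le_nhds
        have := ((h1.tendsto.comp h2).sub_const (u x)).const_mul (bw z)
        simpa using this
    simpa using h0
  have hsq0 : Tendsto (fun ρ : ℝ => ρ^2) (nhdsWithin 0 (Ioi 0)) (nhds 0) := by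
    have : Tendsto (fun ρ : ℝ => ρ^2) (nhds 0) (nhds ((0:ℝ)^2)) := by
      apply Continuous.tendsto; fun_prop
    norm_num at this
    exact this.mono_left nhdsWithin_le_nhds
  have hfin : Tendsto (fun ρ : ℝ => (∫ z, bw z * ⟪gradient u (x + ρ • z), z⟫) / (2 * ρ)) (nhdsWithin 0 (Ioi 0))
      (nhds (-(bc N / 2) * lam * u x)) := by
    have h1 := hlim.const_mul (-(lam / 2))
    have e : -(lam / 2) * ((∫ z : EN N, bE z) * u x) = -(bc N / 2) * lam * u x := by unfold bc; ring
    rw [e] at h1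
    refine h1.congr' ?_
    filter_upwards [Ioo_mem_nhdsGT hr] with ρ hρ
    have hρ0 : ρ ≠ 0 := hρ.1.ne'
    rw [hweak ρ hρ]
    field_simp
  have hL := HasDerivAt.lhopital_zero_nhdsGT (f := fun ρ : ℝ => ∫ z, bw z * (u (x + ρ • z) - u x)) (g := fun ρ : ℝ => ρ^2)
    (g' := fun ρ => 2 * ρ) (Filter.eventually_of_mem (Ioo_mem_nhdsGT hr) hder) (Eventually.of_forall fun ρ => by simpa using hasDerivAt_pow 2 ρ)
    (by filter_upwards [self_mem_nhdsWithin] with ρ hρ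
        have : 0 < ρ := hρ
        positivity) hlim0 hsq0 hfin
  refine hL.congr fun ρ => ?_
  rw [div_eq_inv_mul]

end

section

variable {N : ℕ}

lemma logcurve {V : EN N → ℝ} {G : EN N} {c : ℝ → EN N} {c' : EN N} (hG : HasGradientAt V G (c 0)) (hp : 0 < V (c 0))
    (hc : HasDerivAt c c' 0) : HasDerivAt (fun t => Real.log (V (c t))) (⟪(V (c 0))⁻¹ • G, c'⟫) 0 := by
  have h1 := hG.hasFDerivAt.comp_hasDerivAt (0:ℝ) hc
  have h2 := h1.log hp.ne'
  refine h2.congr_deriv ?_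
  simp [real_inner_smul_left, div_eq_inv_mul]

lemma logcos_deriv {c : ℝ → ℝ} {c' : ℝ} (k : ℝ) (hc : HasDerivAt c c' 0) (hp : 0 < Real.cos (c 0)) :
    HasDerivAt (fun t => k * Real.log (Real.cos (c t))) (-k * Real.tan (c 0) * c') 0 := by
  have h2 := ((hc.cos).log hp.ne').const_mul k
  refine h2.congr_deriv ?_
  rw [Real.tan_eq_sin_div_cos]
  field_simp

lemma avg_logcos (k A : ℝ) (e : EN N) (he : ‖e‖ = 1) (hp : 0 < Real.cos A) :
    Avg (fun z => Real.log (Real.cos (A + k * ⟪z, e⟫))) 0 (-(bc N / 2) * (k ^ 2 * (1 + Real.tan A ^ 2))) := by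
  have h1 := Avg.cos A k e 0
  have hg : HasGradientAt (fun z : EN N => Real.cos (A + k * ⟪z, e⟫)) (-(Real.sin A * k) • e) 0 := by
    rw [hasGradientAt_iff_hasFDerivAt]
    have hf : HasFDerivAt (fun z : EN N => A + k * ⟪z, e⟫) (k • innerSL ℝ e) 0 := by
      have := ((innerSL ℝ e).hasFDerivAt (x := (0 : EN N))).const_mul k |>.const_add A
      refine this.congr_of_eventuallyEq (Eventually.of_forall fun y => ?_)
      simp [real_inner_comm]
    refine (hf.cos).congr_fderiv ?_
    ext v
    simp; ring
  have h2 := h1.log (by simpa using hp) hg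
  refine (congrArg (Avg _ _) ?_).mp h2
  simp only [inner_zero_left, mul_zero, add_zero, norm_smul, he, Real.tan_eq_sin_div_cos, Real.norm_eq_abs, mul_one, sq_abs, neg_sq, one_pow, abs_neg]
  field_simp
  ring

set_option maxHeartbeats 1000000 in
theorem max_contra (p q e : EN N) (r σ a b ε lam : ℝ) (U V3 V4 : EN N → ℝ) (G1 G2 G3 G4 : EN N) (L3 L4 : ℝ)
    (hr : 0 < r) (hσ : |σ| < 1) (he : ‖e‖ = 1) (hpq : p - q = (2 * r) • e)
    (hca : 0 < cos (a * r)) (hcb : 0 < cos (b * (σ * r))) (hε : ε < a ^ 2 - b ^ 2)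
    (hA1 : Avg U p (-(bc N / 2) * lam * U p)) (hA2 : Avg U q (-(bc N / 2) * lam * U q))
    (hA3 : Avg V3 ((1/2:ℝ) • (p + q) + (σ/2) • (p - q)) L3) (hA4 : Avg V4 ((1/2:ℝ) • (p + q) - (σ/2) • (p - q)) L4)
    (hL3 : L3 ≤ bc N / 2 * (-lam + ε) * V3 ((1/2:ℝ) • (p + q) + (σ/2) • (p - q)))
    (hL4 : L4 ≤ bc N / 2 * (-lam + ε) * V4 ((1/2:ℝ) • (p + q) - (σ/2) • (p - q)))
    (hp1 : 0 < U p) (hp2 : 0 < U q) (hp3 : 0 < V3 ((1/2:ℝ) • (p + q) + (σ/2) • (p - q)))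
    (hp4 : 0 < V4 ((1/2:ℝ) • (p + q) - (σ/2) • (p - q)))
    (hG1 : HasGradientAt U G1 p) (hG2 : HasGradientAt U G2 q)
    (hG3 : HasGradientAt V3 G3 ((1/2:ℝ) • (p + q) + (σ/2) • (p - q)))
    (hG4 : HasGradientAt V4 G4 ((1/2:ℝ) • (p + q) - (σ/2) • (p - q)))
    (Θ : EN N × EN N × ℝ → ℝ)
    (hΘ : ∀ w, Θ w = Real.log (U w.1) + Real.log (U w.2.1)
      + (-1) * Real.log (V3 ((1/2:ℝ) • (w.1 + w.2.1) + (w.2.2/2) • (w.1 - w.2.1)))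
      + (-1) * Real.log (V4 ((1/2:ℝ) • (w.1 + w.2.1) - (w.2.2/2) • (w.1 - w.2.1)))
      + (-2) * Real.log (cos (a * (‖w.1 - w.2.1‖ / 2))) + 2 * Real.log (cos (b * (w.2.2 * (‖w.1 - w.2.1‖ / 2)))))
    (hmax : ∀ᶠ w in nhds (p, q, σ), Θ w ≤ Θ (p, q, σ)) : False := by
  have hnpq : ‖p - q‖ / 2 = r := by
    rw [hpq, norm_smul, he, Real.norm_eq_abs, abs_of_pos (by linarith)]; ring
  set x3 := (1/2:ℝ) • (p + q) + (σ/2) • (p - q) with hx3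
  set x4 := (1/2:ℝ) • (p + q) - (σ/2) • (p - q) with hx4
  set g1 := (U p)⁻¹ • G1 with hg1
  set g2 := (U q)⁻¹ • G2 with hg2
  set g3 := (V3 x3)⁻¹ • G3 with hg3
  set g4 := (V4 x4)⁻¹ • G4 with hg4
  set ta := tan (a * r) with hta
  set tb := tan (b * (σ * r)) with htb
  -- first order
  have first : ∀ (ξ η : EN N) (τ : ℝ), ⟪g1, ξ⟫ + ⟪g2, η⟫ - ⟪g3, (1/2:ℝ) • (ξ + η) + ((σ/2) • (ξ - η) + (τ/2) • (p - q))⟫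
      - ⟪g4, (1/2:ℝ) • (ξ + η) - ((σ/2) • (ξ - η) + (τ/2) • (p - q))⟫ + 2 * ta * (a * (⟪e, ξ - η⟫ / 2))
      - 2 * tb * (b * (τ * r + σ * (⟪e, ξ - η⟫ / 2))) = 0 := by
    intro ξ η τ
    have d1 : HasDerivAt (fun t : ℝ => p + t • ξ) ξ 0 := by
      simpa using ((hasDerivAt_id (0:ℝ)).smul_const ξ).const_add p
    have d2 : HasDerivAt (fun t : ℝ => q + t • η) η 0 := by
      simpa using ((hasDerivAt_id (0:ℝ)).smul_const η).const_add q
    have d0 : HasDerivAt (fun t : ℝ => σ + t * τ) τ 0 := by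
      simpa using ((hasDerivAt_id (0:ℝ)).mul_const τ).const_add σ
    have ds : HasDerivAt (fun t : ℝ => (1/2:ℝ) • ((p + t • ξ) + (q + t • η))) ((1/2:ℝ) • (ξ + η)) 0 := (d1.fun_add d2).fun_const_smul _
    have dd : HasDerivAt (fun t : ℝ => (p + t • ξ) - (q + t • η)) (ξ - η) 0 := d1.fun_sub d2
    have dm : HasDerivAt (fun t : ℝ => ((σ + t * τ)/2) • ((p + t • ξ) - (q + t • η))) ((σ/2) • (ξ - η) + (τ/2) • (p - q)) 0 := by
      refine ((d0.div_const 2).fun_smul dd).congr_deriv ?_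
      simp
    have dn : HasDerivAt (fun t : ℝ => ‖(p + t • ξ) - (q + t • η)‖ / 2) (⟪e, ξ - η⟫ / 2) 0 := by
      have h1 := dd.norm_sq
      have h2 := h1.sqrt (by simp only [zero_smul, add_zero]; have : 0 < ‖p - q‖ := by linarith
                             positivity)
      have h3 := h2.div_const 2
      simp only [Real.sqrt_sq (norm_nonneg _)] at h3
      refine h3.congr_deriv ?_
      have h4 : ‖p - q‖ = 2 * r := by linarith
      simp only [zero_smul, add_zero, h4]
      rw [hpq, real_inner_smul_left]
      field_simp
    have t1 := logcurve (V := U) (G := G1) (c := fun t : ℝ => p + t • ξ) (by simpa using hG1) (by simpa using hp1) d1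
    have t2 := logcurve (V := U) (G := G2) (c := fun t : ℝ => q + t • η) (by simpa using hG2) (by simpa using hp2) d2
    have t3 := (logcurve (V := V3) (G := G3) (c := fun t : ℝ => (1/2:ℝ) • ((p + t • ξ) + (q + t • η)) + ((σ + t * τ)/2) • ((p + t • ξ) - (q + t • η)))
      (by simpa only [zero_smul, add_zero, zero_mul, ← hx3] using hG3) (by simpa only [zero_smul, add_zero, zero_mul, ← hx3] using hp3) (ds.fun_add dm)).const_mul (-1)
    have t4 := (logcurve (V := V4) (G := G4) (c := fun t : ℝ => (1/2:ℝ) • ((p + t • ξ) + (q + t • η)) - ((σ + t * τ)/2) • ((p + t • ξ) - (q + t • η)))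
      (by simpa only [zero_smul, add_zero, zero_mul, ← hx4] using hG4) (by simpa only [zero_smul, add_zero, zero_mul, ← hx4] using hp4) (ds.fun_sub dm)).const_mul (-1)
    have t5 := logcos_deriv (-2) (dn.const_mul a) (by simpa [hnpq] using hca)
    have t6 := logcos_deriv 2 ((d0.fun_mul dn).const_mul b) (by simpa [hnpq] using hcb)
    have tt := ((((t1.fun_add t2).fun_add t3).fun_add t4).fun_add t5).fun_add t6
    have hloc : IsLocalMax (fun t : ℝ => Θ (p + t • ξ, q + t • η, σ + t * τ)) 0 := by
      have hcont : Tendsto (fun t : ℝ => ((p + t • ξ, q + t • η, σ + t * τ) : EN N × EN N × ℝ)) (nhds 0) (nhds (p, q, σ)) := by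
        have : Continuous (fun t : ℝ => ((p + t • ξ, q + t • η, σ + t * τ) : EN N × EN N × ℝ)) := by fun_prop
        simpa using this.tendsto 0
      have := hcont.eventually hmax
      unfold IsLocalMax IsMaxFilter
      simpa using this
    have hz := hloc.hasDerivAt_eq_zero (f' := _) (by
      simp only [hΘ]
      exact tt)
    simp only [zero_smul, add_zero, zero_mul, hnpq] at hz
    rw [← hx3, ← hx4] at hz
    rw [← hta, ← htb, ← hg1, ← hg2, ← hg3, ← hg4] at hz
    linarith
  -- vector identities
  have hB : ⟪g3 - g4, e⟫ = -2 * b * tb := by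
    have h := first 0 0 1
    simp only [add_zero, sub_zero, smul_zero, inner_zero_right, zero_add, zero_sub, inner_neg_right, hpq, inner_smul_right] at h
    have h2 : r * (⟪g3 - g4, e⟫ + 2 * b * tb) = 0 := by
      rw [inner_sub_left]; linarith
    have := (mul_eq_zero.1 h2).resolve_left hr.ne'
    linarith
  have hS : g1 + g2 = g3 + g4 := by
    rw [← sub_eq_zero]
    refine ext_inner_right ℝ fun ξ => ?_
    have h := first ξ ξ 0
    have e1 : (1/2:ℝ) • (ξ + ξ) = ξ := by rw [← two_smul ℝ ξ, smul_smul]; norm_num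
    simp only [sub_self, smul_zero, inner_zero_right, zero_div, zero_smul, add_zero, sub_zero, zero_mul, mul_zero, e1] at h
    rw [inner_zero_left, inner_sub_left, inner_add_left, inner_add_left]
    linarith
  have hP : g1 - g2 = σ • (g3 - g4) + (-2 * (a * ta - b * σ * tb)) • e := by
    rw [← sub_eq_zero]
    refine ext_inner_right ℝ fun ξ => ?_
    have h := first ξ (-ξ) 0
    have e1 : ξ - -ξ = (2:ℝ) • ξ := by rw [two_smul]; abel
    simp only [e1, add_neg_cancel, smul_zero, inner_zero_right, inner_neg_right, zero_div, zero_smul, add_zero, zero_add, zero_sub, inner_smul_right, zero_mul] at h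
    have q1 : ⟪σ • (g3 - g4), ξ⟫ = σ * (⟪g3, ξ⟫ - ⟪g4, ξ⟫) := by rw [real_inner_smul_left, inner_sub_left]
    have q2 : ⟪(-2 * (a * ta - b * σ * tb)) • e, ξ⟫ = (-2 * (a * ta - b * σ * tb)) * ⟪e, ξ⟫ := real_inner_smul_left _ _ _
    rw [inner_zero_left, inner_sub_left, inner_sub_left, inner_add_left, q1, q2]
    linarith
  -- second order
  let R : EN N ≃ₗᵢ[ℝ] EN N := ((Submodule.span ℝ {e}).reflection).trans (LinearIsometryEquiv.neg ℝ)
  have hR : ∀ z, R z = z - (2 * ⟪z, e⟫) • e := by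
    intro z
    simp only [R, LinearIsometryEquiv.trans_apply, LinearIsometryEquiv.coe_neg]
    rw [Submodule.reflection_singleton_apply]
    simp only [he]
    rw [real_inner_comm]
    simp only [RCLike.ofReal_real_eq_id, id]
    rw [neg_sub, mul_smul]
    norm_num
    rw [two_smul, two_smul]
  have a1 := ((hA1.log hp1 hG1).comp_isometry (LinearIsometryEquiv.refl ℝ (EN N)))
  have a2 := ((hA2.log hp2 hG2).comp_isometry R)
  have a3 := (((hA3.log hp3 hG3).comp_isometry (LinearIsometryEquiv.refl ℝ (EN N)))).const_mul (-1)
  have a4 := (((hA4.log hp4 hG4).comp_isometry R)).const_mul (-1)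
  have a5 := (avg_logcos a (a * r) e he hca).const_mul (-2)
  have a6 := (avg_logcos b (b * (σ * r)) e he hcb).const_mul 2
  have aa := ((((a1.add a2).add a3).add a4).add a5).add a6
  have hle := aa.le_zero (by
    set S : EN N → ℝ := fun z => (σ * r + ⟪z, e⟫) / (r + ⟪z, e⟫) with hS'
    have hcS : Tendsto (fun z : EN N => ((p + z, q + R z, S z) : EN N × EN N × ℝ)) (nhds 0) (nhds (p, q, σ)) := by
      have h1 : ContinuousAt (fun z : EN N => ((p + z, q + R z, S z) : EN N × EN N × ℝ)) 0 := by
        have h2 : ContinuousAt S 0 := by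
          apply ContinuousAt.div (by fun_prop) (by fun_prop)
          simpa using hr.ne'
        have h3 : Continuous (fun z : EN N => q + R z) := by fun_prop
        exact ContinuousAt.prodMk (by fun_prop) (h3.continuousAt.prodMk h2)
      have h4 : S 0 = σ := by simp only [hS', inner_zero_left, add_zero]; field_simp
      have := h1.tendsto
      simpa [h4] using this
    have hpos : ∀ᶠ z : EN N in nhds 0, 0 < r + ⟪z, e⟫ := by
      have : Continuous (fun z : EN N => r + ⟪z, e⟫) := by fun_prop
      have h2 := this.continuousAt (x := 0)
      exact h2.eventually_const_lt (by simpa using hr)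
    filter_upwards [hcS.eventually hmax, hpos] with z hz hzp
    have f1 : (p + z) - (q + R z) = (2 * (r + ⟪z, e⟫)) • e := by
      rw [hR]
      have : p + z - (q + (z - (2 * ⟪z, e⟫) • e)) = (p - q) + (2 * ⟪z, e⟫) • e := by abel
      rw [this, hpq, ← add_smul]; congr 1; ring
    have f2 : ‖(p + z) - (q + R z)‖ / 2 = r + ⟪z, e⟫ := by
      rw [f1, norm_smul, he, Real.norm_eq_abs, abs_of_pos (by linarith)]; ring
    have f3 : (S z / 2) • ((p + z) - (q + R z)) = (σ * r + ⟪z, e⟫) • e := by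
      rw [f1, smul_smul]; congr 1; simp only [hS']; field_simp
    have f0 : (σ/2) • (p - q) = (σ * r) • e := by rw [hpq, smul_smul]; congr 1; ring
    have fm : (1/2:ℝ) • ((p + z) + (q + R z)) = (1/2:ℝ) • (p + q) + (z - ⟪z, e⟫ • e) := by
      rw [hR]
      have : p + z + (q + (z - (2 * ⟪z, e⟫) • e)) = (p + q) + (2:ℝ) • (z - ⟪z, e⟫ • e) := by
        rw [smul_sub, smul_smul, two_smul]; abel
      rw [this, smul_add, smul_smul]; norm_num
    have f4 : (1/2:ℝ) • ((p + z) + (q + R z)) + (S z / 2) • ((p + z) - (q + R z)) = x3 + z := by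
      rw [f3, fm, hx3, f0, add_smul]; abel
    have f5 : (1/2:ℝ) • ((p + z) + (q + R z)) - (S z / 2) • ((p + z) - (q + R z)) = x4 + R z := by
      have f7 : (2 * ⟪z, e⟫) • e = ⟪z, e⟫ • e + ⟪z, e⟫ • e := by rw [← add_smul]; congr 1; ring
      rw [f3, fm, hx4, f0, add_smul, hR, f7]; abel
    have f6 : S z * (r + ⟪z, e⟫) = σ * r + ⟪z, e⟫ := by simp only [hS']; field_simp
    simp only [hΘ] at hz
    rw [f2, f4, f5, f6, hnpq, ← hx3, ← hx4] at hz
    simp only [LinearIsometryEquiv.coe_refl, id, add_zero, map_zero, inner_zero_left, mul_zero]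
    rw [← mul_add a, ← mul_add b]
    exact hz)
  have hbc := bc_pos (N := N)
  have n1 : ‖G1‖ ^ 2 / U p ^ 2 = ‖g1‖ ^ 2 := by
    rw [hg1, norm_smul, mul_pow, norm_inv, Real.norm_eq_abs, abs_of_pos hp1]; field_simp
  have n2 : ‖G2‖ ^ 2 / U q ^ 2 = ‖g2‖ ^ 2 := by
    rw [hg2, norm_smul, mul_pow, norm_inv, Real.norm_eq_abs, abs_of_pos hp2]; field_simp
  have n3 : ‖G3‖ ^ 2 / V3 x3 ^ 2 = ‖g3‖ ^ 2 := by
    rw [hg3, norm_smul, mul_pow, norm_inv, Real.norm_eq_abs, abs_of_pos hp3]; field_simp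
  have n4 : ‖G4‖ ^ 2 / V4 x4 ^ 2 = ‖g4‖ ^ 2 := by
    rw [hg4, norm_smul, mul_pow, norm_inv, Real.norm_eq_abs, abs_of_pos hp4]; field_simp
  rw [n1, n2, n3, n4] at hle
  have l1 : -(bc N / 2) * lam * U p / U p = -(bc N / 2) * lam := by field_simp
  have l2 : -(bc N / 2) * lam * U q / U q = -(bc N / 2) * lam := by field_simp
  have l3 : L3 / V3 x3 ≤ bc N / 2 * (-lam + ε) := by rwa [div_le_iff₀ hp3]
  have l4 : L4 / V4 x4 ≤ bc N / 2 * (-lam + ε) := by rwa [div_le_iff₀ hp4]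
  rw [l1, l2] at hle
  have par1 : ‖g1 + g2‖ ^ 2 + ‖g1 - g2‖ ^ 2 = 2 * (‖g1‖ ^ 2 + ‖g2‖ ^ 2) := by
    rw [norm_add_sq_real, norm_sub_sq_real]; ring
  have par2 : ‖g3 + g4‖ ^ 2 + ‖g3 - g4‖ ^ 2 = 2 * (‖g3‖ ^ 2 + ‖g4‖ ^ 2) := by
    rw [norm_add_sq_real, norm_sub_sq_real]; ring
  rw [hS] at par1
  have hPn : ‖g1 - g2‖ ^ 2 = σ ^ 2 * ‖g3 - g4‖ ^ 2 + 2 * (σ * (-2 * (a * ta - b * σ * tb)) * (-2 * b * tb)) + (-2 * (a * ta - b * σ * tb)) ^ 2 := by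
    rw [hP, norm_add_sq_real, norm_smul, norm_smul, real_inner_smul_left, inner_smul_right, hB, he, mul_pow, Real.norm_eq_abs, Real.norm_eq_abs, sq_abs, mul_one, sq_abs]
    ring
  have hBn : (-2 * b * tb) ^ 2 ≤ ‖g3 - g4‖ ^ 2 := by
    rw [← hB]
    have := abs_real_inner_le_norm (g3 - g4) e
    rw [he, mul_one] at this
    exact sq_le_sq' (by linarith [neg_abs_le ⟪g3 - g4, e⟫]) (by linarith [le_abs_self ⟪g3 - g4, e⟫])
  have hσ2 : 0 ≤ 1 - σ ^ 2 := by
    have := abs_lt.1 hσ; nlinarith [mul_pos (by linarith [this.1] : 0 < 1 + σ) (by linarith [this.2] : 0 < 1 - σ)]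
  have key := mul_le_mul_of_nonneg_left hBn hσ2
  set β := bc N / 2 with hβ
  have hβ0 : 0 < β := by positivity
  -- conclude
  have hfin : β * (-‖g1‖^2 - ‖g2‖^2 + ‖g3‖^2 + ‖g4‖^2 - 2 * ε + 2 * a^2 * (1 + ta^2) - 2 * b^2 * (1 + tb^2)) ≤ 0 := by
    rw [← hta, ← htb] at hle
    clear_value β g1 g2 g3 g4 ta tb
    clear hP hS hB first aa a1 a2 a3 a4 a5 a6
    linarith
  have hX : -‖g1‖^2 - ‖g2‖^2 + ‖g3‖^2 + ‖g4‖^2 - 2 * ε + 2 * a^2 * (1 + ta^2) - 2 * b^2 * (1 + tb^2) > 0 := by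
    clear_value β g1 g2 g3 g4 ta tb
    clear hP hS hB first aa a1 a2 a3 a4 a5 a6 hle
    linarith
  have := mul_pos hβ0 hX
  linarith

end

section

variable {N : ℕ}

def bet (Ω : Set (EN N)) (κ : ℝ) (z : EN N) : ℝ := Real.cos (max 0 (1 - κ * Metric.infDist z Ωᶜ))

lemma bet_cont (Ω : Set (EN N)) (κ : ℝ) : Continuous (bet Ω κ) := by
  unfold bet
  have := Metric.continuous_infDist_pt (Ωᶜ : Set (EN N))
  fun_prop

lemma bet_arg (Ω : Set (EN N)) (κ : ℝ) (hκ : 0 ≤ κ) (z : EN N) :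
    0 ≤ max 0 (1 - κ * Metric.infDist z Ωᶜ) ∧ max 0 (1 - κ * Metric.infDist z Ωᶜ) ≤ 1 := by
  refine ⟨le_max_left _ _, max_le zero_le_one ?_⟩
  have := mul_nonneg hκ (Metric.infDist_nonneg (x := z) (s := Ωᶜ))
  linarith

lemma bet_pos (Ω : Set (EN N)) (κ : ℝ) (hκ : 0 ≤ κ) (z : EN N) : 0 < bet Ω κ z := by
  obtain ⟨h1, h2⟩ := bet_arg Ω κ hκ z
  apply Real.cos_pos_of_mem_Ioo
  constructor <;> linarith [Real.pi_gt_three]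

lemma bet_le (Ω : Set (EN N)) (κ : ℝ) (z : EN N) : bet Ω κ z ≤ 1 := Real.cos_le_one _

theorem touching (Ω : Set (EN N)) (hΩ : IsOpen Ω) (hc : Convex ℝ Ω) (hne : (Ωᶜ).Nonempty) (u : EN N → ℝ) (lam ε δ c0 κ : ℝ)
    (hl : 0 ≤ lam) (hε : 0 < ε) (hδ : 0 < δ) (hκ : 0 < κ) (hκ2 : κ ^ 2 = lam + 1)
    (hu : ContDiffOn ℝ 1 u Ω) (hup : ∀ x ∈ Ω, 0 < u x)
    (hw : ∀ φ : EN N → ℝ, ContDiff ℝ 1 φ → tsupport φ ⊆ Ω →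
      ∫ x in Ω, ⟪gradient u x, gradient φ x⟫ = lam * ∫ x in Ω, u x * φ x)
    (hc0 : ∀ x ∈ Ω, 1 ≤ κ * Metric.infDist x Ωᶜ → c0 ≤ u x) (hδ2 : lam * δ ≤ ε * c0) (x : EN N) (hx : x ∈ Ω) :
    ∃ (V : EN N → ℝ) (G : EN N) (L : ℝ), (∀ᶠ z in nhds x, u z + δ * bet Ω κ z ≤ V z) ∧ V x = u x + δ * bet Ω κ x ∧
      HasGradientAt V G x ∧ Avg V x L ∧ L ≤ bc N / 2 * (-lam + ε) * V x := by
  have hA := Avg.eigen Ω hΩ u lam hu hw x hx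
  have hdu : DifferentiableAt ℝ u x := (hu.differentiableOn one_ne_zero).differentiableAt (hΩ.mem_nhds hx)
  have hgu : HasGradientAt u (gradient u x) x := hdu.hasGradientAt
  have hbc := bc_pos (N := N)
  have hux := hup x hx
  by_cases h1 : 1 ≤ κ * Metric.infDist x Ωᶜ
  · refine ⟨fun z => u z + δ * 1, gradient u x, _, ?_, ?_, ?_, hA.add (Avg.const (δ * 1) x), ?_⟩
    · exact Eventually.of_forall fun z => by
        have := mul_le_mul_of_nonneg_left (bet_le Ω κ z) hδ.le
        simpa using this
    · have : bet Ω κ x = 1 := by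
        unfold bet; rw [max_eq_left (by linarith), Real.cos_zero]
      rw [this]
    · rw [hasGradientAt_iff_hasFDerivAt] at hgu ⊢
      exact hgu.add_const _
    · have h2 := mul_le_mul_of_nonneg_left (hc0 x hx h1) hε.le
      have h3 : -lam * u x ≤ (-lam + ε) * (u x + δ * 1) := by nlinarith [mul_pos hε hδ]
      have h4 := mul_le_mul_of_nonneg_left h3 (by positivity : 0 ≤ bc N / 2)
      linarith
  · push Not at h1
    obtain ⟨y, hy, hxy⟩ := hΩ.isClosed_compl.exists_infDist_eq_dist hne x
    obtain ⟨f, hf⟩ := geometric_hahn_banach_open_point hc hΩ hy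
    set n0 := (InnerProductSpace.toDual ℝ (EN N)).symm f with hn0
    have hfn : ∀ z, f z = ⟪n0, z⟫ := fun z => by rw [hn0, InnerProductSpace.toDual_symm_apply]
    have hn0' : n0 ≠ 0 := by
      intro h
      have := hf x hx
      rw [hfn, hfn, h, inner_zero_left, inner_zero_left] at this
      exact lt_irrefl _ this
    have hnpos : 0 < ‖n0‖ := norm_pos_iff.2 hn0'
    set n := (-‖n0‖⁻¹) • n0 with hn
    have hn1 : ‖n‖ = 1 := by
      rw [hn, norm_smul, norm_neg, norm_inv, norm_norm, inv_mul_cancel₀ hnpos.ne']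
    have hpos : ∀ z ∈ Ω, 0 < ⟪z - y, n⟫ := by
      intro z hz
      have := hf z hz
      rw [hfn, hfn] at this
      rw [hn, real_inner_smul_right, inner_sub_left, real_inner_comm, real_inner_comm n0 y]
      have h3 : 0 < ‖n0‖⁻¹ := by positivity
      nlinarith
    have hdist : ∀ z, Metric.infDist z Ωᶜ ≤ |⟪z - y, n⟫| := by
      intro z
      have hm : z - ⟪z - y, n⟫ • n ∈ Ωᶜ := by
        intro h
        have := hpos _ h
        have h2 : ⟪z - ⟪z - y, n⟫ • n - y, n⟫ = 0 := by
          have : z - ⟪z - y, n⟫ • n - y = (z - y) - ⟪z - y, n⟫ • n := by abel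
          rw [this, inner_sub_left (z - y), real_inner_smul_left, real_inner_self_eq_norm_sq, hn1]; ring
        linarith
      refine (Metric.infDist_le_dist_of_mem hm).trans ?_
      rw [dist_eq_norm, sub_sub_cancel, norm_smul, hn1, mul_one, Real.norm_eq_abs]
    have heq : Metric.infDist x Ωᶜ = ⟪x - y, n⟫ := by
      apply le_antisymm
      · have := hdist x; rwa [abs_of_pos (hpos x hx)] at this
      · rw [hxy, dist_eq_norm]
        have := real_inner_le_norm (x - y) n
        rwa [hn1, mul_one] at this
    have hform : ∀ z, (1 + κ * ⟪y, n⟫) + (-κ) * ⟪z, n⟫ = 1 - κ * ⟪z - y, n⟫ := fun z => by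
      rw [inner_sub_left]; ring
    have hgc : HasGradientAt (fun z : EN N => Real.cos ((1 + κ * ⟪y, n⟫) + (-κ) * ⟪z, n⟫))
        ((-(Real.sin ((1 + κ * ⟪y, n⟫) + (-κ) * ⟪x, n⟫) * (-κ))) • n) x := by
      rw [hasGradientAt_iff_hasFDerivAt]
      have hf : HasFDerivAt (fun z : EN N => (1 + κ * ⟪y, n⟫) + (-κ) * ⟪z, n⟫) ((-κ) • innerSL ℝ n) x := by
        have := ((innerSL ℝ n).hasFDerivAt (x := x)).const_mul (-κ) |>.const_add (1 + κ * ⟪y, n⟫)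
        refine this.congr_of_eventuallyEq (Eventually.of_forall fun y => ?_)
        simp [real_inner_comm]
      refine (hf.cos).congr_fderiv ?_
      ext v
      simp; ring
    refine ⟨fun z => u z + δ * Real.cos ((1 + κ * ⟪y, n⟫) + (-κ) * ⟪z, n⟫), 
      gradient u x + δ • ((-(Real.sin ((1 + κ * ⟪y, n⟫) + (-κ) * ⟪x, n⟫) * (-κ))) • n), _, ?_, ?_, ?_, 
      hA.add ((Avg.cos (1 + κ * ⟪y, n⟫) (-κ) n x).const_mul δ), ?_⟩
    · have h2 : ∀ᶠ z in nhds x, κ * ⟪z - y, n⟫ < 1 := by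
        have : Continuous (fun z : EN N => κ * ⟪z - y, n⟫) := by fun_prop
        exact this.continuousAt.eventually_lt_const (by show κ * ⟪x - y, n⟫ < 1; rw [← heq]; exact h1)
      filter_upwards [h2, hΩ.mem_nhds hx] with z hz hzΩ
      have h3 := hpos z hzΩ
      have h4 := hdist z
      rw [abs_of_pos h3] at h4
      have h5 := mul_le_mul_of_nonneg_left h4 hκ.le
      have h6 : bet Ω κ z ≤ Real.cos ((1 + κ * ⟪y, n⟫) + (-κ) * ⟪z, n⟫) := by
        rw [hform]
        unfold bet
        have := bet_arg Ω κ hκ.le z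
        apply Real.cos_le_cos_of_nonneg_of_le_pi (by linarith) (by linarith [Real.pi_gt_three])
        exact le_trans (by linarith) (le_max_right _ _)
      have := mul_le_mul_of_nonneg_left h6 hδ.le
      linarith
    · simp only [hform, ← heq]
      unfold bet
      rw [max_eq_right (by linarith)]
    · rw [hasGradientAt_iff_hasFDerivAt] at hgu hgc ⊢
      refine (hgu.add (hgc.const_mul δ)).congr_fderiv ?_
      simp
    · have hcp : 0 < Real.cos ((1 + κ * ⟪y, n⟫) + (-κ) * ⟪x, n⟫) := by
        rw [hform, ← heq]
        have := mul_nonneg hκ.le (Metric.infDist_nonneg (x := x) (s := Ωᶜ))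
        apply Real.cos_pos_of_mem_Ioo
        constructor <;> linarith [Real.pi_gt_three]
      set c := Real.cos ((1 + κ * ⟪y, n⟫) + (-κ) * ⟪x, n⟫) with hcdef
      rw [hn1, neg_sq, hκ2]
      show _ ≤ bc N / 2 * (-lam + ε) * (u x + δ * c)
      have h3 : -lam * u x - δ * (lam + 1) * c ≤ (-lam + ε) * (u x + δ * c) := by
        have k1 := mul_pos hδ hcp
        have k2 := mul_pos hε k1
        have k3 := mul_pos hε hux
        linarith
      have h4 := mul_le_mul_of_nonneg_left h3 (by positivity : 0 ≤ bc N / 2)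
      linarith

end

section

variable {N : ℕ}

lemma cos_pos_small {a D t : ℝ} (ha : 0 < a) (haD : a * D < π) (ht : |t| ≤ D / 2) : 0 < cos (a * t) := by
  have := abs_le.1 ht
  apply Real.cos_pos_of_mem_Ioo
  constructor <;> nlinarith

lemma log_comb {a1 a2 a3 a4 a5 a6 : ℝ} (h1 : 0 < a1) (h2 : 0 < a2) (h3 : 0 < a3) (h4 : 0 < a4) (h5 : 0 < a5) (h6 : 0 < a6) :
    Real.log a1 + Real.log a2 + (-1) * Real.log a3 + (-1) * Real.log a4 + (-2) * Real.log a5 + 2 * Real.log a6 =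
      Real.log (a1 * a2 * a6 ^ 2 / (a3 * a4 * a5 ^ 2)) := by
  rw [Real.log_div (by positivity) (by positivity), Real.log_mul (by positivity) (by positivity),
    Real.log_mul (by positivity) (by positivity), Real.log_mul (by positivity) (by positivity),
    Real.log_mul (by positivity) (by positivity), Real.log_pow, Real.log_pow]
  push_cast; ring

set_option maxHeartbeats 1000000 in
theorem claimA0 (Ω : Set (EN N)) (hΩ : IsOpen Ω) (hb : IsBounded Ω) (hc : Convex ℝ Ω) (hne : (Ωᶜ).Nonempty) (u : EN N → ℝ)
    (lam ε δ c0 κ a b : ℝ)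
    (hl : 0 ≤ lam) (hε : 0 < ε) (hδ : 0 < δ) (hκ : 0 < κ) (hκ2 : κ ^ 2 = lam + 1)
    (huc : Continuous u) (hu0 : ∀ x ∉ Ω, u x = 0)
    (hu : ContDiffOn ℝ 1 u Ω) (hup : ∀ x ∈ Ω, 0 < u x)
    (hw : ∀ φ : EN N → ℝ, ContDiff ℝ 1 φ → tsupport φ ⊆ Ω →
      ∫ x in Ω, ⟪gradient u x, gradient φ x⟫ = lam * ∫ x in Ω, u x * φ x)
    (hc0 : ∀ x ∈ Ω, 1 ≤ κ * Metric.infDist x Ωᶜ → c0 ≤ u x) (hδ2 : lam * δ ≤ ε * c0)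
    (hb0 : 0 < b) (hba : b < a) (haD : a * Metric.diam Ω < π) (hab : ε < a ^ 2 - b ^ 2)
    (p q : EN N) (hp : p ∈ Ω) (hq : q ∈ Ω) (σ : ℝ) (hσ : |σ| ≤ 1) :
    u p * u q * cos (b * (σ * (‖p - q‖ / 2))) ^ 2 ≤ (1 + (a - b) * (Metric.diam Ω / 2) / cos (a * (Metric.diam Ω / 2))) ^ 2 *
      ((u ((1/2:ℝ) • (p + q) + (σ/2) • (p - q)) + δ) * (u ((1/2:ℝ) • (p + q) - (σ/2) • (p - q)) + δ) * cos (a * (‖p - q‖ / 2)) ^ 2) := by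
  set D := Metric.diam Ω with hD
  have hD0 : 0 ≤ D := Metric.diam_nonneg
  have ha0 : 0 < a := hb0.trans hba
  have hbD : b * D < π := lt_of_le_of_lt (mul_le_mul_of_nonneg_right hba.le hD0) haD
  have hcD : 0 < cos (a * (D / 2)) := cos_pos_small ha0 haD (by rw [abs_of_nonneg (by positivity)])
  set M := (1 + (a - b) * (D / 2) / cos (a * (D / 2))) ^ 2 with hM
  have hM0 : 0 ≤ (a - b) * (D / 2) / cos (a * (D / 2)) := by
    have : 0 < a - b := by linarith
    positivity
  have hM1 : 1 ≤ M := by rw [hM]; nlinarith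
  have hunn : ∀ x, 0 ≤ u x := fun x => by
    by_cases h : x ∈ Ω
    · exact (hup x h).le
    · rw [hu0 x h]
  set v : EN N → ℝ := fun z => u z + δ * bet Ω κ z with hv
  have hvc : Continuous v := by
    have := bet_cont Ω κ
    fun_prop
  have hvp : ∀ x, 0 < v x := fun x => by
    have := mul_pos hδ (bet_pos Ω κ hκ.le x)
    have := hunn x
    simp only [hv]; linarith
  have huv : ∀ x, u x ≤ v x := fun x => by
    have := mul_pos hδ (bet_pos Ω κ hκ.le x)
    simp only [hv]; linarith
  have hvu : ∀ x, v x ≤ u x + δ := fun x => by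
    have := mul_le_mul_of_nonneg_left (bet_le Ω κ x) hδ.le
    simp only [hv]; linarith
  set x3 : EN N × EN N × ℝ → EN N := fun w => (1/2:ℝ) • (w.1 + w.2.1) + (w.2.2/2) • (w.1 - w.2.1) with hx3
  set x4 : EN N × EN N × ℝ → EN N := fun w => (1/2:ℝ) • (w.1 + w.2.1) - (w.2.2/2) • (w.1 - w.2.1) with hx4
  have hx3c : Continuous x3 := by fun_prop
  have hx4c : Continuous x4 := by fun_prop
  set F : EN N × EN N × ℝ → ℝ := fun w => u w.1 * u w.2.1 * cos (b * (w.2.2 * (‖w.1 - w.2.1‖ / 2))) ^ 2 /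
    (v (x3 w) * v (x4 w) * cos (a * (‖w.1 - w.2.1‖ / 2)) ^ 2) with hF
  set K : Set (EN N × EN N × ℝ) := closure Ω ×ˢ (closure Ω ×ˢ Icc (-1 : ℝ) 1) with hK
  have hKc : IsCompact K := (hb.isCompact_closure).prod ((hb.isCompact_closure).prod isCompact_Icc)
  have hrK : ∀ w ∈ K, ‖w.1 - w.2.1‖ ≤ D := by
    rintro ⟨p, q, s⟩ ⟨h1, h2, h3⟩
    rw [← dist_eq_norm, hD, ← Metric.diam_closure]
    exact Metric.dist_le_diam_of_mem hb.closure h1 h2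
  have hcaK : ∀ w ∈ K, 0 < cos (a * (‖w.1 - w.2.1‖ / 2)) := fun w hw =>
    cos_pos_small ha0 haD (by rw [abs_of_nonneg (by positivity)]; linarith [hrK w hw])
  have hcbK : ∀ w ∈ K, 0 < cos (b * (w.2.2 * (‖w.1 - w.2.1‖ / 2))) := fun w hw => by
    refine cos_pos_small hb0 hbD ?_
    rw [abs_mul, abs_of_nonneg (by positivity : 0 ≤ ‖w.1 - w.2.1‖ / 2)]
    have h1 : |w.2.2| ≤ 1 := abs_le.2 hw.2.2
    have := mul_le_mul_of_nonneg_right h1 (by positivity : 0 ≤ ‖w.1 - w.2.1‖ / 2)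
    linarith [hrK w hw]
  have hdenK : ∀ w ∈ K, 0 < v (x3 w) * v (x4 w) * cos (a * (‖w.1 - w.2.1‖ / 2)) ^ 2 := fun w hw =>
    mul_pos (mul_pos (hvp _) (hvp _)) (pow_pos (hcaK w hw) 2)
  have hFc : ContinuousOn F K := by
    apply ContinuousOn.div
    · exact Continuous.continuousOn (by fun_prop)
    · exact Continuous.continuousOn (by fun_prop)
    · exact fun w hw => (hdenK w hw).ne'
  have hmem : (p, q, σ) ∈ K := ⟨subset_closure hp, subset_closure hq, abs_le.1 hσ⟩
  obtain ⟨w0, hw0, hmax⟩ := hKc.exists_isMaxOn ⟨_, hmem⟩ hFc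
  have main : F w0 ≤ M := by
    by_contra hcon
    push Not at hcon
    obtain ⟨P, Q, s⟩ := w0
    have hP : P ∈ Ω := by
      by_contra h
      have : F (P, Q, s) = 0 := by simp only [hF, hu0 P h, zero_mul, zero_div]
      linarith
    have hQ : Q ∈ Ω := by
      by_contra h
      have : F (P, Q, s) = 0 := by simp only [hF, hu0 Q h, mul_zero, zero_mul, zero_div]
      linarith
    have hs : |s| ≤ 1 := abs_le.2 hw0.2.2
    have huP := hup P hP
    have huQ := hup Q hQ
    have hne : P ≠ Q := by
      rintro rfl
      have e3 : x3 (P, P, s) = P := by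
        simp only [hx3, sub_self, smul_zero, add_zero]; rw [← two_smul ℝ P, smul_smul]; norm_num
      have e4 : x4 (P, P, s) = P := by
        simp only [hx4, sub_self, smul_zero, sub_zero]; rw [← two_smul ℝ P, smul_smul]; norm_num
      have : F (P, P, s) ≤ 1 := by
        simp only [hF, e3, e4, sub_self, norm_zero, zero_div, mul_zero, cos_zero, one_pow, mul_one]
        rw [div_le_one (mul_pos (hvp _) (hvp _))]
        exact mul_le_mul (huv P) (huv P) huP.le (hvp _).le
      linarith
    have hrpos : 0 < ‖P - Q‖ / 2 := by
      have := norm_pos_iff.2 (sub_ne_zero.2 hne); positivity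
    have hr2 : ‖P - Q‖ / 2 ≤ D / 2 := by have := hrK _ hw0; simp only at this; linarith
    set r := ‖P - Q‖ / 2 with hr
    have hca := hcaK _ hw0
    have hcb := hcbK _ hw0
    simp only [← hr] at hca hcb
    have hs1 : |s| < 1 := by
      rcases lt_or_eq_of_le hs with h | h
      · exact h
      · exfalso
        have hcs : cos (b * (s * r)) = cos (b * r) := by
          rcases (abs_eq zero_le_one).1 h with h | h
          · rw [h, one_mul]
          · rw [h, neg_one_mul, mul_neg, Real.cos_neg]
        have hprod : v (x3 (P, Q, s)) * v (x4 (P, Q, s)) = v P * v Q := by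
          rcases (abs_eq zero_le_one).1 h with h | h
          · have e3 : x3 (P, Q, s) = P := by
              simp only [hx3, h]; rw [← smul_add]
              have : P + Q + (P - Q) = (2:ℝ) • P := by rw [two_smul]; abel
              rw [this, smul_smul]; norm_num
            have e4 : x4 (P, Q, s) = Q := by
              simp only [hx4, h]; rw [← smul_sub]
              have : P + Q - (P - Q) = (2:ℝ) • Q := by rw [two_smul]; abel
              rw [this, smul_smul]; norm_num
            rw [e3, e4]
          · have e3 : x3 (P, Q, s) = Q := by
              simp only [hx3, h]; rw [neg_div, neg_smul, ← sub_eq_add_neg, ← smul_sub]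
              have : P + Q - (P - Q) = (2:ℝ) • Q := by rw [two_smul]; abel
              rw [this, smul_smul]; norm_num
            have e4 : x4 (P, Q, s) = P := by
              simp only [hx4, h]; rw [neg_div, neg_smul, sub_neg_eq_add, ← smul_add]
              have : P + Q + (P - Q) = (2:ℝ) • P := by rw [two_smul]; abel
              rw [this, smul_smul]; norm_num
            rw [e3, e4, mul_comm]
        have hcosle : cos (b * r) ≤ (1 + (a - b) * (D / 2) / cos (a * (D / 2))) * cos (a * r) := by
          have h1 : cos (b * r) - cos (a * r) ≤ (a - b) * r := by
            have := Real.abs_cos_sub_cos_le (b * r) (a * r)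
            have h2 : |b * r - a * r| = (a - b) * r := by
              rw [← sub_mul, abs_mul, abs_of_pos hrpos, abs_of_neg (by linarith)]; ring
            rw [h2] at this
            exact (le_abs_self _).trans this
          have h3 : cos (a * (D / 2)) ≤ cos (a * r) := by
            apply Real.cos_le_cos_of_nonneg_of_le_pi (by positivity) (by nlinarith [Real.pi_pos])
            exact mul_le_mul_of_nonneg_left hr2 ha0.le
          have h4 : (a - b) * r ≤ (a - b) * (D / 2) := mul_le_mul_of_nonneg_left hr2 (by linarith)
          have h5 : (a - b) * (D / 2) ≤ (a - b) * (D / 2) / cos (a * (D / 2)) * cos (a * r) := by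
            calc (a - b) * (D / 2) = (a - b) * (D / 2) / cos (a * (D / 2)) * cos (a * (D / 2)) := (div_mul_cancel₀ _ hcD.ne').symm
              _ ≤ _ := mul_le_mul_of_nonneg_left h3 hM0
          linarith
        have hcb' : 0 < cos (b * r) := by rw [← hcs]; exact hcb
        have : F (P, Q, s) ≤ M := by
          simp only [hF, ← hr]
          rw [hprod, hcs, div_le_iff₀ (mul_pos (mul_pos (hvp _) (hvp _)) (pow_pos hca 2))]
          have h6 : cos (b * r) ^ 2 ≤ M * cos (a * r) ^ 2 := by
            rw [hM, ← mul_pow]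
            exact pow_le_pow_left₀ hcb'.le hcosle 2
          have h7 : u P * u Q ≤ v P * v Q := mul_le_mul (huv _) (huv _) huQ.le (hvp _).le
          calc u P * u Q * cos (b * r) ^ 2 ≤ (v P * v Q) * (M * cos (a * r) ^ 2) :=
                mul_le_mul h7 h6 (by positivity) (mul_pos (hvp _) (hvp _)).le
            _ = _ := by ring
        linarith
    have hconv3 : x3 (P, Q, s) ∈ Ω := by
      have h := hc hP hQ (a := (1+s)/2) (b := (1-s)/2) (by linarith [(abs_le.1 hs).1]) (by linarith [(abs_le.1 hs).2]) (by ring)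
      convert h using 1
      simp only [hx3]; module
    have hconv4 : x4 (P, Q, s) ∈ Ω := by
      have h := hc hP hQ (a := (1-s)/2) (b := (1+s)/2) (by linarith [(abs_le.1 hs).2]) (by linarith [(abs_le.1 hs).1]) (by ring)
      convert h using 1
      simp only [hx4]; module
    obtain ⟨V3, G3, L3, t31, t32, t33, t34, t35⟩ := touching Ω hΩ hc ‹_› u lam ε δ c0 κ hl hε hδ hκ hκ2 hu hup hw hc0 hδ2 _ hconv3
    obtain ⟨V4, G4, L4, t41, t42, t43, t44, t45⟩ := touching Ω hΩ hc ‹_› u lam ε δ c0 κ hl hε hδ hκ hκ2 hu hup hw hc0 hδ2 _ hconv4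
    have hdu : ∀ x ∈ Ω, HasGradientAt u (gradient u x) x := fun x hx =>
      ((hu.differentiableOn one_ne_zero).differentiableAt (hΩ.mem_nhds hx)).hasGradientAt
    have hpq : P - Q = (2 * r) • ((‖P - Q‖)⁻¹ • (P - Q)) := by
      rw [smul_smul, hr]
      have : (2 * (‖P - Q‖ / 2) * ‖P - Q‖⁻¹) = 1 := by
        have := norm_pos_iff.2 (sub_ne_zero.2 hne)
        field_simp
      rw [this, one_smul]
    refine max_contra P Q (‖P - Q‖⁻¹ • (P - Q)) r s a b ε lam u V3 V4 (gradient u P) (gradient u Q) G3 G4 L3 L4 hrpos hs1 ?_ hpq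
      hca hcb hab (Avg.eigen Ω hΩ u lam hu hw P hP) (Avg.eigen Ω hΩ u lam hu hw Q hQ) t34 t44 t35 t45 huP huQ ?_ ?_
      (hdu P hP) (hdu Q hQ) t33 t43 _ (fun w => rfl) ?_
    · rw [norm_smul, norm_inv, norm_norm, inv_mul_cancel₀ (norm_pos_iff.2 (sub_ne_zero.2 hne)).ne']
    · exact lt_of_lt_of_eq (hvp (x3 (P, Q, s))) t32.symm
    · exact lt_of_lt_of_eq (hvp (x4 (P, Q, s))) t42.symm
    · have c1 : ∀ᶠ w : EN N × EN N × ℝ in nhds (P, Q, s), w.1 ∈ Ω :=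
        (continuous_fst.continuousAt (x := (P, Q, s))).eventually (hΩ.mem_nhds hP)
      have c2 : ∀ᶠ w : EN N × EN N × ℝ in nhds (P, Q, s), w.2.1 ∈ Ω :=
        ((continuous_fst.comp continuous_snd).continuousAt (x := (P, Q, s))).eventually (hΩ.mem_nhds hQ)
      have c3 : ∀ᶠ w : EN N × EN N × ℝ in nhds (P, Q, s), w.2.2 ∈ Ioo (-1:ℝ) 1 :=
        ((continuous_snd.comp continuous_snd).continuousAt (x := (P, Q, s))).eventually (isOpen_Ioo.mem_nhds (abs_lt.1 hs1))
      have c4 := (hx3c.continuousAt (x := (P, Q, s))).eventually t31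
      have c5 := (hx4c.continuousAt (x := (P, Q, s))).eventually t41
      filter_upwards [c1, c2, c3, c4, c5] with w h1 h2 h3 h4 h5
      have hwK : w ∈ K := ⟨subset_closure h1, subset_closure h2, Ioo_subset_Icc_self h3⟩
      have v3 : 0 < V3 (x3 w) := (hvp _).trans_le h4
      have v4 : 0 < V4 (x4 w) := (hvp _).trans_le h5
      have k3 : 0 < V3 (x3 (P, Q, s)) := by rw [t32]; exact hvp _
      have k4 : 0 < V4 (x4 (P, Q, s)) := by rw [t42]; exact hvp _
      have e1 := log_comb (hup _ h1) (hup _ h2) v3 v4 (hcaK w hwK) (hcbK w hwK)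
      have e2 := log_comb huP huQ k3 k4 hca hcb
      have hFle : F w ≤ F (P, Q, s) := hmax hwK
      refine (le_of_eq e1).trans (le_trans ?_ (le_of_eq e2.symm))
      have n1 : 0 < u w.1 * u w.2.1 * cos (b * (w.2.2 * (‖w.1 - w.2.1‖ / 2))) ^ 2 :=
        mul_pos (mul_pos (hup _ h1) (hup _ h2)) (pow_pos (hcbK w hwK) 2)
      apply Real.log_le_log
      · exact div_pos n1 (mul_pos (mul_pos v3 v4) (pow_pos (hcaK w hwK) 2))
      · refine le_trans ?_ (hFle.trans (le_of_eq ?_))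
        · simp only [hF]
          apply div_le_div_of_nonneg_left n1.le (hdenK w hwK)
          apply mul_le_mul_of_nonneg_right _ (by positivity)
          exact mul_le_mul h4 h5 (hvp _).le v3.le
        · rw [t32, t42]
  have h8 : F (p, q, σ) ≤ M := (hmax hmem).trans main
  simp only [hF] at h8
  rw [div_le_iff₀ (hdenK _ hmem)] at h8
  refine h8.trans (mul_le_mul_of_nonneg_left ?_ (by linarith))
  apply mul_le_mul_of_nonneg_right _ (by positivity)
  exact mul_le_mul (hvu _) (hvu _) (hvp _).le (by have := hunn (x3 (p, q, σ)); simp only [hx3] at this; linarith)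


theorem claimA (Ω : Set (EN N)) (hΩ : IsOpen Ω) (hb : IsBounded Ω) (hc : Convex ℝ Ω) (hD : 0 < Metric.diam Ω)
    (u : EN N → ℝ) (hu : IsFirstDirichletEF Ω u) (p q : EN N) (hp : p ∈ Ω) (hq : q ∈ Ω) (σ : ℝ) (hσ : |σ| ≤ 1) :
    u p * u q * cos (π / Metric.diam Ω * (σ * (‖p - q‖ / 2))) ^ 2 ≤
      u ((1/2:ℝ) • (p + q) + (σ/2) • (p - q)) * u ((1/2:ℝ) • (p + q) - (σ/2) • (p - q)) *
        cos (π / Metric.diam Ω * (‖p - q‖ / 2)) ^ 2 := by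
  obtain ⟨lam, hl, hw⟩ := weak_eq Ω hΩ hb u hu
  obtain ⟨huc, hu0, hu1, -, hup, -, -⟩ := hu
  have hne : (Ωᶜ).Nonempty := by
    by_contra h
    rw [not_nonempty_iff_eq_empty, compl_empty_iff] at h
    rw [h] at hb
    have : Nontrivial (EN N) := by
      by_contra h2
      rw [not_nontrivial_iff_subsingleton] at h2
      have := Metric.diam_subsingleton (subsingleton_of_subsingleton (s := Ω))
      linarith
    exact NormedSpace.unbounded_univ ℝ (EN N) hb
  set κ := Real.sqrt (lam + 1) with hκ
  have hκ0 : 0 < κ := Real.sqrt_pos.2 (by linarith)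
  have hκ2 : κ ^ 2 = lam + 1 := Real.sq_sqrt (by linarith)
  obtain ⟨c0, hc0p, hc0⟩ : ∃ c0 > 0, ∀ x ∈ Ω, 1 ≤ κ * Metric.infDist x Ωᶜ → c0 ≤ u x := by
    set S := closure Ω ∩ {x | 1 ≤ κ * Metric.infDist x Ωᶜ} with hS
    have hSc : IsCompact S := by
      apply hb.isCompact_closure.inter_right
      have := Metric.continuous_infDist_pt (Ωᶜ : Set (EN N))
      exact isClosed_le continuous_const (by fun_prop)
    have hSΩ : S ⊆ Ω := by
      rintro x ⟨-, hx⟩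
      by_contra h
      have : Metric.infDist x Ωᶜ = 0 := Metric.infDist_zero_of_mem h
      simp only [mem_setOf_eq, this] at hx
      linarith
    rcases S.eq_empty_or_nonempty with h | h
    · exact ⟨1, one_pos, fun x hx h1 => absurd (show x ∈ S from ⟨subset_closure hx, h1⟩) (by rw [h]; exact notMem_empty _)⟩
    · obtain ⟨x0, hx0, hmin⟩ := hSc.exists_isMinOn h huc.continuousOn
      exact ⟨u x0, hup _ (hSΩ hx0), fun x hx h1 => hmin (show x ∈ S from ⟨subset_closure hx, h1⟩)⟩
  set D := Metric.diam Ω with hDd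
  set A := u ((1/2:ℝ) • (p + q) + (σ/2) • (p - q)) with hA
  set B := u ((1/2:ℝ) • (p + q) - (σ/2) • (p - q)) with hB
  set r := ‖p - q‖ / 2 with hr
  have S1 : ∀ a b, 0 < b → b < a → a * D < π → u p * u q * cos (b * (σ * r)) ^ 2 ≤
      (1 + (a - b) * (D / 2) / cos (a * (D / 2))) ^ 2 * (A * B * cos (a * r) ^ 2) := by
    intro a b hb0 hba haD
    set ε := (a ^ 2 - b ^ 2) / 2 with hε
    have hεp : 0 < a ^ 2 - b ^ 2 := by nlinarith
    have hlim : Tendsto (fun δ : ℝ => (1 + (a - b) * (D / 2) / cos (a * (D / 2))) ^ 2 * ((A + δ) * (B + δ) * cos (a * r) ^ 2))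
        (nhdsWithin 0 (Ioi 0)) (nhds ((1 + (a - b) * (D / 2) / cos (a * (D / 2))) ^ 2 * (A * B * cos (a * r) ^ 2))) := by
      have h1 : Continuous (fun δ : ℝ => (1 + (a - b) * (D / 2) / cos (a * (D / 2))) ^ 2 * ((A + δ) * (B + δ) * cos (a * r) ^ 2)) := by fun_prop
      have := (h1.tendsto 0).mono_left (nhdsWithin_le_nhds (s := Ioi 0))
      simpa using this
    refine ge_of_tendsto hlim ?_
    have h2 : ∀ᶠ δ : ℝ in nhdsWithin 0 (Ioi 0), lam * δ < ε * c0 := by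
      have h1 : Continuous (fun δ : ℝ => lam * δ) := by fun_prop
      exact ((h1.continuousAt (x := 0)).eventually_lt_const (by simp; positivity)).filter_mono nhdsWithin_le_nhds
    filter_upwards [h2, self_mem_nhdsWithin] with δ hδ hδ0
    exact claimA0 Ω hΩ hb hc hne u lam ε δ c0 κ a b hl (by positivity) hδ0 hκ0 hκ2 huc hu0 hu1 hup hw hc0 hδ.le hb0 hba haD
      (by rw [hε]; linarith) p q hp hq σ hσ
  have S2 : ∀ a, 0 < a → a * D < π → u p * u q * cos (a * (σ * r)) ^ 2 ≤ A * B * cos (a * r) ^ 2 := by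
    intro a ha haD
    have l1 : Continuous (fun b : ℝ => u p * u q * cos (b * (σ * r)) ^ 2) := by fun_prop
    have l2 : Continuous (fun b : ℝ => (1 + (a - b) * (D / 2) / cos (a * (D / 2))) ^ 2 * (A * B * cos (a * r) ^ 2)) := by fun_prop
    have k1 := (l1.tendsto a).mono_left (nhdsWithin_le_nhds (s := Iio a))
    have k2 := (l2.tendsto a).mono_left (nhdsWithin_le_nhds (s := Iio a))
    have := le_of_tendsto_of_tendsto k1 k2 (by
      filter_upwards [Ioo_mem_nhdsLT ha] with b hb
      exact S1 a b hb.1 hb.2 haD)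
    simpa using this
  have l1 : Continuous (fun b : ℝ => u p * u q * cos (b * (σ * r)) ^ 2) := by fun_prop
  have l2 : Continuous (fun b : ℝ => A * B * cos (b * r) ^ 2) := by fun_prop
  have k1 := (l1.tendsto (π / D)).mono_left (nhdsWithin_le_nhds (s := Iio (π / D)))
  have k2 := (l2.tendsto (π / D)).mono_left (nhdsWithin_le_nhds (s := Iio (π / D)))
  refine le_of_tendsto_of_tendsto k1 k2 ?_
  filter_upwards [Ioo_mem_nhdsLT (show 0 < π / D by positivity)] with b hb
  exact S2 b hb.1 ((lt_div_iff₀ hD).1 hb.2)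

end

lemma bm1_aff (S : Set ℝ) (c τ : ℝ) (hτ : 0 < τ) :
    volume ((fun z : ℝ => (z - c) * τ⁻¹) ⁻¹' S) = ENNReal.ofReal τ * volume S := by
  have h1 : (fun z : ℝ => (z - c) * τ⁻¹) ⁻¹' S = (fun z => z - c) ⁻¹' ((fun z => z * τ⁻¹) ⁻¹' S) := rfl
  simp only [sub_eq_add_neg] at h1 ⊢
  rw [h1, measure_preimage_add_right, Real.volume_preimage_mul_right (inv_ne_zero hτ.ne'), inv_inv, abs_of_pos hτ]

lemma bm1 (A B C : Set ℝ) (hA : MeasurableSet A) (hB : MeasurableSet B) (hA0 : A.Nonempty) (hB0 : B.Nonempty)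
    (hAb : BddAbove A) (hBb : BddBelow B) (l : ℝ) (hl0 : 0 < l) (hl1 : l < 1)
    (hC : ∀ a ∈ A, ∀ b ∈ B, (1 - l) * a + l * b ∈ C) :
    ENNReal.ofReal (1 - l) * volume A + ENNReal.ofReal l * volume B ≤ volume C := by
  have hl : 0 < 1 - l := by linarith
  refine ENNReal.le_of_forall_pos_le_add fun ε hε _ => ?_
  obtain ⟨a0, ha0, ha0'⟩ := exists_lt_of_lt_csSup hA0 (sub_lt_self (sSup A) (NNReal.coe_pos.2 hε))
  obtain ⟨b0, hb0, hb0'⟩ := exists_lt_of_csInf_lt hB0 (lt_add_of_pos_right (sInf B) (NNReal.coe_pos.2 hε))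
  set A' := A ∩ Iio a0 with hA'
  set B' := B ∩ Ici b0 with hB'
  have hAv : volume A ≤ volume A' + ε := by
    have : A ⊆ A' ∪ Icc (sSup A - ε) (sSup A) := by
      intro x hx
      by_cases h : x < a0
      · exact Or.inl ⟨hx, h⟩
      · exact Or.inr ⟨by linarith, le_csSup hAb hx⟩
    refine (measure_mono this).trans ((measure_union_le _ _).trans ?_)
    gcongr
    rw [Real.volume_Icc]; simp
  have hBv : volume B ≤ volume B' + ε := by
    have : B ⊆ B' ∪ Icc (sInf B) (sInf B + ε) := by
      intro x hx
      by_cases h : b0 ≤ x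
      · exact Or.inl ⟨hx, h⟩
      · exact Or.inr ⟨csInf_le hBb hx, by linarith⟩
    refine (measure_mono this).trans ((measure_union_le _ _).trans ?_)
    gcongr
    rw [Real.volume_Icc]; simp
  set S1 := (fun z : ℝ => (z - l * b0) * (1 - l)⁻¹) ⁻¹' A' with hS1
  set S2 := (fun z : ℝ => (z - (1 - l) * a0) * l⁻¹) ⁻¹' B' with hS2
  have hm : MeasurableSet S2 := by
    have : Measurable (fun z : ℝ => (z - (1 - l) * a0) * l⁻¹) := by fun_prop
    exact this (hB.inter measurableSet_Ici)
  have hd : Disjoint S1 S2 := by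
    rw [Set.disjoint_left]
    rintro z ⟨_, h1⟩ ⟨_, h2⟩
    simp only [mem_Iio, mem_Ici] at h1 h2
    rw [← div_eq_mul_inv, div_lt_iff₀ hl] at h1
    rw [← div_eq_mul_inv, le_div_iff₀ hl0] at h2
    linarith
  have hsub : S1 ∪ S2 ⊆ C := by
    rintro z (⟨h1, _⟩ | ⟨h1, _⟩)
    · have := hC _ h1 _ hb0
      convert this using 1; field_simp; ring
    · have := hC _ ha0 _ h1
      convert this using 1; field_simp; ring
  have hvol : ENNReal.ofReal (1 - l) * volume A' + ENNReal.ofReal l * volume B' ≤ volume C := by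
    rw [← bm1_aff A' (l * b0) (1 - l) hl, ← bm1_aff B' ((1 - l) * a0) l hl0, ← measure_union hd hm]
    exact measure_mono hsub
  calc ENNReal.ofReal (1 - l) * volume A + ENNReal.ofReal l * volume B
      ≤ ENNReal.ofReal (1 - l) * (volume A' + ε) + ENNReal.ofReal l * (volume B' + ε) := by gcongr
    _ = (ENNReal.ofReal (1 - l) * volume A' + ENNReal.ofReal l * volume B') + (ENNReal.ofReal (1 - l) + ENNReal.ofReal l) * ε := by ring
    _ ≤ volume C + ε := by
      gcongr
      rw [← ENNReal.ofReal_add hl.le hl0.le]; simp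

lemma PL1n (f g h : ℝ → ℝ) (hf : Measurable f) (hg : Measurable g) (hh : Measurable h)
    (hf0 : ∀ x, 0 ≤ f x) (hg0 : ∀ x, 0 ≤ g x) (hh0 : ∀ x, 0 ≤ h x) (hf1 : ∀ x, f x ≤ 1) (hg1 : ∀ x, g x ≤ 1)
    (R : ℝ) (hfR : ∀ x, R < |x| → f x = 0) (hgR : ∀ x, R < |x| → g x = 0)
    (hfs : ∀ s, 0 ≤ s → s < 1 → ∃ x, s < f x) (hgs : ∀ s, 0 ≤ s → s < 1 → ∃ x, s < g x) (l : ℝ) (hl0 : 0 < l) (hl1 : l < 1)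
    (H : ∀ x y s, 0 ≤ s → s < f x → s < g y → s < h ((1 - l) * x + l * y)) :
    ENNReal.ofReal (1 - l) * (∫⁻ x, ENNReal.ofReal (f x)) + ENNReal.ofReal l * (∫⁻ x, ENNReal.ofReal (g x)) ≤
      ∫⁻ x, ENNReal.ofReal (h x) := by
  rw [lintegral_eq_lintegral_meas_lt _ (Eventually.of_forall hf0) hf.aemeasurable,
    lintegral_eq_lintegral_meas_lt _ (Eventually.of_forall hg0) hg.aemeasurable,
    lintegral_eq_lintegral_meas_lt _ (Eventually.of_forall hh0) hh.aemeasurable]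
  have mf : Measurable (fun t => volume {a | t < f a}) :=
    Antitone.measurable fun s t hst => measure_mono fun x hx => lt_of_le_of_lt hst hx
  have mg : Measurable (fun t => volume {a | t < g a}) :=
    Antitone.measurable fun s t hst => measure_mono fun x hx => lt_of_le_of_lt hst hx
  rw [← lintegral_const_mul _ mf, ← lintegral_const_mul _ mg, ← lintegral_add_left (mf.const_mul _)]
  refine setLIntegral_mono' measurableSet_Ioi fun t ht => ?_
  have ht0 : 0 < t := ht
  have bdd : ∀ (k : ℝ → ℝ), (∀ x, R < |x| → k x = 0) → {a | t < k a} ⊆ Icc (-R) R := by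
    intro k hk x hx
    refine abs_le.1 ?_
    by_contra hc
    have := hk x (not_le.1 hc)
    simp only [mem_setOf_eq, this] at hx
    linarith
  by_cases h1 : t < 1
  · refine bm1 _ _ _ (measurableSet_lt measurable_const hf) (measurableSet_lt measurable_const hg) (hfs t ht0.le h1) (hgs t ht0.le h1)
      (bddAbove_Icc.mono (bdd f hfR)) (bddBelow_Icc.mono (bdd g hgR)) l hl0 hl1 ?_
    intro a ha b hb
    exact H a b t ht0.le ha hb
  · have e1 : {a | t < f a} = ∅ := by
      ext x; simp only [mem_setOf_eq, mem_empty_iff_false, iff_false, not_lt]; linarith [hf1 x]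
    have e2 : {a | t < g a} = ∅ := by
      ext x; simp only [mem_setOf_eq, mem_empty_iff_false, iff_false, not_lt]; linarith [hg1 x]
    simp [e1, e2]

lemma sup_attain (f : ℝ → ℝ≥0∞) (hα0 : (⨆ x, f x) ≠ 0) (hαM : (⨆ x, f x) ≠ ∞) (s : ℝ) (hs0 : 0 ≤ s) (hs : s < 1) :
    ∃ x, s < (f x / ⨆ x, f x).toReal := by
  have : ENNReal.ofReal s * (⨆ x, f x) < ⨆ x, f x := by
    calc ENNReal.ofReal s * (⨆ x, f x) < 1 * (⨆ x, f x) := by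
          rw [ENNReal.mul_lt_mul_iff_left hα0 hαM]; simpa using hs
      _ = (⨆ x, f x) := one_mul _
  obtain ⟨x, hx⟩ := lt_iSup_iff.1 this
  refine ⟨x, ?_⟩
  have ht : f x / (⨆ x, f x) ≠ ∞ := ENNReal.div_ne_top (ne_top_of_le_ne_top hαM (le_iSup f x)) hα0
  rw [← ENNReal.ofReal_lt_iff_lt_toReal hs0 ht, ENNReal.lt_div_iff_mul_lt (Or.inl hα0) (Or.inl hαM)]
  exact hx

lemma ennreal_amgm (x y : ℝ≥0∞) (l : ℝ) (hl0 : 0 < l) (hl1 : l < 1) :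
    x ^ (1 - l) * y ^ l ≤ ENNReal.ofReal (1 - l) * x + ENNReal.ofReal l * y := by
  have hl : 0 < 1 - l := by linarith
  by_cases hx : x = ∞
  · rw [hx, ENNReal.mul_top (by simpa using hl1)]; simp
  by_cases hy : y = ∞
  · rw [hy, ENNReal.mul_top (by simpa using hl0)]; simp
  lift x to NNReal using hx
  lift y to NNReal using hy
  have := NNReal.geom_mean_le_arith_mean2_weighted ⟨1 - l, hl.le⟩ ⟨l, hl0.le⟩ x y (by apply NNReal.coe_injective; show 1 - l + l = 1; ring)
  rw [← ENNReal.coe_rpow_of_nonneg _ hl.le, ← ENNReal.coe_rpow_of_nonneg _ hl0.le, ENNReal.ofReal_eq_coe_nnreal hl.le, ENNReal.ofReal_eq_coe_nnreal hl0.le]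
  exact_mod_cast this

/-- one dimensional Prekopa-Leindler -/
theorem PL1 (f g h : ℝ → ℝ≥0∞) (hf : Measurable f) (hg : Measurable g) (hh : Measurable h) (M : ℝ≥0∞) (hM : M ≠ ∞)
    (hfM : ∀ x, f x ≤ M) (hgM : ∀ x, g x ≤ M) (hhM : ∀ x, h x ≤ M) (R : ℝ)
    (hfR : ∀ x, R < |x| → f x = 0) (hgR : ∀ x, R < |x| → g x = 0) (l : ℝ) (hl0 : 0 < l) (hl1 : l < 1)
    (H : ∀ x y, f x ^ (1 - l) * g y ^ l ≤ h ((1 - l) * x + l * y)) :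
    (∫⁻ x, f x) ^ (1 - l) * (∫⁻ x, g x) ^ l ≤ ∫⁻ x, h x := by
  have hl : 0 < 1 - l := by linarith
  set α := ⨆ x, f x with hα
  set β := ⨆ x, g x with hβ
  have hαM : α ≠ ∞ := ne_top_of_le_ne_top hM (iSup_le hfM)
  have hβM : β ≠ ∞ := ne_top_of_le_ne_top hM (iSup_le hgM)
  by_cases hα0 : α = 0
  · have : ∀ x, f x = 0 := fun x => le_antisymm (hα0 ▸ le_iSup f x) bot_le
    simp [this, hl]
  by_cases hβ0 : β = 0
  · have : ∀ x, g x = 0 := fun x => le_antisymm (hβ0 ▸ le_iSup g x) bot_le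
    simp [this, hl0]
  set θ := α ^ (1 - l) * β ^ l with hθ
  have hθ0 : θ ≠ 0 := mul_ne_zero (by simp [ENNReal.rpow_eq_zero_iff, hα0, hαM]) (by simp [ENNReal.rpow_eq_zero_iff, hβ0, hβM])
  have hθM : θ ≠ ∞ := ENNReal.mul_ne_top (ENNReal.rpow_ne_top_of_nonneg hl.le hαM) (ENNReal.rpow_ne_top_of_nonneg hl0.le hβM)
  have e1 : ∀ x, f x / α ≤ 1 := fun x => ENNReal.div_le_of_le_mul (by rw [one_mul]; exact le_iSup f x)
  have e2 : ∀ x, g x / β ≤ 1 := fun x => ENNReal.div_le_of_le_mul (by rw [one_mul]; exact le_iSup g x)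
  have t1 : ∀ x, f x / α ≠ ∞ := fun x => ne_top_of_le_ne_top ENNReal.one_ne_top (e1 x)
  have t2 : ∀ x, g x / β ≠ ∞ := fun x => ne_top_of_le_ne_top ENNReal.one_ne_top (e2 x)
  have t3 : ∀ x, h x / θ ≠ ∞ := fun x => ENNReal.div_ne_top (ne_top_of_le_ne_top hM (hhM x)) hθ0
  have key := PL1n (fun x => (f x / α).toReal) (fun x => (g x / β).toReal) (fun x => (h x / θ).toReal)
    (by fun_prop) (by fun_prop) (by fun_prop) (fun _ => ENNReal.toReal_nonneg) (fun _ => ENNReal.toReal_nonneg)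
    (fun _ => ENNReal.toReal_nonneg) (fun x => ENNReal.toReal_le_of_le_ofReal zero_le_one (by simpa using e1 x))
    (fun x => ENNReal.toReal_le_of_le_ofReal zero_le_one (by simpa using e2 x)) R (fun x hx => by simp [hfR x hx])
    (fun x hx => by simp [hgR x hx])
    (fun s hs0 hs => sup_attain f hα0 hαM s hs0 hs) (fun s hs0 hs => sup_attain g hβ0 hβM s hs0 hs) l hl0 hl1
    (fun x y s hs h1 h2 => by
      rw [← ENNReal.ofReal_lt_iff_lt_toReal hs (t1 x), ENNReal.lt_div_iff_mul_lt (Or.inl hα0) (Or.inl hαM)] at h1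
      rw [← ENNReal.ofReal_lt_iff_lt_toReal hs (t2 y), ENNReal.lt_div_iff_mul_lt (Or.inl hβ0) (Or.inl hβM)] at h2
      rw [← ENNReal.ofReal_lt_iff_lt_toReal hs (t3 _), ENNReal.lt_div_iff_mul_lt (Or.inl hθ0) (Or.inl hθM)]
      refine lt_of_lt_of_le ?_ (H x y)
      have k : ENNReal.ofReal s * θ = (ENNReal.ofReal s * α) ^ (1 - l) * (ENNReal.ofReal s * β) ^ l := by
        rw [ENNReal.mul_rpow_of_nonneg _ _ hl.le, ENNReal.mul_rpow_of_nonneg _ _ hl0.le, hθ]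
        have : ENNReal.ofReal s = ENNReal.ofReal s ^ (1 - l) * ENNReal.ofReal s ^ l := by
          rw [← ENNReal.rpow_add_of_nonneg _ _ hl.le hl0.le]; simp
        nth_rewrite 1 [this]; ring
      rw [k]
      exact ENNReal.mul_lt_mul (ENNReal.rpow_lt_rpow h1 hl) (ENNReal.rpow_lt_rpow h2 hl0))
  simp only [ENNReal.ofReal_toReal (t1 _), ENNReal.ofReal_toReal (t2 _), ENNReal.ofReal_toReal (t3 _)] at key
  simp only [div_eq_mul_inv] at key
  rw [lintegral_mul_const _ hf, lintegral_mul_const _ hg, lintegral_mul_const _ hh] at key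
  have am := (ennreal_amgm ((∫⁻ x, f x) * α⁻¹) ((∫⁻ x, g x) * β⁻¹) l hl0 hl1).trans key
  rw [← div_eq_mul_inv _ θ, ENNReal.le_div_iff_mul_le (Or.inl hθ0) (Or.inl hθM)] at am
  refine le_trans (le_of_eq ?_) am
  rw [ENNReal.mul_rpow_of_nonneg _ _ hl.le, ENNReal.mul_rpow_of_nonneg _ _ hl0.le, hθ, ENNReal.inv_rpow, ENNReal.inv_rpow]
  have c1 : (α ^ (1 - l))⁻¹ * α ^ (1 - l) = 1 :=
    ENNReal.inv_mul_cancel (by simp [ENNReal.rpow_eq_zero_iff, hα0, hαM]) (ENNReal.rpow_ne_top_of_nonneg hl.le hαM)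
  have c2 : (β ^ l)⁻¹ * β ^ l = 1 :=
    ENNReal.inv_mul_cancel (by simp [ENNReal.rpow_eq_zero_iff, hβ0, hβM]) (ENNReal.rpow_ne_top_of_nonneg hl0.le hβM)
  calc (∫⁻ x, f x) ^ (1 - l) * (∫⁻ x, g x) ^ l
      = (∫⁻ x, f x) ^ (1 - l) * (∫⁻ x, g x) ^ l * ((α ^ (1 - l))⁻¹ * α ^ (1 - l)) * ((β ^ l)⁻¹ * β ^ l) := by
        rw [c1, c2, mul_one, mul_one]
    _ = _ := by ring

/-- Prekopa-Leindler in dimension n -/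
theorem PLn (n : ℕ) : ∀ (f g h : (Fin n → ℝ) → ℝ≥0∞) (_ : Measurable f) (_ : Measurable g) (_ : Measurable h) (M : ℝ≥0∞) (_ : M ≠ ∞)
    (_ : ∀ x, f x ≤ M) (_ : ∀ x, g x ≤ M) (_ : ∀ x, h x ≤ M) (R : ℝ)
    (_ : ∀ x, ∀ i, R < |x i| → f x = 0) (_ : ∀ x, ∀ i, R < |x i| → g x = 0) (_ : ∀ x, ∀ i, R < |x i| → h x = 0)
    (l : ℝ) (_ : 0 < l) (_ : l < 1)
    (_ : ∀ x y, f x ^ (1 - l) * g y ^ l ≤ h ((1 - l) • x + l • y)),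
    (∫⁻ x, f x) ^ (1 - l) * (∫⁻ x, g x) ^ l ≤ ∫⁻ x, h x := by
  induction n with
  | zero =>
    intro f g h _ _ _ M _ _ _ _ R _ _ _ l hl0 hl1 H
    have : ∀ k : (Fin 0 → ℝ) → ℝ≥0∞, ∫⁻ x, k x = k 0 := by
      intro k
      rw [Measure.volume_pi_eq_dirac (0 : Fin 0 → ℝ), lintegral_dirac]
    rw [this, this, this]
    have := H 0 0
    simpa using this
  | succ n ih =>
    intro f g h hf hg hh M hM hfM hgM hhM R hfR hgR hhR l hl0 hl1 H
    set e := MeasurableEquiv.piFinSuccAbove (fun _ : Fin (n+1) => ℝ) 0 with he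
    have hep := volume_preserving_piFinSuccAbove (fun _ : Fin (n+1) => ℝ) 0
    have fub : ∀ k : (Fin (n+1) → ℝ) → ℝ≥0∞, Measurable k → ∫⁻ x, k x = ∫⁻ t : ℝ, ∫⁻ y : Fin n → ℝ, k (e.symm (t, y)) := by
      intro k hk
      rw [← (hep.symm e).lintegral_comp hk, Measure.volume_eq_prod, lintegral_prod]
      exact (hk.comp e.symm.measurable).aemeasurable
    have es0 : ∀ (t : ℝ) (y : Fin n → ℝ), e.symm (t, y) 0 = t := fun t y => by simp [he, MeasurableEquiv.piFinSuccAbove]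
    have es1 : ∀ (t : ℝ) (y : Fin n → ℝ) (i : Fin n), e.symm (t, y) i.succ = y i := fun t y i => by simp [he, MeasurableEquiv.piFinSuccAbove]
    rw [fub f hf, fub g hg, fub h hh]
    have hms : ∀ k : (Fin (n+1) → ℝ) → ℝ≥0∞, Measurable k → Measurable (fun t : ℝ => ∫⁻ y : Fin n → ℝ, k (e.symm (t, y))) := by
      intro k hk
      exact (hk.comp e.symm.measurable).lintegral_prod_right'
    have hbd : ∀ k : (Fin (n+1) → ℝ) → ℝ≥0∞, (∀ x, k x ≤ M) → (∀ x, ∀ i, R < |x i| → k x = 0) → ∀ t : ℝ,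
        ∫⁻ y : Fin n → ℝ, k (e.symm (t, y)) ≤ M * volume (Icc (fun _ => -R : Fin n → ℝ) (fun _ => R)) := by
      intro k hk hkR t
      rw [← setLIntegral_const, ← lintegral_indicator measurableSet_Icc]
      apply lintegral_mono
      intro y
      by_cases hy : y ∈ Icc (fun _ => -R : Fin n → ℝ) (fun _ => R)
      · simp only [indicator_of_mem hy]; exact hk _
      · rw [indicator_of_notMem hy]
        have : ∃ i, R < |y i| := by
          by_contra hcon
          push Not at hcon
          exact hy ⟨fun i => (abs_le.1 (hcon i)).1, fun i => (abs_le.1 (hcon i)).2⟩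
        obtain ⟨i, hi⟩ := this
        exact le_of_eq (hkR _ i.succ (by rw [es1]; exact hi))
    have hz : ∀ k : (Fin (n+1) → ℝ) → ℝ≥0∞, (∀ x, ∀ i, R < |x i| → k x = 0) → ∀ t : ℝ, R < |t| →
        ∫⁻ y : Fin n → ℝ, k (e.symm (t, y)) = 0 := by
      intro k hkR t ht
      have : ∀ y, k (e.symm (t, y)) = 0 := fun y => hkR _ 0 (by rw [es0]; exact ht)
      simp [this]
    refine PL1 _ _ _ (hms f hf) (hms g hg) (hms h hh) (M * volume (Icc (fun _ => -R : Fin n → ℝ) (fun _ => R)))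
      (ENNReal.mul_ne_top hM (isCompact_Icc.measure_lt_top).ne) (hbd f hfM hfR) (hbd g hgM hgR) (hbd h hhM hhR) R (hz f hfR) (hz g hgR) l hl0 hl1 ?_
    intro s t
    have slice : ∀ t : ℝ, Measurable (fun y : Fin n → ℝ => e.symm (t, y)) := fun t =>
      e.symm.measurable.comp (measurable_const.prodMk measurable_id)
    refine ih _ _ _ (hf.comp (slice s)) (hg.comp (slice t)) (hh.comp (slice _)) M hM (fun _ => hfM _) (fun _ => hgM _) (fun _ => hhM _) R
      (fun x i hi => hfR _ i.succ (lt_of_lt_of_eq hi (congrArg abs (es1 _ _ _).symm))) (fun x i hi => hgR _ i.succ (lt_of_lt_of_eq hi (congrArg abs (es1 _ _ _).symm)))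
      (fun x i hi => hhR _ i.succ (lt_of_lt_of_eq hi (congrArg abs (es1 _ _ _).symm))) l hl0 hl1 ?_
    intro x y
    have := H (e.symm (s, x)) (e.symm (t, y))
    refine this.trans (le_of_eq ?_)
    show _ = h _
    congr 1
    ext i
    refine Fin.cases ?_ (fun i => ?_) i
    · simp only [Pi.add_apply, Pi.smul_apply, es0, smul_eq_mul]
    · simp only [Pi.add_apply, Pi.smul_apply, es1, smul_eq_mul]

lemma rpow_cross (a b : ℝ) (ha : 0 ≤ a) (hb : 0 ≤ b) (l : ℝ) (hl0 : 0 < l) (hl1 : l < 1) :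
    (a ^ (1 - l) * b ^ l) * (b ^ (1 - l) * a ^ l) = a * b := by
  have h1 : a ^ (1 - l) * a ^ l = a := by
    rw [← Real.rpow_add_of_nonneg ha (by linarith) hl0.le]; simp
  have h2 : b ^ (1 - l) * b ^ l = b := by
    rw [← Real.rpow_add_of_nonneg hb (by linarith) hl0.le]; simp
  calc _ = (a ^ (1 - l) * a ^ l) * (b ^ (1 - l) * b ^ l) := by ring
    _ = _ := by rw [h1, h2]

/-- four point property from log-concavity -/
lemma four_of_logconc (A : ℝ → ℝ) (hA0 : ∀ t, 0 ≤ A t)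
    (hA : ∀ s t l : ℝ, 0 < l → l < 1 → A s ^ (1 - l) * A t ^ l ≤ A ((1 - l) * s + l * t))
    (x y x' y' : ℝ) (h1 : y ≤ y') (h2 : y' ≤ x') (h3 : x' ≤ x) (h4 : x + y = x' + y') :
    A x * A y ≤ A x' * A y' := by
  rcases eq_or_lt_of_le h3 with h | h
  · have : y' = y := by linarith
    rw [h, this]
  · have hxy : y < x := by linarith
    have hd : 0 < x - y := by linarith
    set l := (x - x') / (x - y) with hl
    have hl0 : 0 < l := div_pos (by linarith) hd
    have hl1 : l < 1 := by rw [hl, div_lt_one hd]; linarith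
    have e1 : (1 - l) * x + l * y = x' := by rw [hl]; field_simp; ring
    have e2 : (1 - l) * y + l * x = y' := by
      have : y' = x + y - x' := by linarith
      rw [hl, this]; field_simp; ring
    have k1 := hA x y l hl0 hl1
    have k2 := hA y x l hl0 hl1
    rw [e1] at k1
    rw [e2] at k2
    rw [← rpow_cross _ _ (hA0 x) (hA0 y) l hl0 hl1]
    exact mul_le_mul k1 k2 (mul_nonneg (Real.rpow_nonneg (hA0 _) _) (Real.rpow_nonneg (hA0 _) _)) (hA0 _)

/-- structure of a log-concave function on the line -/
lemma logconc_struct (A : ℝ → ℝ) (hA0 : ∀ t, 0 ≤ A t) (R : ℝ) (hR : ∀ t, R < |t| → A t = 0)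
    (hA : ∀ s t l : ℝ, 0 < l → l < 1 → A s ^ (1 - l) * A t ^ l ≤ A ((1 - l) * s + l * t))
    (hv : volume {t | 0 < A t} ≠ 0) :
    ∃ α β, α < β ∧ (∀ t ∈ Ioo α β, 0 < A t) ∧ (∀ t, t ∉ Icc α β → A t = 0) ∧ ContinuousOn A (Ioo α β) := by
  set S := {t | 0 < A t} with hS
  have hSR : S ⊆ Icc (-R) R := by
    intro t ht
    refine abs_le.1 ?_
    by_contra hc
    have := hR t (not_le.1 hc)
    simp only [hS, mem_setOf_eq, this] at ht
    linarith
  have hconv : Convex ℝ S := by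
    intro s hs t ht a b ha hb hab
    rcases eq_or_lt_of_le hb with h | h
    · have : a = 1 := by linarith
      rw [← h, this]; simpa using hs
    rcases eq_or_lt_of_le ha with h' | h'
    · have : b = 1 := by linarith
      rw [← h', this]; simpa using ht
    have k := hA s t b h (by linarith)
    have e : a = 1 - b := by linarith
    rw [e]
    refine lt_of_lt_of_le ?_ k
    exact mul_pos (Real.rpow_pos_of_pos hs _) (Real.rpow_pos_of_pos ht _)
  have hne : S.Nonempty := by
    by_contra hc
    rw [not_nonempty_iff_eq_empty] at hc
    rw [hc] at hv
    simp at hv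
  have hsub1 : S ⊆ Icc (sInf S) (sSup S) := fun t ht =>
    ⟨csInf_le (bddBelow_Icc.mono hSR) ht, le_csSup (bddAbove_Icc.mono hSR) ht⟩
  have hsub2 : Ioo (sInf S) (sSup S) ⊆ S :=
    IsConnected.Ioo_csInf_csSup_subset ⟨hne, hconv.isPreconnected⟩ (bddBelow_Icc.mono hSR) (bddAbove_Icc.mono hSR)
  have hlt : sInf S < sSup S := by
    by_contra hc
    apply hv
    refine measure_mono_null hsub1 ?_
    rw [Real.volume_Icc, ENNReal.ofReal_eq_zero]; linarith
  refine ⟨sInf S, sSup S, hlt, hsub2, ?_, ?_⟩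
  · intro t ht
    by_contra hc
    exact ht (hsub1 (lt_of_le_of_ne (hA0 t) (Ne.symm hc)))
  · have hcon : ConcaveOn ℝ (Ioo (sInf S) (sSup S)) (fun t => Real.log (A t)) := by
      refine ⟨convex_Ioo _ _, ?_⟩
      intro s hs t ht a b ha hb hab
      rcases eq_or_lt_of_le hb with h | h
      · have : a = 1 := by linarith
        rw [← h, this]; simp
      rcases eq_or_lt_of_le ha with h' | h'
      · have : b = 1 := by linarith
        rw [← h', this]; simp
      have k := hA s t b h (by linarith)
      have ps : 0 < A s := hsub2 hs
      have pt : 0 < A t := hsub2 ht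
      have e : a = 1 - b := by linarith
      rw [e]
      have k2 := Real.log_le_log (mul_pos (Real.rpow_pos_of_pos ps _) (Real.rpow_pos_of_pos pt _)) k
      rw [Real.log_mul (Real.rpow_pos_of_pos ps _).ne' (Real.rpow_pos_of_pos pt _).ne', Real.log_rpow ps, Real.log_rpow pt] at k2
      exact k2
    have hc := hcon.continuousOn isOpen_Ioo
    have := Real.continuous_exp.comp_continuousOn hc
    refine this.congr fun t ht => ?_
    exact (Real.exp_log (hsub2 ht)).symm

/-- the one-dimensional inequality for a thin needle in product coordinates -/
theorem needle_prod {n : ℕ} (F : ℝ × (Fin n → ℝ) → ℝ) (hF : Measurable F) (hF0 : ∀ x, 0 ≤ F x) (M : ℝ) (hFM : ∀ x, F x ≤ M)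
    (R : ℝ) (hR0 : ∀ t y, R < |t| → F (t, y) = 0) (hR1 : ∀ t y i, R < |y i| → F (t, y) = 0)
    (hFl : ∀ (x y : ℝ × (Fin n → ℝ)) (l : ℝ), 0 < l → l < 1 → F x ^ (1 - l) * F y ^ l ≤ F ((1 - l) • x + l • y))
    (ω : ℝ → ℝ) (hω : Continuous ω) (D d μ : ℝ) (hd : 0 < d) (hdD : d ≤ D) (hμ0 : 0 < μ)
    (hμ : μ < 3 * π ^ 2 / D ^ 2 + 1 * (D - d) ^ 3 / D ^ 5)
    (hωp : ∀ t y, F (t, y) ≠ 0 → 0 < ω t)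
    (hdiam : ∀ t y t' y', F (t, y) ≠ 0 → F (t', y') ≠ 0 → |t - t'| ≤ d)
    (hω4 : ∀ x y x' y', (∃ z, F (x, z) ≠ 0) → (∃ z, F (y, z) ≠ 0) → y ≤ y' → y' ≤ x' → x' ≤ x → x + y = x' + y' →
      ω x * ω y * cos (π / D * ((x' - y') / 2)) ^ 4 ≤ ω x' * ω y' * cos (π / D * ((x - y) / 2)) ^ 4)
    (g g' : ℝ → ℝ) (hg : ∀ t, HasDerivAt g (g' t) t) (hg' : Continuous g') (B : ℝ) (hB : ∀ t, |g t| ≤ B)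
    (hpos : (∫⁻ x, ENNReal.ofReal (F x)) ≠ 0) :
    ∃ c0, |c0| ≤ B ∧ ∫ x : ℝ × (Fin n → ℝ), (μ * (g x.1 - c0) ^ 2 - g' x.1 ^ 2) * (ω x.1 * F x) ≤ 0 ∧
      0 < ∫ x : ℝ × (Fin n → ℝ), ω x.1 * F x := by
  have hgc : Continuous g := continuous_iff_continuousAt.2 fun t => (hg t).continuousAt
  -- fiber integral
  set a : ℝ → ℝ≥0∞ := fun t => ∫⁻ y, ENNReal.ofReal (F (t, y)) with ha
  have hM0 : 0 ≤ M := (hF0 0).trans (hFM 0)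
  have hcub : ∀ t y, y ∉ Icc (fun _ => -R : Fin n → ℝ) (fun _ => R) → F (t, y) = 0 := by
    intro t y hy
    have : ∃ i, R < |y i| := by
      by_contra hcon
      push Not at hcon
      exact hy ⟨fun i => (abs_le.1 (hcon i)).1, fun i => (abs_le.1 (hcon i)).2⟩
    obtain ⟨i, hi⟩ := this
    exact hR1 t y i hi
  have hafin : ∀ t, a t ≠ ∞ := by
    intro t
    refine ne_top_of_le_ne_top (b := ENNReal.ofReal M * volume (Icc (fun _ => -R : Fin n → ℝ) (fun _ => R)))
      (ENNReal.mul_ne_top ENNReal.ofReal_ne_top isCompact_Icc.measure_lt_top.ne) ?_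
    rw [← setLIntegral_const, ← lintegral_indicator measurableSet_Icc]
    apply lintegral_mono
    intro y
    by_cases hy : y ∈ Icc (fun _ => -R : Fin n → ℝ) (fun _ => R)
    · simp only [indicator_of_mem hy]; exact ENNReal.ofReal_le_ofReal (hFM _)
    · rw [indicator_of_notMem hy]; simp [hcub t y hy]
  have hamul : ∀ s t l : ℝ, 0 < l → l < 1 → a s ^ (1 - l) * a t ^ l ≤ a ((1 - l) * s + l * t) := by
    intro s t l hl0 hl1
    have ms : ∀ t : ℝ, Measurable (fun y : Fin n → ℝ => ENNReal.ofReal (F (t, y))) := fun t => by fun_prop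
    refine PLn n _ _ _ (ms s) (ms t) (ms _) (ENNReal.ofReal M) ENNReal.ofReal_ne_top
      (fun _ => ENNReal.ofReal_le_ofReal (hFM _)) (fun _ => ENNReal.ofReal_le_ofReal (hFM _)) (fun _ => ENNReal.ofReal_le_ofReal (hFM _)) R
      (fun x i hi => by simp [hR1 _ x i hi]) (fun x i hi => by simp [hR1 _ x i hi]) (fun x i hi => by simp [hR1 _ x i hi]) l hl0 hl1 ?_
    intro x y
    rw [ENNReal.ofReal_rpow_of_nonneg (hF0 _) (by linarith), ENNReal.ofReal_rpow_of_nonneg (hF0 _) hl0.le,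
      ← ENNReal.ofReal_mul (Real.rpow_nonneg (hF0 _) _)]
    exact ENNReal.ofReal_le_ofReal (hFl (s, x) (t, y) l hl0 hl1)
  set A : ℝ → ℝ := fun t => (a t).toReal with hAdef
  have hA0 : ∀ t, 0 ≤ A t := fun t => ENNReal.toReal_nonneg
  have hAmul : ∀ s t l : ℝ, 0 < l → l < 1 → A s ^ (1 - l) * A t ^ l ≤ A ((1 - l) * s + l * t) := by
    intro s t l hl0 hl1
    have := ENNReal.toReal_mono (hafin _) (hamul s t l hl0 hl1)
    rwa [ENNReal.toReal_mul, ← ENNReal.toReal_rpow, ← ENNReal.toReal_rpow] at this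
  have hAR : ∀ t, R < |t| → A t = 0 := by
    intro t ht
    have : ∀ y, F (t, y) = 0 := fun y => hR0 t y ht
    simp [hAdef, ha, this]
  have hAmeas : Measurable a := by
    have : Measurable (fun x : ℝ × (Fin n → ℝ) => ENNReal.ofReal (F x)) := by fun_prop
    exact this.lintegral_prod_right'
  have hAF : ∀ t, 0 < A t → ∃ y, F (t, y) ≠ 0 := by
    intro t ht
    by_contra hc
    push Not at hc
    simp [hAdef, ha, hc] at ht
  have hvS : volume {t | 0 < A t} ≠ 0 := by
    intro h0
    apply hpos
    rw [Measure.volume_eq_prod, lintegral_prod _ (by fun_prop)]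
    rw [lintegral_eq_zero_iff hAmeas]
    have : ∀ᵐ t : ℝ, t ∉ {t | 0 < A t} := measure_eq_zero_iff_ae_notMem.1 h0
    filter_upwards [this] with t ht
    have h2 : A t = 0 := le_antisymm (not_lt.1 ht) (hA0 t)
    exact ((ENNReal.toReal_eq_zero_iff _).1 h2).resolve_right (hafin t)
  obtain ⟨α, β, hαβ, hApos, hAz, hAc⟩ := logconc_struct A hA0 R hAR hAmul hvS
  set q : ℝ → ℝ := fun t => A t * ω t with hq
  have hqp : ∀ t ∈ Ioo α β, 0 < q t := fun t ht => by
    obtain ⟨y, hy⟩ := hAF t (hApos t ht)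
    exact mul_pos (hApos t ht) (hωp t y hy)
  -- Fubini
  have hsupp : ∀ x : ℝ × (Fin n → ℝ), x ∉ Icc ((-R, fun _ => -R) : ℝ × (Fin n → ℝ)) (R, fun _ => R) → F x = 0 := by
    rintro ⟨t, y⟩ hx
    by_contra hc
    apply hx
    have h1 : |t| ≤ R := not_lt.1 fun h => hc (hR0 t y h)
    have h2 : ∀ i, |y i| ≤ R := fun i => not_lt.1 fun h => hc (hR1 t y i h)
    exact ⟨⟨(abs_le.1 h1).1, fun i => (abs_le.1 (h2 i)).1⟩, ⟨(abs_le.1 h1).2, fun i => (abs_le.1 (h2 i)).2⟩⟩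
  have hInt : ∀ G : ℝ → ℝ, Continuous G → Integrable (fun x : ℝ × (Fin n → ℝ) => G x.1 * (ω x.1 * F x)) := by
    intro G hG
    have hFint : Integrable F := by
      have : F = indicator (Icc ((-R, fun _ => -R) : ℝ × (Fin n → ℝ)) (R, fun _ => R)) F := by
        ext x
        by_cases hx : x ∈ Icc ((-R, fun _ => -R) : ℝ × (Fin n → ℝ)) (R, fun _ => R)
        · rw [indicator_of_mem hx]
        · rw [indicator_of_notMem hx, hsupp x hx]
      rw [this, integrable_indicator_iff measurableSet_Icc]
      refine Measure.integrableOn_of_bounded (M := M) isCompact_Icc.measure_lt_top.ne hF.aestronglyMeasurable ?_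
      exact Eventually.of_forall fun x => by rw [Real.norm_eq_abs, abs_of_nonneg (hF0 x)]; exact hFM x
    have hcomp : IsCompact (Icc (-R) R) := isCompact_Icc
    obtain ⟨C, hC⟩ := hcomp.exists_bound_of_continuousOn (f := fun t => G t * ω t) (by fun_prop)
    refine (hFint.const_mul C).mono' (by fun_prop) (Eventually.of_forall fun x => ?_)
    rw [← mul_assoc, norm_mul, Real.norm_eq_abs (F x), abs_of_nonneg (hF0 x)]
    by_cases hx : |x.1| ≤ R
    · exact mul_le_mul_of_nonneg_right (hC _ (abs_le.1 hx)) (hF0 x)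
    · rw [show F x = 0 from hR0 x.1 x.2 (not_le.1 hx)]; simp
  have hfib : ∀ t, ∫ y, F (t, y) = A t := by
    intro t
    rw [integral_eq_lintegral_of_nonneg_ae (Eventually.of_forall fun y => hF0 _)]
    exact (hF.comp (measurable_const.prodMk measurable_id)).aestronglyMeasurable
  have hFub : ∀ G : ℝ → ℝ, Continuous G → IntegrableOn (fun t => G t * q t) (Ioo α β) ∧
      ∫ x : ℝ × (Fin n → ℝ), G x.1 * (ω x.1 * F x) = ∫ t in Ioo α β, G t * q t := by
    intro G hG
    have h1 := hInt G hG
    rw [Measure.volume_eq_prod] at h1 ⊢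
    have e : ∀ t, ∫ y : Fin n → ℝ, G t * (ω t * F (t, y)) = G t * q t := fun t => by
      simp only [hq]
      rw [integral_const_mul, integral_const_mul, hfib]; ring
    have h2 := h1.integral_prod_left
    simp only [e] at h2
    refine ⟨h2.integrableOn, ?_⟩
    rw [integral_prod _ h1]
    simp only [e]
    rw [setIntegral_congr_set Ioo_ae_eq_Icc, setIntegral_eq_integral_of_forall_compl_eq_zero]
    intro t ht
    simp only [hq]; rw [hAz t ht]; ring
  have hqi : IntegrableOn q (Ioo α β) := by simpa using (hFub (fun _ => 1) continuous_const).1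
  have hba : β - α ≤ d := by
    by_contra hc
    push Not at hc
    set η := (β - α - d) / 4 with hη
    have hη0 : 0 < η := by rw [hη]; linarith
    obtain ⟨y1, h1⟩ := hAF _ (hApos (α + η) ⟨by linarith, by linarith⟩)
    obtain ⟨y2, h2⟩ := hAF _ (hApos (β - η) ⟨by linarith, by linarith⟩)
    have := hdiam _ _ _ _ h2 h1
    have := (abs_le.1 this).2
    linarith
  have hone := oneD q g g' α β D d μ hαβ hd hba hdD hμ0 hμ (hAc.mul hω.continuousOn) hqp hqi (by
    intro x y x' y' h1 h2 h3 h4 h5 h6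
    have hx := hAF x (hApos x ⟨by linarith, h5⟩)
    have hy := hAF y (hApos y ⟨h1, by linarith⟩)
    have k1 := hω4 x y x' y' hx hy h2 h3 h4 h6
    have k2 := four_of_logconc A hA0 hAmul x y x' y' h2 h3 h4 h6
    obtain ⟨zx, hzx⟩ := hx
    obtain ⟨zy, hzy⟩ := hy
    have k3 : 0 ≤ ω x * ω y * cos (π / D * ((x' - y') / 2)) ^ 4 :=
      mul_nonneg (mul_nonneg (hωp _ _ hzx).le (hωp _ _ hzy).le) (by positivity)
    have := mul_le_mul k2 k1 k3 (mul_nonneg (hA0 _) (hA0 _))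
    simp only [hq]
    linarith) hg hg'
  have hQpos : 0 < ∫ t in Ioo α β, q t := by
    rw [setIntegral_pos_iff_support_of_nonneg_ae]
    · have : Ioo α β ⊆ Function.support q ∩ Ioo α β := fun t ht => ⟨(hqp t ht).ne', ht⟩
      refine lt_of_lt_of_le ?_ (measure_mono this)
      rw [Real.volume_Ioo]; simpa using hαβ
    · exact (ae_restrict_iff' measurableSet_Ioo).2 (Eventually.of_forall fun t ht => (hqp t ht).le)
    · exact hqi
  set Q := ∫ t in Ioo α β, q t with hQ
  set I1 := ∫ t in Ioo α β, g t * q t with hI1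
  obtain ⟨i1, -⟩ := hFub g hgc
  obtain ⟨i2, -⟩ := hFub (fun t => g t ^ 2) (by fun_prop)
  obtain ⟨i3, -⟩ := hFub (fun t => g' t ^ 2) (by fun_prop)
  refine ⟨I1 / Q, ?_, ?_, ?_⟩
  · rw [abs_div, abs_of_pos hQpos, div_le_iff₀ hQpos]
    have h1 : |I1| ≤ ∫ t in Ioo α β, |g t * q t| := abs_integral_le_integral_abs
    refine h1.trans ?_
    rw [hQ, ← integral_const_mul]
    refine setIntegral_mono_on i1.abs (hqi.const_mul B) measurableSet_Ioo fun t ht => ?_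
    rw [abs_mul, abs_of_pos (hqp t ht)]
    exact mul_le_mul_of_nonneg_right (hB t) (hqp t ht).le
  · rw [(hFub (fun t => μ * (g t - I1 / Q) ^ 2 - g' t ^ 2) (by fun_prop)).2]
    have e : ∀ t, (μ * (g t - I1 / Q) ^ 2 - g' t ^ 2) * q t =
        (μ * (g t ^ 2 * q t) - (2 * μ * (I1 / Q)) * (g t * q t) + (μ * (I1 / Q) ^ 2) * q t) - g' t ^ 2 * q t := fun t => by ring
    simp only [e]
    rw [integral_sub, integral_add, integral_sub, integral_const_mul, integral_const_mul, integral_const_mul, ← hI1, ← hQ]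
    · set I2 := ∫ t in Ioo α β, g t ^ 2 * q t with hI2
      set I3 := ∫ t in Ioo α β, g' t ^ 2 * q t with hI3
      have : (μ * I2 - 2 * μ * (I1 / Q) * I1 + μ * (I1 / Q) ^ 2 * Q - I3) = (μ * (I2 * Q - I1 ^ 2) - Q * I3) / Q := by
        field_simp; ring
      rw [this]
      exact div_nonpos_of_nonpos_of_nonneg (by linarith) hQpos.le
    · exact i2.const_mul μ
    · exact i1.const_mul _
    · exact (i2.const_mul μ).sub (i1.const_mul _)
    · exact hqi.const_mul _
    · exact ((i2.const_mul μ).sub (i1.const_mul _)).add (hqi.const_mul _)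
    · exact i3
  · have := (hFub (fun _ => 1) continuous_const).2
    simp only [one_mul] at this
    rw [this]; exact hQpos

/-- rotated product coordinates with first coordinate along a unit vector -/
lemma rot_exists {n : ℕ} (e : EN (n+1)) (he : ‖e‖ = 1) :
    ∃ A : (ℝ × (Fin n → ℝ)) ≃L[ℝ] EN (n+1), MeasurePreserving A volume volume ∧ ∀ z, ⟪A z, e⟫ = z.1 := by
  have hor : Orthonormal ℝ (({0} : Set (Fin (n+1))).domRestrict (fun _ => e)) := by
    constructor
    · intro i; exact he
    · intro i j hij
      exact absurd (Subsingleton.elim i j) hij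
  obtain ⟨b, hb⟩ := hor.exists_orthonormalBasis_extension_of_card_eq (by simp)
  have hb0 : b 0 = e := hb 0 rfl
  let A1 : (ℝ × (Fin n → ℝ)) ≃L[ℝ] (Fin (n+1) → ℝ) := Fin.consEquivL ℝ (fun _ : Fin (n+1) => ℝ)
  let A2 : (Fin (n+1) → ℝ) ≃L[ℝ] EN (n+1) := (PiLp.continuousLinearEquiv 2 ℝ (fun _ : Fin (n+1) => ℝ)).symm
  let A3 : EN (n+1) ≃L[ℝ] EN (n+1) := b.repr.symm.toContinuousLinearEquiv
  refine ⟨(A1.trans A2).trans A3, ?_, ?_⟩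
  · have m1 : MeasurePreserving A1 volume volume := by
      have := (volume_preserving_piFinSuccAbove (fun _ : Fin (n+1) => ℝ) 0).symm
      suffices heq : (A1 : ℝ × (Fin n → ℝ) → (Fin (n+1) → ℝ)) = (MeasurableEquiv.piFinSuccAbove (fun _ : Fin (n+1) => ℝ) 0).symm by
        rw [heq]; exact this
      funext z; funext i
      refine Fin.cases ?_ (fun j => ?_) i
      · simp [A1, MeasurableEquiv.piFinSuccAbove]
      · simp [A1, MeasurableEquiv.piFinSuccAbove]
    have m2 : MeasurePreserving A2 volume volume := PiLp.volume_preserving_toLp (Fin (n+1))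
    have m3 : MeasurePreserving A3 volume volume := b.repr.symm.measurePreserving
    exact m3.comp (m2.comp m1)
  · intro z
    have : ⟪A3 (A2 (A1 z)), e⟫ = (A2 (A1 z)) 0 := by
      rw [real_inner_comm, ← hb0, ← b.repr_apply_apply]
      simp [A3]
    exact this

/-- integrals in translated rotated coordinates -/
lemma rot_integral {n : ℕ} (A : (ℝ × (Fin n → ℝ)) ≃L[ℝ] EN (n+1)) (hA : MeasurePreserving A volume volume)
    (a : EN (n+1)) (f : EN (n+1) → ℝ) : ∫ z, f (a + A z) = ∫ x, f x := by
  have h1 := hA.integral_comp A.toHomeomorph.measurableEmbedding (fun x => f (a + x))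
  rw [h1, integral_add_left_eq_self]

lemma rot_lintegral {n : ℕ} (A : (ℝ × (Fin n → ℝ)) ≃L[ℝ] EN (n+1)) (hA : MeasurePreserving A volume volume)
    (a : EN (n+1)) (f : EN (n+1) → ℝ≥0∞) : ∫⁻ z, f (a + A z) = ∫⁻ x, f x := by
  have h1 := hA.lintegral_comp_emb A.toHomeomorph.measurableEmbedding (fun x => f (a + x))
  rw [h1, lintegral_add_left_eq_self]

/-- the data of the localized weighted problem in `k = n + 1` dimensions -/
structure ND (n : ℕ) (W : Set (EN (n+1))) (h U : EN (n+1) → ℝ) (M D d μ : ℝ) : Prop where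
  Wo : IsOpen W
  Wc : Convex ℝ W
  Wb : IsBounded W
  hp : ∀ x ∈ W, 0 < h x
  hM : ∀ x ∈ W, h x ≤ M
  hc : ContinuousOn h W
  hl : ∀ x ∈ W, ∀ y ∈ W, ∀ l : ℝ, 0 < l → l < 1 → h x ^ (1 - l) * h y ^ l ≤ h ((1 - l) • x + l • y)
  Uc : Continuous U
  Up : ∀ x ∈ W, 0 < U x
  U4 : ∀ p ∈ W, ∀ q ∈ W, ∀ σ : ℝ, |σ| ≤ 1 →
    U p * U q * cos (π / D * (σ * (‖p - q‖ / 2))) ^ 2 ≤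
      U ((1/2:ℝ) • (p + q) + (σ/2) • (p - q)) * U ((1/2:ℝ) • (p + q) - (σ/2) • (p - q)) *
        cos (π / D * (‖p - q‖ / 2)) ^ 2
  hd : 0 < d
  hdD : d ≤ D
  hμ0 : 0 < μ
  hμ : μ < 3 * π ^ 2 / D ^ 2 + 1 * (D - d) ^ 3 / D ^ 5
  diam : ∀ x ∈ W, ∀ y ∈ W, ‖x - y‖ ≤ d

/-- projection on the line through `a` with direction `e` -/
def lproj {n : ℕ} (a e : EN (n+1)) (x : EN (n+1)) : EN (n+1) := a + ⟪x - a, e⟫ • e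

lemma needle_E {n : ℕ} {W : Set (EN (n+1))} {h U : EN (n+1) → ℝ} {M D d μ : ℝ} (H : ND n W h U M D d μ)
    (K : Set (EN (n+1))) (hK : IsCompact K) (hKc : Convex ℝ K) (hKW : K ⊆ W) (hKv : volume K ≠ 0)
    (a e : EN (n+1)) (he : ‖e‖ = 1) (hproj : ∀ x ∈ K, lproj a e x ∈ W)
    (g : EN (n+1) → ℝ) (hg : ContDiff ℝ 1 g) (B : ℝ) (hB : ∀ x, |g x| ≤ B) :
    ∃ c0, |c0| ≤ B ∧
      ∫ x in K, (μ * (g (lproj a e x) - c0) ^ 2 - (fderiv ℝ g (lproj a e x) e) ^ 2) * (h x * U (lproj a e x) ^ 2) ≤ 0 ∧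
      0 < ∫ x in K, h x * U (lproj a e x) ^ 2 := by
  obtain ⟨A, hAm, hA1⟩ := rot_exists e he
  have hlp : ∀ z, lproj a e (a + A z) = a + z.1 • e := by
    intro z; unfold lproj; rw [add_sub_cancel_left, hA1]
  set F0 : EN (n+1) → ℝ := K.indicator h with hF0
  have hF0m : Measurable F0 := by
    classical
    have := ContinuousOn.measurable_piecewise (f := h) (g := fun _ => (0:ℝ)) (H.hc.mono hKW) continuousOn_const hK.measurableSet
    rwa [show K.piecewise h (fun _ => (0:ℝ)) = F0 from by rw [hF0]; exact Set.piecewise_eq_indicator] at this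
  set F : ℝ × (Fin n → ℝ) → ℝ := fun z => F0 (a + A z) with hF
  have hFm : Measurable F := hF0m.comp (by fun_prop)
  have hFne : ∀ z, F z ≠ 0 → a + A z ∈ K := fun z hz => by
    by_contra hc
    exact hz (indicator_of_notMem hc _)
  have hFK : ∀ z, a + A z ∈ K → F z = h (a + A z) := fun z hz => indicator_of_mem hz _
  have hFnn : ∀ z, 0 ≤ F z := fun z => by
    by_cases hz : a + A z ∈ K
    · rw [hFK z hz]; exact (H.hp _ (hKW hz)).le
    · exact (indicator_of_notMem hz _).ge
  have hne : K.Nonempty := by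
    by_contra hc
    rw [not_nonempty_iff_eq_empty] at hc
    simp [hc] at hKv
  have hM0 : 0 ≤ M := by
    obtain ⟨x, hx⟩ := hne
    exact (H.hp _ (hKW hx)).le.trans (H.hM _ (hKW hx))
  have hFM : ∀ z, F z ≤ M := fun z => by
    by_cases hz : a + A z ∈ K
    · rw [hFK z hz]; exact H.hM _ (hKW hz)
    · exact (indicator_of_notMem hz _).le.trans hM0
  obtain ⟨R, hR⟩ : ∃ R, ∀ z, a + A z ∈ K → ‖z‖ ≤ R := by
    have hc : IsCompact ((fun x => A.symm (x - a)) '' K) := hK.image (by fun_prop)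
    obtain ⟨R, hR⟩ := hc.isBounded.exists_norm_le
    refine ⟨R, fun z hz => hR z ⟨_, hz, ?_⟩⟩
    simp
  have hwit : ∀ t, (∃ y, F (t, y) ≠ 0) → a + t • e ∈ W := by
    rintro t ⟨y, hy⟩
    have := hproj _ (hFne _ hy)
    rwa [hlp] at this
  set ω : ℝ → ℝ := fun t => U (a + t • e) ^ 2 with hω
  have hUc := H.Uc
  have hωc : Continuous ω := by fun_prop
  have hgd : ∀ x, HasFDerivAt g (fderiv ℝ g x) x := fun x => (hg.differentiable (by norm_num) x).hasFDerivAt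
  have hgt : ∀ t : ℝ, HasDerivAt (fun t : ℝ => g (a + t • e)) (fderiv ℝ g (a + t • e) e) t := by
    intro t
    have h1 : HasDerivAt (fun t : ℝ => a + t • e) e t := by
      have := ((hasDerivAt_id t).smul_const e).const_add a
      simpa using this
    exact (hgd _).comp_hasDerivAt t h1
  have hfc : Continuous (fderiv ℝ g) := hg.continuous_fderiv (by norm_num)
  have hgc' : Continuous (fun t : ℝ => fderiv ℝ g (a + t • e) e) := by fun_prop
  obtain ⟨c0, hc0, hI, hP⟩ := needle_prod F hFm hFnn M hFM R
    (fun t y ht => by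
      by_contra hc
      have := hR _ (hFne _ hc)
      have h2 := (norm_fst_le (t, y)).trans this
      rw [Real.norm_eq_abs] at h2
      exact absurd ht (not_lt.2 h2))
    (fun t y i ht => by
      by_contra hc
      have := hR _ (hFne _ hc)
      have h2 := (norm_le_pi_norm y i).trans ((norm_snd_le (t, y)).trans this)
      rw [Real.norm_eq_abs] at h2
      exact absurd ht (not_lt.2 h2))
    (fun x y l hl0 hl1 => by
      by_cases hx : a + A x ∈ K
      · by_cases hy : a + A y ∈ K
        · have e1 : a + A ((1 - l) • x + l • y) = (1 - l) • (a + A x) + l • (a + A y) := by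
            rw [map_add, map_smul, map_smul]; module
          have hm : a + A ((1 - l) • x + l • y) ∈ K := by
            rw [e1]; exact hKc hx hy (by linarith) hl0.le (by ring)
          rw [hFK _ hx, hFK _ hy, hFK _ hm, e1]
          exact H.hl _ (hKW hx) _ (hKW hy) l hl0 hl1
        · rw [show F y = 0 from indicator_of_notMem hy _, Real.zero_rpow hl0.ne', mul_zero]
          exact hFnn _
      · rw [show F x = 0 from indicator_of_notMem hx _, Real.zero_rpow (by linarith), zero_mul]
        exact hFnn _)
    ω hωc D d μ H.hd H.hdD H.hμ0 H.hμ
    (fun t y hy => pow_pos (H.Up _ (hwit t ⟨y, hy⟩)) 2)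
    (fun t y t' y' h1 h2 => by
      have k := H.diam _ (hKW (hFne _ h1)) _ (hKW (hFne _ h2))
      have e1 : t - t' = ⟪(a + A (t, y)) - (a + A (t', y')), e⟫ := by
        rw [add_sub_add_left_eq_sub, inner_sub_left, hA1, hA1]
      rw [e1]
      refine (abs_real_inner_le_norm _ _).trans ?_
      rw [he, mul_one]; exact k)
    (fun x y x' y' hx hy h1 h2 h3 h4 => by
      have wx := hwit x hx
      have wy := hwit y hy
      rcases eq_or_lt_of_le (show y ≤ x by linarith) with hxy | hxy
      · have e1 : x' = x := by linarith
        have e2 : y' = y := by linarith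
        rw [e1, e2]
      · have hs : |(x' - y') / (x - y)| ≤ 1 := by
          rw [abs_div, abs_of_nonneg (by linarith), abs_of_pos (by linarith), div_le_one (by linarith)]; linarith
        have k := H.U4 _ wx _ wy _ hs
        have n1 : ‖(a + x • e) - (a + y • e)‖ = x - y := by
          rw [show (a + x • e) - (a + y • e) = (x - y) • e by module, norm_smul, he, mul_one, Real.norm_eq_abs, abs_of_pos (by linarith)]
        have n2 : (x' - y') / (x - y) * ((x - y) / 2) = (x' - y') / 2 := by
          have : x - y ≠ 0 := by linarith
          field_simp
        have hne' : x - y ≠ 0 := by linarith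
        have ys : y' = x + y - x' := by linarith
        have n3 : (1/2:ℝ) • ((a + x • e) + (a + y • e)) + ((x' - y') / (x - y) / 2) • ((a + x • e) - (a + y • e)) = a + x' • e := by
          rw [show (a + x • e) - (a + y • e) = (x - y) • e by module, smul_smul,
            show (x' - y') / (x - y) / 2 * (x - y) = (x' - y') / 2 by field_simp, ys]
          module
        have n4 : (1/2:ℝ) • ((a + x • e) + (a + y • e)) - ((x' - y') / (x - y) / 2) • ((a + x • e) - (a + y • e)) = a + y' • e := by
          rw [show (a + x • e) - (a + y • e) = (x - y) • e by module, smul_smul,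
            show (x' - y') / (x - y) / 2 * (x - y) = (x' - y') / 2 by field_simp, ys]
          module
        rw [n3, n4, n1, n2] at k
        have k0 : 0 ≤ U (a + x • e) * U (a + y • e) * cos (π / D * ((x' - y') / 2)) ^ 2 :=
          mul_nonneg (mul_nonneg (H.Up _ wx).le (H.Up _ wy).le) (sq_nonneg _)
        have k2 := pow_le_pow_left₀ k0 k 2
        simp only [hω]
        calc _ = (U (a + x • e) * U (a + y • e) * cos (π / D * ((x' - y') / 2)) ^ 2) ^ 2 := by ring
          _ ≤ _ := k2
          _ = _ := by ring)
    (fun t : ℝ => g (a + t • e)) (fun t : ℝ => fderiv ℝ g (a + t • e) e) hgt hgc' B (fun t => hB _)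
    (by
      rw [hF, rot_lintegral A hAm a (fun x => ENNReal.ofReal (F0 x))]
      intro h0
      rw [lintegral_eq_zero_iff (by fun_prop)] at h0
      apply hKv
      refine measure_mono_null (t := {x | ¬ (fun x => ENNReal.ofReal (F0 x)) x = (0 : EN (n+1) → ℝ≥0∞) x}) ?_ h0
      intro x hx
      simp only [mem_setOf_eq, Pi.zero_apply, ENNReal.ofReal_eq_zero, not_le]
      rw [hF0, indicator_of_mem hx]
      exact H.hp _ (hKW hx))
  refine ⟨c0, hc0, ?_, ?_⟩
  · rw [← integral_indicator hK.measurableSet, ← rot_integral A hAm a]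
    refine le_trans (le_of_eq ?_) hI
    refine integral_congr_ae (Eventually.of_forall fun z => ?_)
    simp only []
    by_cases hz : a + A z ∈ K
    · rw [indicator_of_mem hz, hFK z hz, hlp]; simp only [hω]; ring
    · rw [indicator_of_notMem hz, show F z = 0 from indicator_of_notMem hz _]; ring
  · rw [← integral_indicator hK.measurableSet, ← rot_integral A hAm a]
    refine lt_of_lt_of_le hP (le_of_eq ?_)
    refine integral_congr_ae (Eventually.of_forall fun z => ?_)
    simp only []
    by_cases hz : a + A z ∈ K
    · rw [indicator_of_mem hz, hFK z hz, hlp]; simp only [hω]; ring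
    · rw [indicator_of_notMem hz, show F z = 0 from indicator_of_notMem hz _]; ring

/-- a thin convex needle cannot carry a violation -/
theorem thin_needle {n : ℕ} {W : Set (EN (n+1))} {h U : EN (n+1) → ℝ} {M D d μ : ℝ} (H : ND n W h U M D d μ)
    (K : Set (EN (n+1))) (hK : IsCompact K) (hKc : Convex ℝ K) (hKW : K ⊆ W) (hKv : volume K ≠ 0)
    (a e : EN (n+1)) (he : ‖e‖ = 1) (hproj : ∀ x ∈ K, lproj a e x ∈ W)
    (g : EN (n+1) → ℝ) (hg : ContDiff ℝ 1 g) (B B' : ℝ) (hB : ∀ x, |g x| ≤ B) (hB' : ∀ x, ‖fderiv ℝ g x‖ ≤ B')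
    (η c : ℝ) (hη0 : 0 ≤ η) (hη1 : η ≤ 1 / 2)
    (h1 : ∀ x ∈ K, |g x - g (lproj a e x)| ≤ η)
    (h2 : ∀ x ∈ K, ‖fderiv ℝ g x - fderiv ℝ g (lproj a e x)‖ ≤ η)
    (h3 : ∀ x ∈ K, |U x ^ 2 - U (lproj a e x) ^ 2| ≤ η * U (lproj a e x) ^ 2)
    (hmean : ∫ x in K, g x * (h x * U x ^ 2) = 0)
    (hquad : 0 ≤ ∫ x in K, (μ * g x ^ 2 - ‖fderiv ℝ g x‖ ^ 2 - c) * (h x * U x ^ 2))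
    (hc : η * (2 * (4 * μ * B + 2 * B') + (4 * μ * B ^ 2 + B' ^ 2)) < c / 2) : False := by
  obtain ⟨c0, hc0, hI, hP⟩ := needle_E H K hK hKc hKW hKv a e he hproj g hg B hB
  set C2 := 2 * (4 * μ * B + 2 * B') + (4 * μ * B ^ 2 + B' ^ 2) with hC2
  have hB0 : 0 ≤ B := (abs_nonneg _).trans (hB 0)
  have hB'0 : 0 ≤ B' := (norm_nonneg _).trans (hB' 0)
  have hμ0 := H.hμ0
  have hUc := H.Uc
  have hhc := H.hc.mono hKW
  have hgc : Continuous g := hg.continuous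
  have hfc : Continuous (fderiv ℝ g) := hg.continuous_fderiv (by norm_num)
  have hlc : Continuous (lproj a e) := by unfold lproj; fun_prop
  have hcpos : 0 < c := by
    have : 0 ≤ C2 := by positivity
    nlinarith [mul_nonneg hη0 this]
  -- integrability
  have iC : ∀ f : EN (n+1) → ℝ, Continuous f → IntegrableOn (fun x => f x * (h x * U x ^ 2)) K := fun f hf =>
    (hf.continuousOn.mul (hhc.mul (hUc.pow 2).continuousOn)).integrableOn_compact hK
  have iC' : ∀ f : EN (n+1) → ℝ, Continuous f → IntegrableOn (fun x => f x * (h x * U (lproj a e x) ^ 2)) K := fun f hf =>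
    (hf.continuousOn.mul (hhc.mul ((hUc.comp hlc).pow 2).continuousOn)).integrableOn_compact hK
  have i1 := iC g hgc
  have i2 := iC (fun x => μ * g x ^ 2 - ‖fderiv ℝ g x‖ ^ 2 - c) (by fun_prop)
  have i3 := iC (fun x => μ * (g x - c0) ^ 2 - ‖fderiv ℝ g x‖ ^ 2 - c) (by fun_prop)
  have i4 := iC (fun _ => 1) continuous_const
  have i5 := iC' (fun x => μ * (g (lproj a e x) - c0) ^ 2 - (fderiv ℝ g (lproj a e x) e) ^ 2) (by fun_prop)
  have i6 := iC' (fun _ => 1) continuous_const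
  -- shift by c0
  have s1 : 0 ≤ ∫ x in K, (μ * (g x - c0) ^ 2 - ‖fderiv ℝ g x‖ ^ 2 - c) * (h x * U x ^ 2) := by
    have e1 : ∀ x, (μ * (g x - c0) ^ 2 - ‖fderiv ℝ g x‖ ^ 2 - c) * (h x * U x ^ 2) =
        (μ * g x ^ 2 - ‖fderiv ℝ g x‖ ^ 2 - c) * (h x * U x ^ 2) - (2 * μ * c0) * (g x * (h x * U x ^ 2)) +
        (μ * c0 ^ 2) * (1 * (h x * U x ^ 2)) := fun x => by ring
    simp only [e1]
    rw [integral_add (by exact i2.sub (i1.const_mul _)) (by exact i4.const_mul _), integral_sub i2 (i1.const_mul _), integral_const_mul, integral_const_mul, hmean]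
    have : 0 ≤ ∫ x in K, 1 * (h x * U x ^ 2) := setIntegral_nonneg hK.measurableSet fun x hx => by
      have := H.hp x (hKW hx); positivity
    have : 0 ≤ μ * c0 ^ 2 * ∫ x in K, 1 * (h x * U x ^ 2) := by positivity
    linarith
  -- pointwise comparison
  have s2 : ∫ x in K, (μ * (g x - c0) ^ 2 - ‖fderiv ℝ g x‖ ^ 2 - c) * (h x * U x ^ 2) ≤
      ∫ x in K, ((μ * (g (lproj a e x) - c0) ^ 2 - (fderiv ℝ g (lproj a e x) e) ^ 2) * (h x * U (lproj a e x) ^ 2) +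
        (η * C2 - c / 2) * (1 * (h x * U (lproj a e x) ^ 2))) := by
    refine setIntegral_mono_on i3 (i5.add (i6.const_mul _)) hK.measurableSet fun x hx => ?_
    have hh := H.hp x (hKW hx)
    have b1 := h1 x hx
    have b2 := h2 x hx
    have b3 := h3 x hx
    set y := lproj a e x with hy
    have b4 : |fderiv ℝ g x e - fderiv ℝ g y e| ≤ η := by
      have := (fderiv ℝ g x - fderiv ℝ g y).le_opNorm e
      rw [he, mul_one, Real.norm_eq_abs] at this
      exact this.trans b2
    have b5 : |fderiv ℝ g x e| ≤ ‖fderiv ℝ g x‖ := by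
      have := (fderiv ℝ g x).le_opNorm e
      rwa [he, mul_one, Real.norm_eq_abs] at this
    have b6 : |fderiv ℝ g y e| ≤ B' := by
      have := (fderiv ℝ g y).le_opNorm e
      rw [he, mul_one, Real.norm_eq_abs] at this
      exact this.trans (hB' y)
    have b7 : |fderiv ℝ g x e| ≤ B' := b5.trans (hB' x)
    set ux := U x ^ 2
    set uy := U y ^ 2
    have huy : 0 ≤ uy := sq_nonneg _
    have hux : 0 ≤ ux := sq_nonneg _
    -- squares
    have q1 : (g x - c0) ^ 2 ≤ (g y - c0) ^ 2 + 4 * B * η := by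
      have ee : (g x - c0) ^ 2 - (g y - c0) ^ 2 = (g x - g y) * (g x + g y - 2 * c0) := by ring
      have : |(g x - g y) * (g x + g y - 2 * c0)| ≤ η * (4 * B) := by
        rw [abs_mul]
        refine mul_le_mul b1 ?_ (abs_nonneg _) hη0
        have a1 := abs_le.1 (hB x); have a2 := abs_le.1 (hB y); have a3 := abs_le.1 hc0
        rw [abs_le]; constructor <;> linarith
      have := (abs_le.1 this).2
      linarith
    have q2 : (fderiv ℝ g y e) ^ 2 - 2 * B' * η ≤ ‖fderiv ℝ g x‖ ^ 2 := by
      have ee : (fderiv ℝ g x e) ^ 2 - (fderiv ℝ g y e) ^ 2 = (fderiv ℝ g x e - fderiv ℝ g y e) * (fderiv ℝ g x e + fderiv ℝ g y e) := by ring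
      have : |(fderiv ℝ g x e - fderiv ℝ g y e) * (fderiv ℝ g x e + fderiv ℝ g y e)| ≤ η * (2 * B') := by
        rw [abs_mul]
        refine mul_le_mul b4 ?_ (abs_nonneg _) hη0
        refine (abs_add_le _ _).trans (by linarith)
      have h4 := (abs_le.1 this).1
      have h5 : (fderiv ℝ g x e) ^ 2 ≤ ‖fderiv ℝ g x‖ ^ 2 := by
        rw [← sq_abs (fderiv ℝ g x e)]; exact pow_le_pow_left₀ (abs_nonneg _) b5 2
      linarith
    set Q := μ * (g y - c0) ^ 2 - (fderiv ℝ g y e) ^ 2 with hQ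
    have q3 : μ * (g x - c0) ^ 2 - ‖fderiv ℝ g x‖ ^ 2 ≤ Q + η * (4 * μ * B + 2 * B') := by
      have := mul_le_mul_of_nonneg_left q1 hμ0.le
      rw [hQ]; linarith
    have q4 : |Q| ≤ 4 * μ * B ^ 2 + B' ^ 2 := by
      have a1 : (g y - c0) ^ 2 ≤ (2 * B) ^ 2 := by
        rw [← sq_abs]; refine pow_le_pow_left₀ (abs_nonneg _) ?_ 2
        have a2 := abs_le.1 (hB y); have a3 := abs_le.1 hc0
        rw [abs_le]; constructor <;> linarith
      have a2 : (fderiv ℝ g y e) ^ 2 ≤ B' ^ 2 := by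
        rw [← sq_abs]; exact pow_le_pow_left₀ (abs_nonneg _) b6 2
      have a3 := mul_le_mul_of_nonneg_left a1 hμ0.le
      have a4 : 0 ≤ μ * (g y - c0) ^ 2 := by positivity
      have a5 : 0 ≤ (fderiv ℝ g y e) ^ 2 := sq_nonneg _
      have a6 : 0 ≤ 4 * μ * B ^ 2 := by positivity
      have a7 : 0 ≤ B' ^ 2 := sq_nonneg _
      rw [hQ, abs_le]; constructor <;> linarith
    have q5 : Q * ux ≤ Q * uy + η * (4 * μ * B ^ 2 + B' ^ 2) * uy := by
      have : |Q * (ux - uy)| ≤ (4 * μ * B ^ 2 + B' ^ 2) * (η * uy) := by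
        rw [abs_mul]; exact mul_le_mul q4 b3 (abs_nonneg _) (by positivity)
      have := (abs_le.1 this).2
      linarith
    have hb := abs_le.1 b3
    have hlow : uy / 2 ≤ ux := by
      have := mul_le_mul_of_nonneg_right hη1 huy
      linarith
    have hup : ux ≤ 2 * uy := by
      have := mul_le_mul_of_nonneg_right hη1 huy
      linarith
    have fin : (μ * (g x - c0) ^ 2 - ‖fderiv ℝ g x‖ ^ 2 - c) * ux ≤ Q * uy + (η * C2 - c / 2) * uy := by
      have w1 := mul_le_mul_of_nonneg_right q3 hux
      have w2 : (η * (4 * μ * B + 2 * B')) * ux ≤ (η * (4 * μ * B + 2 * B')) * (2 * uy) :=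
        mul_le_mul_of_nonneg_left hup (by positivity)
      have w3 := mul_le_mul_of_nonneg_left hlow hcpos.le
      rw [hC2]
      linarith
    have := mul_le_mul_of_nonneg_left fin hh.le
    calc _ = h x * ((μ * (g x - c0) ^ 2 - ‖fderiv ℝ g x‖ ^ 2 - c) * ux) := by ring
      _ ≤ _ := this
      _ = _ := by ring
  rw [integral_add i5 (i6.const_mul _), integral_const_mul] at s2
  simp only [one_mul] at s2
  have : (η * C2 - c / 2) * ∫ x in K, h x * U (lproj a e x) ^ 2 < 0 := mul_neg_of_neg_of_pos (by linarith) hP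
  linarith

lemma hyperplane_null {k : ℕ} (L : EN k →L[ℝ] ℝ) (hL : L ≠ 0) (c : ℝ) : volume {x : EN k | L x = c} = 0 := by
  by_cases hne : ∃ x0, L x0 = c
  · obtain ⟨x0, hx0⟩ := hne
    have e : {x : EN k | L x = c} = (fun x => x + (-x0)) ⁻¹' (LinearMap.ker (L : EN k →ₗ[ℝ] ℝ) : Set (EN k)) := by
      ext x
      simp [sub_eq_zero, hx0, ← sub_eq_add_neg]
    rw [e, measure_preimage_add_right]
    apply Measure.addHaar_submodule
    intro h
    apply hL
    ext x
    have : x ∈ LinearMap.ker (L : EN k →ₗ[ℝ] ℝ) := h ▸ Submodule.mem_top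
    simpa using this
  · have : {x : EN k | L x = c} = ∅ := by
      ext x; simp; exact fun h => hne ⟨x, h⟩
    simp [this]

/-- the linear form used for cutting -/
def cutF {k : ℕ} (i j : Fin k) (q1 q2 θ : ℝ) (x : EN k) : ℝ := cos θ * (x i - q1) + sin θ * (x j - q2)

lemma cutF_cont {k : ℕ} (i j : Fin k) (q1 q2 θ : ℝ) : Continuous (cutF i j q1 q2 θ) := by
  unfold cutF; fun_prop

lemma cutF_pi {k : ℕ} (i j : Fin k) (q1 q2 θ : ℝ) (x : EN k) : cutF i j q1 q2 (θ + π) x = - cutF i j q1 q2 θ x := by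
  unfold cutF; rw [cos_add_pi, sin_add_pi]; ring

lemma cutF_null {k : ℕ} (i j : Fin k) (hij : i ≠ j) (q1 q2 θ : ℝ) : volume {x : EN k | cutF i j q1 q2 θ x = 0} = 0 := by
  set L : EN k →L[ℝ] ℝ := cos θ • (EuclideanSpace.proj i : EN k →L[ℝ] ℝ) + sin θ • (EuclideanSpace.proj j : EN k →L[ℝ] ℝ) with hL
  have hLx : ∀ x, L x = cos θ * x i + sin θ * x j := fun x => by simp [hL]
  have e : {x : EN k | cutF i j q1 q2 θ x = 0} = {x : EN k | L x = cos θ * q1 + sin θ * q2} := by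
    ext x
    simp only [mem_setOf_eq, hLx, cutF]
    constructor <;> intro h <;> linarith
  rw [e]
  apply hyperplane_null
  intro h0
  have h1 := hLx (EuclideanSpace.single i 1)
  have h2 := hLx (EuclideanSpace.single j 1)
  rw [h0] at h1 h2
  simp [hij, hij.symm] at h1 h2
  have := sin_sq_add_cos_sq θ
  rw [← h1, ← h2] at this
  norm_num at this

/-- good sets for the localization -/
structure LGood {k : ℕ} (f1 f2 : EN k → ℝ) (K : Set (EN k)) : Prop where
  comp : IsCompact K
  conv : Convex ℝ K
  vol : volume K ≠ 0
  i1 : IntegrableOn f1 K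
  i2 : IntegrableOn f2 K
  m1 : ∫ x in K, f1 x = 0
  m2 : 0 ≤ ∫ x in K, f2 x

lemma cut_split {k : ℕ} (i j : Fin k) (hij : i ≠ j) (q1 q2 θ : ℝ) (K : Set (EN k)) (f : EN k → ℝ) (hf : IntegrableOn f K) :
    (∫ x in K ∩ {x | 0 ≤ cutF i j q1 q2 θ x}, f x) + (∫ x in K ∩ {x | 0 ≤ cutF i j q1 q2 (θ + π) x}, f x) = ∫ x in K, f x := by
  have hm : MeasurableSet {x | 0 ≤ cutF i j q1 q2 θ x} :=
    measurableSet_le measurable_const (cutF_cont i j q1 q2 θ).measurable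
  rw [← integral_inter_add_diff hm hf]
  congr 1
  apply setIntegral_congr_set
  have h0 := cutF_null i j hij q1 q2 θ
  have h1 : ∀ᵐ x : EN k, x ∉ {x : EN k | cutF i j q1 q2 θ x = 0} := measure_eq_zero_iff_ae_notMem.1 h0
  filter_upwards [h1] with x hx
  apply propext
  change (x ∈ K ∧ 0 ≤ cutF i j q1 q2 (θ + π) x) ↔ (x ∈ K ∧ ¬ (0 ≤ cutF i j q1 q2 θ x))
  rw [cutF_pi]
  have hx' : cutF i j q1 q2 θ x ≠ 0 := hx
  constructor
  · rintro ⟨a, b⟩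
    exact ⟨a, fun c => hx' (by linarith)⟩
  · rintro ⟨a, b⟩
    exact ⟨a, by linarith⟩

lemma cut_cont {k : ℕ} (i j : Fin k) (hij : i ≠ j) (q1 q2 : ℝ) (K : Set (EN k)) (hK : MeasurableSet K) (f : EN k → ℝ) (hf : IntegrableOn f K) :
    Continuous fun θ => ∫ x in K ∩ {x | 0 ≤ cutF i j q1 q2 θ x}, f x := by
  have hm : ∀ θ, MeasurableSet {x | 0 ≤ cutF i j q1 q2 θ x} := fun θ =>
    measurableSet_le measurable_const (cutF_cont i j q1 q2 θ).measurable
  have e : (fun θ => ∫ x in K ∩ {x | 0 ≤ cutF i j q1 q2 θ x}, f x) =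
      fun θ => ∫ x in K, indicator {x | 0 ≤ cutF i j q1 q2 θ x} f x := by
    funext θ
    rw [setIntegral_indicator (hm θ)]
  rw [e, continuous_iff_continuousAt]
  intro θ0
  refine continuousAt_of_dominated (bound := fun x => ‖f x‖) ?_ ?_ hf.norm ?_
  · exact Eventually.of_forall fun θ => hf.aestronglyMeasurable.indicator (hm θ)
  · exact Eventually.of_forall fun θ => Eventually.of_forall fun x => norm_indicator_le_norm_self _ _
  · have h0 := cutF_null i j hij q1 q2 θ0
    have h1 : ∀ᵐ x : EN k, x ∉ {x : EN k | cutF i j q1 q2 θ0 x = 0} := measure_eq_zero_iff_ae_notMem.1 h0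
    filter_upwards [ae_restrict_of_ae h1] with x hx
    have hx' : cutF i j q1 q2 θ0 x ≠ 0 := hx
    have hc : Continuous fun θ => cutF i j q1 q2 θ x := by unfold cutF; fun_prop
    rcases lt_or_gt_of_ne hx' with h | h
    · have : ∀ᶠ θ in nhds θ0, cutF i j q1 q2 θ x < 0 := hc.continuousAt.eventually_lt continuousAt_const h
      refine (continuousAt_const (y := (0:ℝ))).congr ?_
      filter_upwards [this] with θ hθ
      rw [indicator_of_notMem]; simpa using hθ
    · have : ∀ᶠ θ in nhds θ0, 0 < cutF i j q1 q2 θ x := continuousAt_const.eventually_lt hc.continuousAt h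
      refine (continuousAt_const (y := f x)).congr ?_
      filter_upwards [this] with θ hθ
      rw [indicator_of_mem]; exact hθ.le

lemma cut_step {k : ℕ} (f1 f2 : EN k → ℝ) (K : Set (EN k)) (hK : LGood f1 f2 K) (i j : Fin k) (hij : i ≠ j) (q1 q2 : ℝ) :
    ∃ K', LGood f1 f2 K' ∧ K' ⊆ K ∧ ∃ θ, K' ⊆ {x | 0 ≤ cutF i j q1 q2 θ x} := by
  have key : ∀ θ, (∫ x in K ∩ {x | 0 ≤ cutF i j q1 q2 θ x}, f1 x) = 0 →
      0 ≤ (∫ x in K ∩ {x | 0 ≤ cutF i j q1 q2 θ x}, f2 x) → volume (K ∩ {x | 0 ≤ cutF i j q1 q2 θ x}) ≠ 0 →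
      LGood f1 f2 (K ∩ {x | 0 ≤ cutF i j q1 q2 θ x}) := by
    intro θ h1 h2 h3
    refine ⟨hK.comp.inter_right (isClosed_le continuous_const (cutF_cont i j q1 q2 θ)), hK.conv.inter ?_, h3,
      hK.i1.mono_set inter_subset_left, hK.i2.mono_set inter_subset_left, h1, h2⟩
    intro x hx y hy a b ha hb hab
    simp only [mem_setOf_eq, cutF] at hx hy ⊢
    have e : cos θ * ((a • x + b • y) i - q1) + sin θ * ((a • x + b • y) j - q2) =
        a * (cos θ * (x i - q1) + sin θ * (x j - q2)) + b * (cos θ * (y i - q1) + sin θ * (y j - q2)) := by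
      have ha' : a = 1 - b := by linarith
      simp only [PiLp.add_apply, PiLp.smul_apply, smul_eq_mul, ha']; ring
    rw [e]
    positivity
  have hc := cut_cont i j hij q1 q2 K hK.comp.measurableSet f1 hK.i1
  set Φ := fun θ => ∫ x in K ∩ {x | 0 ≤ cutF i j q1 q2 θ x}, f1 x with hΦ
  have hs : ∀ θ, Φ θ + Φ (θ + π) = 0 := fun θ => (cut_split i j hij q1 q2 θ K f1 hK.i1).trans hK.m1
  obtain ⟨θ, hθ⟩ : ∃ θ, Φ θ = 0 := by
    have h0 := hs 0
    rw [zero_add] at h0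
    rcases le_total (Φ 0) 0 with h | h
    · exact mem_range_of_exists_le_of_exists_ge hc ⟨0, h⟩ ⟨π, by linarith⟩
    · exact mem_range_of_exists_le_of_exists_ge hc ⟨π, by linarith⟩ ⟨0, h⟩
  have hθ' : Φ (θ + π) = 0 := by have := hs θ; linarith
  have hq := cut_split i j hij q1 q2 θ K f2 hK.i2
  have hm2 := hK.m2
  by_cases v1 : volume (K ∩ {x | 0 ≤ cutF i j q1 q2 θ x}) = 0
  · rw [setIntegral_measure_zero _ v1] at hq
    refine ⟨_, key (θ + π) hθ' (by linarith) ?_, inter_subset_left, _, inter_subset_right⟩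
    intro v2
    apply hK.vol
    refine measure_mono_null (t := (K ∩ {x | 0 ≤ cutF i j q1 q2 θ x}) ∪ (K ∩ {x | 0 ≤ cutF i j q1 q2 (θ + π) x})) ?_ (measure_union_null v1 v2)
    intro x hx
    rcases le_total 0 (cutF i j q1 q2 θ x) with h | h
    · exact Or.inl ⟨hx, h⟩
    · refine Or.inr ⟨hx, ?_⟩
      simp only [mem_setOf_eq, cutF_pi]; linarith
  by_cases v2 : volume (K ∩ {x | 0 ≤ cutF i j q1 q2 (θ + π) x}) = 0
  · rw [setIntegral_measure_zero _ v2] at hq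
    exact ⟨_, key θ hθ (by linarith) v1, inter_subset_left, _, inter_subset_right⟩
  rcases le_total 0 (∫ x in K ∩ {x | 0 ≤ cutF i j q1 q2 θ x}, f2 x) with h | h
  · exact ⟨_, key θ hθ h v1, inter_subset_left, _, inter_subset_right⟩
  · exact ⟨_, key (θ + π) hθ' (by linarith) v2, inter_subset_left, _, inter_subset_right⟩

/-- a rational point strictly inside a non-degenerate planar triangle -/
lemma rat_in_triangle (X1 X2 u1 u2 v1 v2 : ℝ) (hdet : u1 * v2 - u2 * v1 ≠ 0) :
    ∃ q1 q2 : ℚ, ∃ b c : ℝ, 0 < b ∧ 0 < c ∧ b + c < 1 ∧ X1 + b * u1 + c * v1 = q1 ∧ X2 + b * u2 + c * v2 = q2 := by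
  set dt := u1 * v2 - u2 * v1 with hdt
  set β : ℝ × ℝ → ℝ := fun q => ((q.1 - X1) * v2 - (q.2 - X2) * v1) / dt with hβ
  set γ : ℝ × ℝ → ℝ := fun q => (u1 * (q.2 - X2) - u2 * (q.1 - X1)) / dt with hγ
  have cβ : Continuous β := by fun_prop
  have cγ : Continuous γ := by fun_prop
  have ho : IsOpen {q : ℝ × ℝ | 0 < β q ∧ 0 < γ q ∧ β q + γ q < 1} :=
    (isOpen_lt continuous_const cβ).inter ((isOpen_lt continuous_const cγ).inter (isOpen_lt (cβ.add cγ) continuous_const))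
  have hne : ({q : ℝ × ℝ | 0 < β q ∧ 0 < γ q ∧ β q + γ q < 1}).Nonempty := by
    refine ⟨(X1 + (1/3) * u1 + (1/3) * v1, X2 + (1/3) * u2 + (1/3) * v2), ?_⟩
    have e1 : β (X1 + (1/3) * u1 + (1/3) * v1, X2 + (1/3) * u2 + (1/3) * v2) = 1/3 := by
      simp only [hβ]; rw [div_eq_iff hdet, hdt]; ring
    have e2 : γ (X1 + (1/3) * u1 + (1/3) * v1, X2 + (1/3) * u2 + (1/3) * v2) = 1/3 := by
      simp only [hγ]; rw [div_eq_iff hdet, hdt]; ring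
    simp only [mem_setOf_eq, e1, e2]; norm_num
  have hd : DenseRange (Prod.map (fun q : ℚ => (q : ℝ)) (fun q : ℚ => (q : ℝ))) :=
    (Rat.denseRange_cast (𝕜 := ℝ)).prodMap (Rat.denseRange_cast (𝕜 := ℝ))
  obtain ⟨⟨q1, q2⟩, hq1, hq2, hq3⟩ := hd.exists_mem_open ho hne
  refine ⟨q1, q2, _, _, hq1, hq2, hq3, ?_, ?_⟩
  · simp only [hβ, hγ, Prod.map]; field_simp; rw [hdt]; ring
  · simp only [hβ, hγ, Prod.map]; field_simp; rw [hdt]; ring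

theorem localization {n : ℕ} (f1 f2 : EN (n+1) → ℝ) (K0 : Set (EN (n+1))) (h0 : LGood f1 f2 K0) :
    ∃ K : ℕ → Set (EN (n+1)), Antitone K ∧ (∀ i, K i ⊆ K0) ∧ (∀ i, LGood f1 f2 (K i)) ∧
      ∀ x ∈ ⋂ i, K i, ∀ y ∈ ⋂ i, K i, ∀ z ∈ ⋂ i, K i, ∀ i j,
        (y i - x i) * (z j - x j) - (y j - x j) * (z i - x i) = 0 := by
  obtain ⟨enum, henum⟩ := exists_surjective_nat (Fin (n+1) × Fin (n+1) × ℚ × ℚ)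
  have hstep : ∀ (K : {K // LGood f1 f2 K}) (t : Fin (n+1) × Fin (n+1) × ℚ × ℚ), ∃ K' : {K // LGood f1 f2 K},
      K'.1 ⊆ K.1 ∧ (t.1 ≠ t.2.1 → ∃ θ, K'.1 ⊆ {x | 0 ≤ cutF t.1 t.2.1 t.2.2.1 t.2.2.2 θ x}) := by
    rintro ⟨K, hK⟩ ⟨i, j, q1, q2⟩
    by_cases hij : i = j
    · exact ⟨⟨K, hK⟩, subset_rfl, fun h => absurd hij h⟩
    · obtain ⟨K', h1, h2, h3⟩ := cut_step f1 f2 K hK i j hij q1 q2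
      exact ⟨⟨K', h1⟩, h2, fun _ => h3⟩
  choose step hs1 hs2 using hstep
  let S : ℕ → {K // LGood f1 f2 K} := fun m => Nat.rec ⟨K0, h0⟩ (fun m K => step K (enum m)) m
  have hS : ∀ m, S (m+1) = step (S m) (enum m) := fun m => rfl
  have hanti : Antitone (fun m => (S m).1) := antitone_nat_of_succ_le fun m => by
    rw [hS]; exact hs1 _ _
  refine ⟨fun m => (S m).1, hanti, fun i => hanti (Nat.zero_le i), fun i => (S i).2, ?_⟩
  intro x hx y hy z hz i j
  by_contra hdet
  have hij : i ≠ j := by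
    rintro rfl; exact hdet (by ring)
  obtain ⟨q1, q2, b, c, hb, hc, hbc, e1, e2⟩ := rat_in_triangle (x i) (x j) (y i - x i) (y j - x j) (z i - x i) (z j - x j) hdet
  obtain ⟨m, hm⟩ := henum (i, j, q1, q2)
  obtain ⟨θ, hθ⟩ := hs2 (S m) (enum m) (by rw [hm]; exact hij)
  rw [← hS, hm] at hθ
  have tx : 0 ≤ cutF i j q1 q2 θ x := hθ (mem_iInter.1 hx (m+1))
  have ty : 0 ≤ cutF i j q1 q2 θ y := hθ (mem_iInter.1 hy (m+1))
  have tz : 0 ≤ cutF i j q1 q2 θ z := hθ (mem_iInter.1 hz (m+1))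
  have hsum : (1 - b - c) * cutF i j q1 q2 θ x + b * cutF i j q1 q2 θ y + c * cutF i j q1 q2 θ z = 0 := by
    unfold cutF; rw [← e1, ← e2]; ring
  have p1 := mul_nonneg (show 0 ≤ 1 - b - c by linarith) tx
  have p2 := mul_nonneg hb.le ty
  have p3 := mul_nonneg hc.le tz
  have zx : cutF i j q1 q2 θ x = 0 := by
    have : (1 - b - c) * cutF i j q1 q2 θ x = 0 := by linarith
    exact (mul_eq_zero.1 this).resolve_left (by linarith)
  have zy : cutF i j q1 q2 θ y = 0 := by
    have : b * cutF i j q1 q2 θ y = 0 := by linarith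
    exact (mul_eq_zero.1 this).resolve_left hb.ne'
  have zz : cutF i j q1 q2 θ z = 0 := by
    have : c * cutF i j q1 q2 θ z = 0 := by linarith
    exact (mul_eq_zero.1 this).resolve_left hc.ne'
  have d1 : cos θ * (y i - x i) + sin θ * (y j - x j) = 0 := by
    unfold cutF at zx zy; linarith
  have d2 : cos θ * (z i - x i) + sin θ * (z j - x j) = 0 := by
    unfold cutF at zx zz; linarith
  have c0 : cos θ * ((y i - x i) * (z j - x j) - (y j - x j) * (z i - x i)) = 0 := by linear_combination (z j - x j) * d1 - (y j - x j) * d2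
  have s0 : sin θ * ((y i - x i) * (z j - x j) - (y j - x j) * (z i - x i)) = 0 := by linear_combination (y i - x i) * d2 - (z i - x i) * d1
  have c0' := (mul_eq_zero.1 c0).resolve_right hdet
  have s0' := (mul_eq_zero.1 s0).resolve_right hdet
  have := sin_sq_add_cos_sq θ
  rw [c0', s0'] at this
  norm_num at this

/-- the limit set lies on a line -/
lemma line_of_det {n : ℕ} (S : Set (EN (n+1))) (hS : S.Nonempty)
    (h : ∀ x ∈ S, ∀ y ∈ S, ∀ z ∈ S, ∀ i j, (y i - x i) * (z j - x j) - (y j - x j) * (z i - x i) = 0) :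
    ∃ a ∈ S, ∃ e : EN (n+1), ‖e‖ = 1 ∧ ∀ x ∈ S, lproj a e x = x := by
  obtain ⟨a, ha⟩ := hS
  by_cases hb : ∃ b ∈ S, b ≠ a
  · obtain ⟨b, hb, hba⟩ := hb
    have hu : b - a ≠ 0 := sub_ne_zero.2 hba
    have hn : ‖b - a‖ ≠ 0 := norm_ne_zero_iff.2 hu
    refine ⟨a, ha, (‖b - a‖)⁻¹ • (b - a), ?_, fun x hx => ?_⟩
    · rw [norm_smul, norm_inv, norm_norm, inv_mul_cancel₀ hn]
    · have key : ‖b - a‖ ^ 2 • (x - a) = ⟪x - a, b - a⟫ • (b - a) := by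
        ext j
        rw [← real_inner_self_eq_norm_sq]
        simp only [PiLp.smul_apply, smul_eq_mul, PiLp.inner_apply, Finset.sum_mul, RCLike.inner_apply, conj_trivial, PiLp.sub_apply]
        refine Finset.sum_congr rfl fun i _ => ?_
        have := h a ha b hb x hx i j
        linear_combination (b i - a i) * this
      unfold lproj
      rw [inner_smul_right, smul_smul]
      have : (‖b - a‖⁻¹ * ⟪x - a, b - a⟫ * ‖b - a‖⁻¹) • (b - a) = x - a := by
        rw [show ‖b - a‖⁻¹ * ⟪x - a, b - a⟫ * ‖b - a‖⁻¹ = (‖b - a‖ ^ 2)⁻¹ * ⟪x - a, b - a⟫ by rw [sq, mul_inv]; ring,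
          ← smul_smul, ← key, smul_smul, inv_mul_cancel₀ (pow_ne_zero 2 hn), one_smul]
      rw [this]; abel
  · push Not at hb
    refine ⟨a, ha, EuclideanSpace.single 0 1, by simp, fun x hx => ?_⟩
    rw [hb x hx]; simp [lproj]

theorem no_violation {n : ℕ} {W : Set (EN (n+1))} {h U : EN (n+1) → ℝ} {M D d μ : ℝ} (H : ND n W h U M D d μ)
    (K0 : Set (EN (n+1))) (hK : IsCompact K0) (hKc : Convex ℝ K0) (hKW : K0 ⊆ W) (hKv : volume K0 ≠ 0)
    (g : EN (n+1) → ℝ) (hg : ContDiff ℝ 1 g) (B B' : ℝ) (hB : ∀ x, |g x| ≤ B) (hB' : ∀ x, ‖fderiv ℝ g x‖ ≤ B')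
    (c : ℝ) (hc : 0 < c)
    (hmean : ∫ x in K0, g x * (h x * U x ^ 2) = 0)
    (hquad : 0 ≤ ∫ x in K0, (μ * g x ^ 2 - ‖fderiv ℝ g x‖ ^ 2 - c) * (h x * U x ^ 2)) : False := by
  have hUc := H.Uc
  have hhc := H.hc.mono hKW
  have hgc : Continuous g := hg.continuous
  have hfc : Continuous (fderiv ℝ g) := hg.continuous_fderiv (by norm_num)
  have iC : ∀ f : EN (n+1) → ℝ, Continuous f → IntegrableOn (fun x => f x * (h x * U x ^ 2)) K0 := fun f hf =>
    (hf.continuousOn.mul (hhc.mul (hUc.pow 2).continuousOn)).integrableOn_compact hK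
  obtain ⟨K, hanti, hsub, hgood, hdet⟩ := localization (fun x => g x * (h x * U x ^ 2))
    (fun x => (μ * g x ^ 2 - ‖fderiv ℝ g x‖ ^ 2 - c) * (h x * U x ^ 2)) K0
    ⟨hK, hKc, hKv, iC g hgc, iC (fun x => μ * g x ^ 2 - ‖fderiv ℝ g x‖ ^ 2 - c) (by fun_prop), hmean, hquad⟩
  set S := ⋂ i, K i with hS
  have hne : ∀ i, (K i).Nonempty := fun i => by
    by_contra hc
    rw [not_nonempty_iff_eq_empty] at hc
    exact (hgood i).vol (by rw [hc]; simp)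
  have hdir : Directed (fun x1 x2 => x1 ⊇ x2) K := hanti.directed_ge
  have hSne : S.Nonempty := IsCompact.nonempty_iInter_of_directed_nonempty_isCompact_isClosed K hdir hne
    (fun i => (hgood i).comp) (fun i => (hgood i).comp.isClosed)
  obtain ⟨a, haS, e, he, hline⟩ := line_of_det S hSne hdet
  have hSK : S ⊆ K0 := (iInter_subset K 0).trans (hsub 0)
  have hScomp : IsCompact S := (hgood 0).comp.of_isClosed_subset (isClosed_iInter fun i => (hgood i).comp.isClosed) (iInter_subset K 0)
  obtain ⟨δ0, hδ0, hTW⟩ := hScomp.exists_cthickening_subset_open H.Wo (hSK.trans hKW)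
  set T := Metric.cthickening δ0 S with hT
  have hTc : IsCompact T := hScomp.cthickening
  have hST : S ⊆ T := Metric.self_subset_cthickening S
  -- lower bound of U^2 on T
  obtain ⟨x0, hx0, hmin⟩ := hTc.exists_isMinOn (hSne.mono hST) (f := fun x => U x ^ 2) (by fun_prop)
  set u0 := U x0 ^ 2 with hu0
  have hu0p : 0 < u0 := pow_pos (H.Up _ (hTW hx0)) 2
  have hminT : ∀ x ∈ T, u0 ≤ U x ^ 2 := fun x hx => hmin hx
  have hB0 : 0 ≤ B := (abs_nonneg _).trans (hB 0)
  have hB'0 : 0 ≤ B' := (norm_nonneg _).trans (hB' 0)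
  have hμ0 := H.hμ0
  set C2 := 2 * (4 * μ * B + 2 * B') + (4 * μ * B ^ 2 + B' ^ 2) with hC2
  have hC20 : 0 ≤ C2 := by positivity
  set η := min (1/2) (c / (4 * (C2 + 1))) with hη
  have hη0 : 0 < η := lt_min (by norm_num) (by positivity)
  have hηc : η * C2 < c / 2 := by
    have h1 : η * (C2 + 1) ≤ c / (4 * (C2 + 1)) * (C2 + 1) := mul_le_mul_of_nonneg_right (min_le_right _ _) (by linarith)
    have h2 : c / (4 * (C2 + 1)) * (C2 + 1) = c / 4 := by
      have : C2 + 1 ≠ 0 := by linarith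
      field_simp
    linarith
  -- uniform continuity
  have ug := Metric.uniformContinuousOn_iff.1 (hTc.uniformContinuousOn_of_continuous hgc.continuousOn) η hη0
  have uf := Metric.uniformContinuousOn_iff.1 (hTc.uniformContinuousOn_of_continuous hfc.continuousOn) η hη0
  have uU := Metric.uniformContinuousOn_iff.1 (hTc.uniformContinuousOn_of_continuous (hUc.pow 2).continuousOn) (η * u0) (by positivity)
  obtain ⟨δ1, hδ1, ug⟩ := ug
  obtain ⟨δ2, hδ2, uf⟩ := uf
  obtain ⟨δ3, hδ3, uU⟩ := uU
  set ε := min δ0 (min δ1 (min δ2 δ3)) / 3 with hε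
  have hmp : 0 < min δ0 (min δ1 (min δ2 δ3)) := lt_min hδ0 (lt_min hδ1 (lt_min hδ2 hδ3))
  have hεp : 0 < ε := by positivity
  have hε0 : 3 * ε ≤ δ0 := by
    have := min_le_left δ0 (min δ1 (min δ2 δ3)); rw [hε]; linarith
  have hε1 : 3 * ε ≤ δ1 := by
    have := (min_le_right δ0 (min δ1 (min δ2 δ3))).trans (min_le_left _ _); rw [hε]; linarith
  have hε2 : 3 * ε ≤ δ2 := by
    have := (min_le_right δ0 (min δ1 (min δ2 δ3))).trans ((min_le_right _ _).trans (min_le_left _ _)); rw [hε]; linarith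
  have hε3 : 3 * ε ≤ δ3 := by
    have := (min_le_right δ0 (min δ1 (min δ2 δ3))).trans ((min_le_right _ _).trans (min_le_right _ _)); rw [hε]; linarith
  obtain ⟨i, hi⟩ := exists_subset_nhds_of_isCompact hdir (fun i => (hgood i).comp) (U := Metric.thickening ε S)
    (fun x hx => Metric.isOpen_thickening.mem_nhds (Metric.self_subset_thickening hεp S hx))
  have hpt : ∀ x ∈ K i, x ∈ T ∧ lproj a e x ∈ T ∧ dist x (lproj a e x) < 3 * ε := by
    intro x hx
    obtain ⟨y, hy, hxy⟩ := Metric.mem_thickening_iff.1 (hi hx)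
    have hyl := hline y hy
    have e1 : lproj a e x - y = ⟪x - y, e⟫ • e := by
      conv_lhs => rw [← hyl]
      unfold lproj
      rw [show ⟪x - y, e⟫ = ⟪x - a, e⟫ - ⟪y - a, e⟫ by rw [← inner_sub_left, sub_sub_sub_cancel_right]]; module
    have d1 : dist (lproj a e x) y < ε := by
      rw [dist_eq_norm, e1, norm_smul, he, mul_one, Real.norm_eq_abs]
      refine lt_of_le_of_lt (abs_real_inner_le_norm _ _) ?_
      rwa [he, mul_one, ← dist_eq_norm]
    refine ⟨Metric.mem_cthickening_of_dist_le x y δ0 S hy (by linarith), Metric.mem_cthickening_of_dist_le _ y δ0 S hy (by linarith), ?_⟩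
    have := dist_triangle_right x (lproj a e x) y
    linarith
  refine thin_needle H (K i) (hgood i).comp (hgood i).conv ((hsub i).trans hKW) (hgood i).vol a e he
    (fun x hx => hTW (hpt x hx).2.1) g hg B B' hB hB' η c hη0.le (min_le_left _ _) ?_ ?_ ?_ (hgood i).m1 (hgood i).m2 hηc
  · intro x hx
    obtain ⟨h1, h2, h3⟩ := hpt x hx
    have := ug x h1 _ h2 (by linarith)
    rw [Real.dist_eq] at this; exact this.le
  · intro x hx
    obtain ⟨h1, h2, h3⟩ := hpt x hx
    have := uf x h1 _ h2 (by linarith)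
    rw [dist_eq_norm] at this; exact this.le
  · intro x hx
    obtain ⟨h1, h2, h3⟩ := hpt x hx
    have := uU x h1 _ h2 (by linarith)
    rw [Real.dist_eq] at this
    exact this.le.trans (mul_le_mul_of_nonneg_left (hminT _ h2) hη0.le)

/-- inner parallel set -/
def Kr {k : ℕ} (W : Set (EN k)) (r : ℝ) : Set (EN k) := {x | Metric.ball x r ⊆ W}

lemma Kr_sub {k : ℕ} (W : Set (EN k)) (r : ℝ) (hr : 0 < r) : Kr W r ⊆ W := fun x hx => hx (Metric.mem_ball_self hr)

lemma Kr_closed {k : ℕ} (W : Set (EN k)) (r : ℝ) : IsClosed (Kr W r) := by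
  apply isClosed_of_closure_subset
  intro x hx z hz
  rw [Metric.mem_ball] at hz
  obtain ⟨y, hy, hxy⟩ := Metric.mem_closure_iff.1 hx (r - dist z x) (by linarith)
  apply hy
  rw [Metric.mem_ball]
  have := dist_triangle z x y
  linarith

lemma Kr_compact {k : ℕ} (W : Set (EN k)) (hb : IsBounded W) (r : ℝ) (hr : 0 < r) : IsCompact (Kr W r) :=
  Metric.isCompact_of_isClosed_isBounded (Kr_closed W r) (hb.subset (Kr_sub W r hr))

lemma Kr_convex {k : ℕ} (W : Set (EN k)) (hc : Convex ℝ W) (r : ℝ) : Convex ℝ (Kr W r) := by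
  intro x hx y hy a b ha hb hab z hz
  set v := z - (a • x + b • y) with hv
  have hvn : ‖v‖ < r := by rwa [Metric.mem_ball, dist_eq_norm] at hz
  have h1 : x + v ∈ W := hx (by rw [Metric.mem_ball, dist_eq_norm]; simpa using hvn)
  have h2 : y + v ∈ W := hy (by rw [Metric.mem_ball, dist_eq_norm]; simpa using hvn)
  have : z = a • (x + v) + b • (y + v) := by
    have e : a • (x + v) + b • (y + v) = (a • x + b • y) + (a + b) • v := by module
    rw [e, hab, one_smul, hv]; abel
  rw [this]
  exact hc h1 h2 ha hb hab

lemma Kr_mono {k : ℕ} (W : Set (EN k)) {r s : ℝ} (h : r ≤ s) : Kr W s ⊆ Kr W r := fun _ hx => (Metric.ball_subset_ball h).trans hx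

lemma Kr_near {k : ℕ} (W : Set (EN k)) (r s : ℝ) (x y : EN k) (hx : x ∈ Kr W r) (hxy : dist y x + s ≤ r) : y ∈ Kr W s := by
  refine (Metric.ball_subset_ball' ?_).trans hx
  linarith

/-- derivative of the mollification -/
lemma moll_deriv {k : ℕ} (ρ : EN k → ℝ) (hρ : ContDiff ℝ 1 ρ) (hρc : HasCompactSupport ρ) (K1 : Set (EN k)) (hK1 : IsCompact K1)
    (g : EN k → ℝ) (hgd : ∀ x ∈ K1, DifferentiableAt ℝ g x) (hgi : IntegrableOn (fun x => ‖fderiv ℝ g x‖) K1)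
    (x : EN k) (hx : ∀ t ∈ tsupport ρ, x - t ∈ K1) :
    (Integrable fun t => ρ t * ‖fderiv ℝ g (x - t)‖) ∧ (∀ t, 0 ≤ ρ t) → 
    ‖fderiv ℝ (convolution ρ (K1.indicator g) (ContinuousLinearMap.lsmul ℝ ℝ) volume) x‖ ≤ ∫ t, ρ t * ‖fderiv ℝ g (x - t)‖ := by
  rintro ⟨hintg, hpos⟩
  have hgc : ContinuousOn g K1 := fun y hy => (hgd y hy).continuousAt.continuousWithinAt
  have hGi : Integrable (K1.indicator g) := (integrable_indicator_iff hK1.measurableSet).2 (hgc.integrableOn_compact hK1)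
  have hD := HasCompactSupport.hasFDerivAt_convolution_left (ContinuousLinearMap.lsmul ℝ ℝ : ℝ →L[ℝ] ℝ →L[ℝ] ℝ) (μ := volume) hρc hρ hGi.locallyIntegrable x
  rw [hD.fderiv]
  have hρc1 : Continuous (fderiv ℝ ρ) := hρ.continuous_fderiv (by norm_num)
  have hsupp : ∀ t, fderiv ℝ ρ t ≠ 0 → x - t ∈ K1 := fun t ht => hx t (by
    by_contra hc
    exact ht (by
      have := (support_fderiv_subset ℝ (f := ρ))
      by_contra hne
      exact hc (this hne)))
  -- integrability of the derivative convolution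
  have hCE : Integrable (fun t => (ContinuousLinearMap.precompL (EN k) (ContinuousLinearMap.lsmul ℝ ℝ : ℝ →L[ℝ] ℝ →L[ℝ] ℝ)) (fderiv ℝ ρ t) (K1.indicator g (x - t))) :=
    HasCompactSupport.convolutionExists_left _ (hρc.fderiv ℝ) hρc1 hGi.locallyIntegrable x
  have happ : ∀ v, (convolution (fderiv ℝ ρ) (K1.indicator g) (ContinuousLinearMap.precompL (EN k) (ContinuousLinearMap.lsmul ℝ ℝ : ℝ →L[ℝ] ℝ →L[ℝ] ℝ)) volume x) v =
      ∫ t, fderiv ℝ ρ t v * g (x - t) := by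
    intro v
    unfold convolution
    rw [ContinuousLinearMap.integral_apply hCE]
    refine integral_congr_ae (Eventually.of_forall fun t => ?_)
    simp only [ContinuousLinearMap.precompL_apply, ContinuousLinearMap.lsmul_apply, smul_eq_mul]
    by_cases h0 : fderiv ℝ ρ t = 0
    · simp [h0]
    · rw [indicator_of_mem (hsupp t h0)]
  have hgx : ∀ t ∈ tsupport ρ, HasFDerivAt (fun t => g (x - t)) (-(fderiv ℝ g (x - t))) t := by
    intro t ht
    have h1 : HasFDerivAt (fun t : EN k => x - t) (-(ContinuousLinearMap.id ℝ (EN k))) t := (hasFDerivAt_id t).const_sub x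
    have h2 := (hgd _ (hx t ht)).hasFDerivAt.comp t h1
    refine h2.congr_fderiv ?_
    ext v; simp
  have hvi : ∀ v, Integrable fun t => ρ t * fderiv ℝ g (x - t) v := by
    intro v
    refine (hintg.mul_const ‖v‖).mono' ?_ (Eventually.of_forall fun t => ?_)
    · have : Measurable fun t => fderiv ℝ g (x - t) v :=
        (measurable_fderiv_apply_const ℝ g v).comp (measurable_const.sub measurable_id)
      exact (hρ.continuous.measurable.mul this).aestronglyMeasurable
    · rw [norm_mul, Real.norm_eq_abs, abs_of_nonneg (hpos t), mul_assoc]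
      exact mul_le_mul_of_nonneg_left ((fderiv ℝ g (x - t)).le_opNorm v) (hpos t)
  have hparts : ∀ v, ∫ t, fderiv ℝ ρ t v * g (x - t) = ∫ t, ρ t * fderiv ℝ g (x - t) v := by
    intro v
    have e1 : ∀ t, ρ t * fderiv ℝ (fun t => g (x - t)) t v = -(ρ t * fderiv ℝ g (x - t) v) := by
      intro t
      by_cases ht : t ∈ tsupport ρ
      · rw [(hgx t ht).fderiv]; simp
      · rw [image_eq_zero_of_notMem_tsupport ht]; simp
    have h3 := integral_mul_fderiv_eq_neg_fderiv_mul_of_integrable (μ := volume) (f := ρ) (g := fun t => g (x - t)) (v := v) ?_ ?_ ?_ ?_ ?_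
    · simp only [e1] at h3
      rw [integral_neg] at h3
      linarith
    · have := hCE.apply_continuousLinearMap v
      refine this.congr (Eventually.of_forall fun t => ?_)
      simp only [ContinuousLinearMap.precompL_apply, ContinuousLinearMap.lsmul_apply, smul_eq_mul]
      by_cases h0 : fderiv ℝ ρ t = 0
      · simp [h0]
      · rw [indicator_of_mem (hsupp t h0)]
    · simp only [e1]; exact (hvi v).neg
    · have : Integrable (fun t => (ContinuousLinearMap.lsmul ℝ ℝ : ℝ →L[ℝ] ℝ →L[ℝ] ℝ) (ρ t) (K1.indicator g (x - t))) :=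
        HasCompactSupport.convolutionExists_left _ hρc hρ.continuous hGi.locallyIntegrable x
      refine this.congr (Eventually.of_forall fun t => ?_)
      simp only [ContinuousLinearMap.lsmul_apply, smul_eq_mul]
      by_cases h0 : ρ t = 0
      · simp [h0]
      · rw [indicator_of_mem (hx t (subset_tsupport _ h0))]
    · intro t _; exact hρ.differentiable (by norm_num) t
    · intro t ht; exact (hgx t ht).differentiableAt
  refine ContinuousLinearMap.opNorm_le_bound _ (integral_nonneg fun t => mul_nonneg (hpos t) (norm_nonneg _)) fun v => ?_
  rw [happ, hparts, ← integral_mul_const]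
  refine (norm_integral_le_integral_norm _).trans ?_
  refine integral_mono (hvi v).norm (hintg.mul_const _) fun t => ?_
  simp only [norm_mul]
  rw [Real.norm_eq_abs, abs_of_nonneg (hpos t), mul_assoc]
  exact mul_le_mul_of_nonneg_left ((fderiv ℝ g (x - t)).le_opNorm v) (hpos t)

lemma jensen_sq {α : Type*} [MeasurableSpace α] (m : Measure α) (ρ f : α → ℝ) (hρ : ∀ t, 0 ≤ ρ t) (hi : Integrable ρ m) (h1 : ∫ t, ρ t ∂m = 1)
    (hf : Integrable (fun t => ρ t * f t) m) (hf2 : Integrable (fun t => ρ t * f t ^ 2) m) :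
    (∫ t, ρ t * f t ∂m) ^ 2 ≤ ∫ t, ρ t * f t ^ 2 ∂m := by
  set c := ∫ t, ρ t * f t ∂m with hc
  have h0 : 0 ≤ ∫ t, ρ t * (f t - c) ^ 2 ∂m := integral_nonneg fun t => mul_nonneg (hρ t) (sq_nonneg _)
  have e : ∀ t, ρ t * (f t - c) ^ 2 = ρ t * f t ^ 2 - (2 * c) * (ρ t * f t) + c ^ 2 * ρ t := fun t => by ring
  simp only [e] at h0
  rw [integral_add (by exact hf2.sub (hf.const_mul _)) (hi.const_mul _), integral_sub hf2 (hf.const_mul _), integral_const_mul, integral_const_mul, h1, ← hc] at h0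
  linarith

set_option maxHeartbeats 1000000 in
lemma mollify {k : ℕ} (W : Set (EN k)) (hWo : IsOpen W) (hWb : IsBounded W) (r : ℝ) (hr : 0 < r) (p g : EN k → ℝ)
    (hpc : ContinuousOn p W) (hp : ∀ x ∈ W, 0 < p x) (hg : ∀ x ∈ W, DifferentiableAt ℝ g x)
    (hfin : (∫⁻ x in W, ENNReal.ofReal (‖fderiv ℝ g x‖ ^ 2 * p x)) ≠ ∞) (η : ℝ) (hη : 0 < η) :
    ∃ f : EN k → ℝ, ContDiff ℝ 1 f ∧ (∃ B, ∀ x, |f x| ≤ B) ∧ (∃ B', ∀ x, ‖fderiv ℝ f x‖ ≤ B') ∧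
      (∀ x ∈ Kr W r, |f x - g x| ≤ η) ∧
      (∫⁻ x in Kr W r, ENNReal.ofReal (‖fderiv ℝ f x‖ ^ 2 * p x)) ≤
        ENNReal.ofReal (1 + η) * ∫⁻ x in W, ENNReal.ofReal (‖fderiv ℝ g x‖ ^ 2 * p x) := by
  set K1 := Kr W (r / 2) with hK1d
  have hK1 : IsCompact K1 := Kr_compact W hWb _ (by linarith)
  have hK1W : K1 ⊆ W := Kr_sub W _ (by linarith)
  have hgc : ContinuousOn g K1 := fun y hy => (hg y (hK1W hy)).continuousAt.continuousWithinAt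
  have hlc : ContinuousOn (fun x => Real.log (p x)) K1 := (hpc.mono hK1W).log fun x hx => (hp x (hK1W hx)).ne'
  have hlog : 0 < Real.log (1 + η) := Real.log_pos (by linarith)
  obtain ⟨δ1, hδ1, H1⟩ := Metric.uniformContinuousOn_iff.1 (hK1.uniformContinuousOn_of_continuous hlc) _ hlog
  obtain ⟨δ2, hδ2, H2⟩ := Metric.uniformContinuousOn_iff.1 (hK1.uniformContinuousOn_of_continuous hgc) _ hη
  obtain ⟨C, hC⟩ := hK1.exists_bound_of_continuousOn ((hpc.mono hK1W).inv₀ fun x hx => (hp x (hK1W hx)).ne')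
  set ε := min (min δ1 δ2) (r / 2) / 2 with hε
  have hε0 : 0 < ε := by have : 0 < min (min δ1 δ2) (r / 2) := lt_min (lt_min hδ1 hδ2) (by linarith)
                         linarith
  have hm0 : 0 < min (min δ1 δ2) (r / 2) := by linarith
  have hε1 : ε < δ1 := by have := (min_le_left (min δ1 δ2) (r / 2)).trans (min_le_left _ _); linarith
  have hε2 : ε < δ2 := by have := (min_le_left (min δ1 δ2) (r / 2)).trans (min_le_right _ _); linarith
  have hε3 : ε < r / 2 := by have := (min_le_right (min δ1 δ2) (r / 2)); linarith
  let φ : ContDiffBump (0 : EN k) := ⟨ε / 2, ε, by linarith, by linarith⟩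
  have hφr : φ.rOut = ε := rfl
  set ρ : EN k → ℝ := φ.normed volume with hρd
  have hρs : ContDiff ℝ 1 ρ := φ.contDiff_normed (n := 1)
  have hρc : HasCompactSupport ρ := φ.hasCompactSupport_normed
  have hρ0 : ∀ t, 0 ≤ ρ t := fun t => φ.nonneg_normed t
  have hρ1 : ∫ t, ρ t = 1 := φ.integral_normed
  have hρt : tsupport ρ = Metric.closedBall 0 ε := φ.tsupport_normed_eq
  have hρi : Integrable ρ := hρs.continuous.integrable_of_hasCompactSupport hρc
  have hGi : Integrable (K1.indicator g) := (integrable_indicator_iff hK1.measurableSet).2 (hgc.integrableOn_compact hK1)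
  have hGs : HasCompactSupport (K1.indicator g) := HasCompactSupport.intro hK1 fun x hx => indicator_of_notMem hx g
  set f := convolution ρ (K1.indicator g) (ContinuousLinearMap.lsmul ℝ ℝ) volume with hf
  have hfC : ContDiff ℝ 1 f := hρc.contDiff_convolution_left (n := 1) _ hρs hGi.locallyIntegrable
  have hfS : HasCompactSupport f := HasCompactSupport.convolution _ hρc hGs
  have hnear : ∀ x ∈ Kr W r, ∀ y, dist y x ≤ ε → y ∈ K1 := fun x hx y hy => Kr_near W r (r / 2) x y hx (by linarith)
  have hKK1 : Kr W r ⊆ K1 := Kr_mono W (by linarith)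
  -- integrability
  have hmd : Measurable fun x => ‖fderiv ℝ g x‖ := (measurable_fderiv ℝ g).norm
  have hi2 : IntegrableOn (fun x => ‖fderiv ℝ g x‖ ^ 2) K1 := by
    have h1 : (∫⁻ x in K1, ENNReal.ofReal (‖fderiv ℝ g x‖ ^ 2)) ≤ ENNReal.ofReal C * ∫⁻ x in W, ENNReal.ofReal (‖fderiv ℝ g x‖ ^ 2 * p x) := by
      rw [← lintegral_const_mul' _ _ ENNReal.ofReal_ne_top]
      refine le_trans ?_ (lintegral_mono_set hK1W)
      refine setLIntegral_mono' hK1.measurableSet fun x hx => ?_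
      have hpx := hp x (hK1W hx)
      have hCx := hC x hx
      rw [Real.norm_eq_abs, Pi.inv_apply, abs_of_pos (inv_pos.2 hpx)] at hCx
      have hC0 : 0 ≤ C := le_trans (inv_pos.2 hpx).le hCx
      rw [← ENNReal.ofReal_mul hC0]
      refine ENNReal.ofReal_le_ofReal ?_
      have : 1 ≤ C * p x := by
        have := mul_le_mul_of_nonneg_right hCx hpx.le
        rwa [inv_mul_cancel₀ hpx.ne'] at this
      have h3 := mul_le_mul_of_nonneg_left this (sq_nonneg ‖fderiv ℝ g x‖)
      linarith
    refine ⟨(hmd.pow_const 2).aestronglyMeasurable, ?_⟩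
    rw [hasFiniteIntegral_iff_ofReal (Eventually.of_forall fun x => sq_nonneg _)]
    exact h1.trans_lt (ENNReal.mul_lt_top ENNReal.ofReal_lt_top (lt_top_iff_ne_top.2 hfin))
  have hi1 : IntegrableOn (fun x => ‖fderiv ℝ g x‖) K1 := by
    have h1 : IntegrableOn (fun x : EN k => (1 : ℝ) + ‖fderiv ℝ g x‖ ^ 2) K1 :=
      (integrableOn_const (hs := hK1.measure_lt_top.ne)).add hi2
    refine Integrable.mono' h1 hmd.aestronglyMeasurable (Eventually.of_forall fun x => ?_)
    rw [norm_norm]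
    nlinarith [sq_nonneg (‖fderiv ℝ g x‖ - 1), norm_nonneg (fderiv ℝ g x)]
  obtain ⟨Bρ, hBρ⟩ := hρs.continuous.bounded_above_of_compact_support hρc
  have htr : ∀ F : EN k → ℝ, IntegrableOn F K1 → ∀ x ∈ Kr W r, Integrable fun t => ρ t * F (x - t) := by
    intro F hF x hx
    have h1 := ((integrable_indicator_iff hK1.measurableSet).2 hF).comp_sub_left x
    have h2 := h1.bdd_mul hρs.continuous.aestronglyMeasurable (Eventually.of_forall hBρ)
    refine h2.congr (Eventually.of_forall fun t => ?_)
    by_cases h0 : ρ t = 0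
    · simp [h0]
    · have : t ∈ Metric.closedBall (0 : EN k) ε := hρt ▸ subset_tsupport _ h0
      rw [mem_closedBall_zero_iff] at this
      simp only
      rw [indicator_of_mem (hnear x hx _ (by rw [dist_eq_norm]; simpa using this))]
  have hpt : ∀ x ∈ Kr W r, ‖fderiv ℝ f x‖ ^ 2 ≤ ∫ t, ρ t * ‖fderiv ℝ g (x - t)‖ ^ 2 := by
    intro x hx
    have h1 := moll_deriv ρ hρs hρc K1 hK1 g (fun x hx => hg x (hK1W hx)) hi1 x (fun t ht => by
      rw [hρt, mem_closedBall_zero_iff] at ht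
      exact hnear x hx _ (by rw [dist_eq_norm]; simpa using ht)) ⟨htr _ hi1 x hx, hρ0⟩
    have h2 := jensen_sq volume ρ (fun t => ‖fderiv ℝ g (x - t)‖) hρ0 hρi hρ1 (htr _ hi1 x hx) (htr _ hi2 x hx)
    refine le_trans ?_ h2
    exact pow_le_pow_left₀ (norm_nonneg _) h1 2
  refine ⟨f, hfC, ?_, ?_, ?_, ?_⟩
  · obtain ⟨B, hB⟩ := hfC.continuous.bounded_above_of_compact_support hfS
    exact ⟨B, fun x => by simpa [Real.norm_eq_abs] using hB x⟩
  · exact (hfC.continuous_fderiv (by norm_num)).bounded_above_of_compact_support (hfS.fderiv ℝ)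
  · intro x hx
    have h1 := ContDiffBump.dist_normed_convolution_le (μ := volume) (φ := φ) (g := K1.indicator g) (x₀ := x) (ε := η) hGi.aestronglyMeasurable
      (fun y hy => by
        rw [hφr, Metric.mem_ball] at hy
        have hyK := hnear x hx y hy.le
        rw [indicator_of_mem hyK, indicator_of_mem (hKK1 hx)]
        exact (H2 y hyK x (hKK1 hx) (by linarith)).le)
    rw [indicator_of_mem (hKK1 hx), Real.dist_eq] at h1
    exact h1
  · have hpm : Measurable (W.indicator p) := by
      classical
      rw [← Set.piecewise_eq_indicator]
      exact ContinuousOn.measurable_piecewise hpc continuousOn_const hWo.measurableSet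
    set Q : EN k → ℝ≥0∞ := fun y => ENNReal.ofReal (‖fderiv ℝ g y‖ ^ 2 * W.indicator p y) with hQ
    have hQm : Measurable Q := ((hmd.pow_const 2).mul hpm).ennreal_ofReal
    have hQi : ∫⁻ y, Q y = ∫⁻ x in W, ENNReal.ofReal (‖fderiv ℝ g x‖ ^ 2 * p x) := by
      rw [← lintegral_indicator hWo.measurableSet]
      refine lintegral_congr fun y => ?_
      by_cases hy : y ∈ W
      · simp [hQ, hy]
      · simp [hQ, hy]
    have hstep : ∀ x ∈ Kr W r, ENNReal.ofReal (‖fderiv ℝ f x‖ ^ 2 * p x) ≤ ENNReal.ofReal (1 + η) * ∫⁻ t, ENNReal.ofReal (ρ t) * Q (x - t) := by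
      intro x hx
      have hpx := hp x (hK1W (hKK1 hx))
      have h1 : ENNReal.ofReal (‖fderiv ℝ f x‖ ^ 2 * p x) ≤ ENNReal.ofReal (p x) * ∫⁻ t, ENNReal.ofReal (ρ t * ‖fderiv ℝ g (x - t)‖ ^ 2) := by
        rw [← ofReal_integral_eq_lintegral_ofReal (htr _ hi2 x hx) (Eventually.of_forall fun t => mul_nonneg (hρ0 t) (sq_nonneg _)), ← ENNReal.ofReal_mul hpx.le]
        refine ENNReal.ofReal_le_ofReal ?_
        rw [mul_comm]
        exact mul_le_mul_of_nonneg_left (hpt x hx) hpx.le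
      refine h1.trans ?_
      rw [← lintegral_const_mul' _ _ ENNReal.ofReal_ne_top, ← lintegral_const_mul' _ _ ENNReal.ofReal_ne_top]
      refine lintegral_mono fun t => ?_
      by_cases h0 : ρ t = 0
      · simp [h0]
      have ht : t ∈ Metric.closedBall (0 : EN k) ε := hρt ▸ subset_tsupport _ h0
      rw [mem_closedBall_zero_iff] at ht
      have hd : dist (x - t) x ≤ ε := by rw [dist_eq_norm]; simpa using ht
      have hyK := hnear x hx _ hd
      have hpy := hp _ (hK1W hyK)
      have hle : p x ≤ (1 + η) * p (x - t) := by
        have h5 := H1 x (hKK1 hx) (x - t) hyK (by rw [dist_comm]; linarith)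
        rw [Real.dist_eq] at h5
        have h6 := (abs_lt.1 h5).2
        have h7 : Real.log (p x) ≤ Real.log ((1 + η) * p (x - t)) := by
          rw [Real.log_mul (by linarith) hpy.ne']; linarith
        exact (Real.log_le_log_iff hpx (by positivity)).1 h7
      simp only [hQ]
      rw [indicator_of_mem (hK1W hyK), ← ENNReal.ofReal_mul hpx.le, ← ENNReal.ofReal_mul (hρ0 t), ← ENNReal.ofReal_mul (by linarith)]
      refine ENNReal.ofReal_le_ofReal ?_
      have h8 := mul_le_mul_of_nonneg_right hle (mul_nonneg (hρ0 t) (sq_nonneg ‖fderiv ℝ g (x - t)‖))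
      linarith
    have hρl : ∫⁻ t, ENNReal.ofReal (ρ t) = 1 := by
      rw [← ofReal_integral_eq_lintegral_ofReal hρi (Eventually.of_forall hρ0), hρ1, ENNReal.ofReal_one]
    calc (∫⁻ x in Kr W r, ENNReal.ofReal (‖fderiv ℝ f x‖ ^ 2 * p x))
        ≤ ∫⁻ x in Kr W r, ENNReal.ofReal (1 + η) * ∫⁻ t, ENNReal.ofReal (ρ t) * Q (x - t) :=
          setLIntegral_mono' (Kr_closed W r).measurableSet hstep
      _ ≤ ∫⁻ x, ENNReal.ofReal (1 + η) * ∫⁻ t, ENNReal.ofReal (ρ t) * Q (x - t) := setLIntegral_le_lintegral _ _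
      _ = ENNReal.ofReal (1 + η) * ∫⁻ x, ∫⁻ t, ENNReal.ofReal (ρ t) * Q (x - t) := lintegral_const_mul' _ _ ENNReal.ofReal_ne_top
      _ = ENNReal.ofReal (1 + η) * ∫⁻ t, ∫⁻ x, ENNReal.ofReal (ρ t) * Q (x - t) := by
          rw [lintegral_lintegral_swap]
          refine Measurable.aemeasurable ?_
          exact ((hρs.continuous.measurable.comp measurable_snd).ennreal_ofReal).mul (hQm.comp (measurable_fst.sub measurable_snd))
      _ = ENNReal.ofReal (1 + η) * ∫⁻ t, ENNReal.ofReal (ρ t) * ∫⁻ x, Q x := by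
          congr 1
          refine lintegral_congr fun t => ?_
          rw [lintegral_const_mul' _ _ ENNReal.ofReal_ne_top, lintegral_sub_right_eq_self]
      _ = _ := by
          rw [lintegral_mul_const _ hρs.continuous.measurable.ennreal_ofReal, hρl, one_mul, hQi]

set_option maxHeartbeats 1000000 in
theorem poincare_ND {n : ℕ} {W : Set (EN (n+1))} {h U : EN (n+1) → ℝ} {M D d μ : ℝ} (H : ND n W h U M D d μ)
    (hne : W.Nonempty) (g : EN (n+1) → ℝ) (hg : ∀ x ∈ W, DifferentiableAt ℝ g x)
    (hg2 : (∫⁻ x in W, ENNReal.ofReal (g x ^ 2 * (h x * U x ^ 2))) ≠ ∞)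
    (hmean : ∫ x in W, g x * (h x * U x ^ 2) = 0)
    (hlt : (∫⁻ x in W, ENNReal.ofReal (‖fderiv ℝ g x‖ ^ 2 * (h x * U x ^ 2))) <
      ENNReal.ofReal μ * ∫⁻ x in W, ENNReal.ofReal (g x ^ 2 * (h x * U x ^ 2))) : False := by
  set p : EN (n+1) → ℝ := fun x => h x * U x ^ 2 with hpd
  have hWm : MeasurableSet W := H.Wo.measurableSet
  have hp : ∀ x ∈ W, 0 < p x := fun x hx => mul_pos (H.hp x hx) (pow_pos (H.Up x hx) 2)
  have hpc : ContinuousOn p W := H.hc.mul (H.Uc.pow 2).continuousOn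
  have hgc : ContinuousOn g W := fun y hy => (hg y hy).continuousAt.continuousWithinAt
  have hgrad : (∫⁻ x in W, ENNReal.ofReal (‖fderiv ℝ g x‖ ^ 2 * p x)) ≠ ∞ := hlt.ne_top
  have hpi : IntegrableOn p W := by
    obtain ⟨B, hB⟩ := (Metric.isCompact_of_isClosed_isBounded isClosed_closure H.Wb.closure).exists_bound_of_continuousOn H.Uc.continuousOn
    have hfin : volume W ≠ ∞ := H.Wb.measure_lt_top.ne
    refine Integrable.mono' (integrableOn_const (C := M * B ^ 2) (hs := hfin)) (hpc.aestronglyMeasurable hWm) ?_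
    refine (ae_restrict_iff' hWm).2 (Eventually.of_forall fun x hx => ?_)
    rw [Real.norm_eq_abs, abs_of_pos (hp x hx)]
    have h1 := hB x (subset_closure hx)
    have h2 := H.Up x hx
    rw [Real.norm_eq_abs, abs_of_pos h2] at h1
    exact mul_le_mul (H.hM x hx) (pow_le_pow_left₀ h2.le h1 2) (sq_nonneg _) ((H.hp x hx).le.trans (H.hM x hx))
  have hg2i : IntegrableOn (fun x => g x ^ 2 * p x) W := by
    refine ⟨((hgc.pow 2).mul hpc).aestronglyMeasurable hWm, ?_⟩
    rw [hasFiniteIntegral_iff_ofReal]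
    · exact lt_top_iff_ne_top.2 hg2
    · exact (ae_restrict_iff' hWm).2 (Eventually.of_forall fun x hx => mul_nonneg (sq_nonneg _) (hp x hx).le)
  have hg1i : IntegrableOn (fun x => g x * p x) W := by
    refine Integrable.mono' (hg2i.add hpi) ((hgc.mul hpc).aestronglyMeasurable hWm) ?_
    refine (ae_restrict_iff' hWm).2 (Eventually.of_forall fun x hx => ?_)
    simp only [Pi.add_apply]
    rw [norm_mul, Real.norm_eq_abs, Real.norm_eq_abs, abs_of_pos (hp x hx)]
    have h1 : |g x| ≤ g x ^ 2 + 1 := by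
      rw [← sq_abs]; nlinarith [sq_nonneg (|g x| - 1), abs_nonneg (g x)]
    have := mul_le_mul_of_nonneg_right h1 (hp x hx).le
    linarith
  set a := (∫⁻ x in W, ENNReal.ofReal (‖fderiv ℝ g x‖ ^ 2 * p x)).toReal with ha
  have haE : (∫⁻ x in W, ENNReal.ofReal (‖fderiv ℝ g x‖ ^ 2 * p x)) = ENNReal.ofReal a := (ENNReal.ofReal_toReal hgrad).symm
  have ha0 : 0 ≤ a := ENNReal.toReal_nonneg
  set G2 := ∫ x in W, g x ^ 2 * p x with hG2
  have haG : a < μ * G2 := by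
    have e : (∫⁻ x in W, ENNReal.ofReal (g x ^ 2 * p x)) = ENNReal.ofReal G2 :=
      (ofReal_integral_eq_lintegral_ofReal hg2i ((ae_restrict_iff' hWm).2 (Eventually.of_forall fun x hx => mul_nonneg (sq_nonneg _) (hp x hx).le))).symm
    rw [haE, e, ← ENNReal.ofReal_mul H.hμ0.le] at hlt
    exact (ENNReal.ofReal_lt_ofReal_iff_of_nonneg ha0).1 hlt
  have hmW : 0 < ∫ x in W, p x := by
    rw [setIntegral_pos_iff_support_of_nonneg_ae ((ae_restrict_iff' hWm).2 (Eventually.of_forall fun x hx => (hp x hx).le)) hpi]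
    have : Function.support p ∩ W = W := by
      ext x; exact ⟨fun h => h.2, fun h => ⟨(hp x h).ne', h⟩⟩
    rw [this]
    exact H.Wo.measure_pos _ hne
  -- exhaustion
  set K : ℕ → Set (EN (n+1)) := fun j => Kr W (1 / ((j : ℝ) + 1)) with hK
  have hKpos : ∀ j : ℕ, 0 < 1 / ((j : ℝ) + 1) := fun j => Nat.one_div_pos_of_nat
  have hKmono : Monotone K := by
    intro i j hij
    exact Kr_mono W (one_div_le_one_div_of_le (by positivity) (by have : (i:ℝ) ≤ j := by exact_mod_cast hij
                                                                  linarith))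
  have hKU : ⋃ j, K j = W := by
    apply Subset.antisymm
    · exact iUnion_subset fun j => Kr_sub W _ (hKpos j)
    · intro x hx
      obtain ⟨ε, hε, hb⟩ := Metric.isOpen_iff.1 H.Wo x hx
      obtain ⟨j, hj⟩ := exists_nat_one_div_lt hε
      exact mem_iUnion.2 ⟨j, (Metric.ball_subset_ball hj.le).trans hb⟩
  have hlim : ∀ F : EN (n+1) → ℝ, IntegrableOn F W → Tendsto (fun j => ∫ x in K j, F x) atTop (nhds (∫ x in W, F x)) := by
    intro F hF
    have := tendsto_setIntegral_of_monotone (μ := volume) (f := F) (s := K) (fun j => (Kr_closed W _).measurableSet) hKmono (by rw [hKU]; exact hF)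
    rwa [hKU] at this
  have hV : Tendsto (fun j => μ * ((∫ x in K j, g x ^ 2 * p x) - (∫ x in K j, g x * p x) ^ 2 / ∫ x in K j, p x)) atTop (nhds (μ * (G2 - 0 ^ 2 / ∫ x in W, p x))) := by
    refine Tendsto.const_mul _ ((hlim _ hg2i).sub (Tendsto.div (Tendsto.pow ?_ 2) (hlim _ hpi) hmW.ne'))
    have := hlim _ hg1i
    rwa [hmean] at this
  obtain ⟨j, hj1, hj2⟩ := ((hV.eventually (lt_mem_nhds (show a < _ by simpa using haG))).and ((hlim _ hpi).eventually (lt_mem_nhds hmW))).exists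
  set r := 1 / ((j : ℝ) + 1) with hr
  have hr0 : 0 < r := hKpos j
  have hKe : K j = Kr W r := rfl
  rw [hKe] at hj1 hj2
  set K0 := Kr W r with hK0
  set m0 := ∫ x in K0, p x with hm0
  set V := (∫ x in K0, g x ^ 2 * p x) - (∫ x in K0, g x * p x) ^ 2 / m0 with hVd
  have hK0c : IsCompact K0 := Kr_compact W H.Wb r hr0
  have hK0W : K0 ⊆ W := Kr_sub W r hr0
  have hK0m : MeasurableSet K0 := hK0c.measurableSet
  have hK0v : volume K0 ≠ 0 := by
    intro h0
    have : m0 = 0 := by rw [hm0, setIntegral_measure_zero _ h0]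
    linarith
  -- choice of η
  have hηlim : Tendsto (fun η : ℝ => μ * ((V - (η ^ 2 + η) * m0) / (1 + η)) - (1 + η) * a) (nhdsWithin 0 (Ioi 0)) (nhds (μ * V - a)) := by
    have hc : ContinuousAt (fun η : ℝ => μ * ((V - (η ^ 2 + η) * m0) / (1 + η)) - (1 + η) * a) 0 := by
      refine ContinuousAt.sub (ContinuousAt.mul continuousAt_const (ContinuousAt.div ?_ ?_ (by norm_num))) ?_ <;> fun_prop
    have := hc.tendsto
    simp only [ne_eq, OfNat.ofNat_ne_zero, not_false_eq_true, zero_pow, add_zero, zero_mul, sub_zero, div_one, one_mul] at this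
    exact this.mono_left nhdsWithin_le_nhds
  obtain ⟨η, hη1, hη0⟩ := ((hηlim.eventually (lt_mem_nhds (show 0 < μ * V - a by linarith))).and self_mem_nhdsWithin).exists
  have hη0 : 0 < η := hη0
  obtain ⟨f, hfC, ⟨B, hB⟩, ⟨B', hB'⟩, hfg, hfgrad⟩ := mollify W H.Wo H.Wb r hr0 p g hpc hp hg hgrad η hη0
  have hpc0 := hpc.mono hK0W
  have hgc0 := hgc.mono hK0W
  have hfc0 : ContinuousOn f K0 := hfC.continuous.continuousOn
  have hintg : ∀ F : EN (n+1) → ℝ, ContinuousOn F K0 → IntegrableOn (fun x => F x * p x) K0 := fun F hF => (hF.mul hpc0).integrableOn_compact hK0c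
  have hi0 : IntegrableOn p K0 := hpc0.integrableOn_compact hK0c
  set c := (∫ x in K0, f x * p x) / m0 with hc
  set q : EN (n+1) → ℝ := fun x => f x - c with hq
  have hqC : ContDiff ℝ 1 q := hfC.sub contDiff_const
  have hqd : ∀ x, fderiv ℝ q x = fderiv ℝ f x := fun x => fderiv_sub_const c
  have hq0 : ∫ x in K0, q x * p x = 0 := by
    have e : ∀ x, q x * p x = f x * p x - c * p x := fun x => by simp only [hq]; ring
    simp only [e]
    rw [integral_sub (hintg f hfc0) (hi0.const_mul c), integral_const_mul, ← hm0, hc, div_mul_cancel₀ _ hj2.ne', sub_self]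
  have hq2i : IntegrableOn (fun x => q x ^ 2 * p x) K0 := hintg (fun x => q x ^ 2) (hqC.continuous.pow 2).continuousOn
  have hV1 : V ≤ ∫ x in K0, (g x - c) ^ 2 * p x := by
    have e : ∀ x, (g x - c) ^ 2 * p x = g x ^ 2 * p x - (2 * c) * (g x * p x) + c ^ 2 * p x := fun x => by ring
    simp only [e]
    have i2 := hintg (fun x => g x ^ 2) (hgc0.pow 2)
    have i1 := hintg g hgc0
    rw [integral_add (by exact i2.sub (i1.const_mul _)) (hi0.const_mul _), integral_sub i2 (i1.const_mul _), integral_const_mul, integral_const_mul, ← hm0, hVd]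
    set I := ∫ x in K0, g x * p x
    have : 0 ≤ (I - c * m0) ^ 2 / m0 := by positivity
    have e2 : (I - c * m0) ^ 2 / m0 = I ^ 2 / m0 - 2 * c * I + c ^ 2 * m0 := by field_simp; ring
    linarith
  have hV2 : (∫ x in K0, (g x - c) ^ 2 * p x) ≤ (1 + η) * (∫ x in K0, q x ^ 2 * p x) + (η ^ 2 + η) * m0 := by
    rw [hm0, ← integral_const_mul, ← integral_const_mul, ← integral_add (hq2i.const_mul _) (hi0.const_mul _)]
    refine setIntegral_mono_on (hintg (fun x => (g x - c) ^ 2) ((hgc0.sub continuousOn_const).pow 2)) ((hq2i.const_mul _).add (hi0.const_mul _)) hK0m fun x hx => ?_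
    have h1 := hfg x hx
    have h2 : (g x - c) ^ 2 ≤ (1 + η) * q x ^ 2 + (η ^ 2 + η) := by
      simp only [hq]
      set A := f x - c
      have e : g x - c = A - (f x - g x) := by simp only [A]; ring
      rw [e]
      set b := f x - g x
      have hb : b ^ 2 ≤ η ^ 2 := sq_le_sq' (abs_le.1 h1).1 (abs_le.1 h1).2
      have h3 : 0 ≤ (η * A + b) ^ 2 / η := by positivity
      have e3 : (η * A + b) ^ 2 / η = η * A ^ 2 + 2 * A * b + b ^ 2 / η := by field_simp; ring
      have h4 : b ^ 2 / η ≤ η := by rw [div_le_iff₀ hη0]; linarith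
      nlinarith
    have := mul_le_mul_of_nonneg_right h2 (hp x (hK0W hx)).le
    linarith
  have hgi : IntegrableOn (fun x => ‖fderiv ℝ f x‖ ^ 2 * p x) K0 := hintg (fun x => ‖fderiv ℝ f x‖ ^ 2) ((hfC.continuous_fderiv (by norm_num)).norm.pow 2).continuousOn
  have hgr : (∫ x in K0, ‖fderiv ℝ f x‖ ^ 2 * p x) ≤ (1 + η) * a := by
    rw [haE, ← ENNReal.ofReal_mul (by linarith), ← ofReal_integral_eq_lintegral_ofReal hgi ((ae_restrict_iff' hK0m).2 (Eventually.of_forall fun x hx => mul_nonneg (sq_nonneg _) (hp x (hK0W hx)).le))] at hfgrad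
    exact (ENNReal.ofReal_le_ofReal_iff (by positivity)).1 hfgrad
  set gap := μ * ((V - (η ^ 2 + η) * m0) / (1 + η)) - (1 + η) * a with hgap
  refine no_violation H K0 hK0c (Kr_convex W H.Wc r) hK0W hK0v q hqC (B + |c|) B' ?_ ?_ (gap / m0) (div_pos hη1 hj2) hq0 ?_
  · intro x
    exact (abs_sub _ _).trans (add_le_add (hB x) le_rfl)
  · intro x; rw [hqd]; exact hB' x
  · have e : ∀ x, (μ * q x ^ 2 - ‖fderiv ℝ q x‖ ^ 2 - gap / m0) * (h x * U x ^ 2) = μ * (q x ^ 2 * p x) - ‖fderiv ℝ f x‖ ^ 2 * p x - (gap / m0) * p x := fun x => by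
      rw [hqd]; simp only [hpd]; ring
    simp only [e]
    rw [integral_sub (by exact (hq2i.const_mul _).sub hgi) (hi0.const_mul _), integral_sub (hq2i.const_mul _) hgi, integral_const_mul, integral_const_mul, ← hm0, div_mul_cancel₀ _ hj2.ne']
    have h5 : (V - (η ^ 2 + η) * m0) / (1 + η) ≤ ∫ x in K0, q x ^ 2 * p x := by
      rw [div_le_iff₀ (by linarith)]; linarith
    have h6 := mul_le_mul_of_nonneg_left h5 H.hμ0.le
    linarith

lemma hausdorff_smul (n : ℕ) : ∃ c : ℝ≥0∞, c ≠ 0 ∧ c ≠ ∞ ∧ (μH[((n + 1 : ℕ) : ℝ)] : Measure (EN (n+1))) = c • volume := by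
  have hI : (μH[((n + 1 : ℕ) : ℝ)] : Measure (EN (n+1))).IsAddHaarMeasure := by
    have := isAddHaarMeasure_hausdorffMeasure (E := EN (n+1))
    rwa [finrank_euclideanSpace_fin] at this
  have h1 := Measure.isAddLeftInvariant_eq_smul (μH[((n + 1 : ℕ) : ℝ)] : Measure (EN (n+1))) volume
  set s := Measure.addHaarScalarFactor (μH[((n + 1 : ℕ) : ℝ)] : Measure (EN (n+1))) volume
  refine ⟨(s : ℝ≥0∞), ?_, ENNReal.coe_ne_top, ?_⟩
  · intro h0
    have hs : s = 0 := by exact_mod_cast h0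
    rw [hs, zero_smul] at h1
    exact hI.toIsOpenPosMeasure.open_pos univ isOpen_univ univ_nonempty (by rw [h1]; simp)
  · rw [h1]; rfl

set_option maxHeartbeats 1000000 in
theorem main_aux (N : ℕ) (Ω : Set (EN N)) (hΩ : IsOpen Ω) (hΩb : IsBounded Ω) (hΩc : Convex ℝ Ω)
    (P : AffineSubspace ℝ (EN N)) (n : ℕ) (hk : Module.finrank ℝ P.direction = n + 1)
    (ω : Set (EN N)) (hω : ω ⊆ Ω ∩ (P : Set (EN N))) (hωc : Convex ℝ ω) (hne : ω.Nonempty)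
    (hO : ∃ O : Set (EN N), IsOpen O ∧ ω = O ∩ (P : Set (EN N))) (hd : 0 < Metric.diam ω)
    (u1 : EN N → ℝ) (hu1 : IsFirstDirichletEF Ω u1) (m : ℕ) (hm : 0 < m) (h : EN N → ℝ)
    (hh : ∀ x ∈ ω, 0 < h x) (M : ℝ) (hM : ∀ x ∈ ω, h x ≤ M)
    (hconc : ConcaveOn ℝ ω (fun x => h x ^ ((1 : ℝ) / m)))
    (u : EN N → ℝ) (hu : tangAdm (n+1) ω (fun x => h x * (u1 x) ^ 2) u) :
    ENNReal.ofReal (3 * π ^ 2 / Metric.diam Ω ^ 2 + 1 * (Metric.diam Ω - Metric.diam ω) ^ 3 / Metric.diam Ω ^ 5) ≤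
      tangRQ (n+1) P.direction ω (fun x => h x * (u1 x) ^ 2) u := by
  obtain ⟨O, hOo, hωO⟩ := hO
  obtain ⟨x0, hx0⟩ := hne
  have hx0P : x0 ∈ P := (hω hx0).2
  have hωb : IsBounded ω := hΩb.subset fun x hx => (hω hx).1
  have hdD : Metric.diam ω ≤ Metric.diam Ω := Metric.diam_mono (fun x hx => (hω hx).1) hΩb
  have hD : 0 < Metric.diam Ω := hd.trans_le hdD
  -- the isometric parametrization
  let L : EN (n+1) ≃ₗᵢ[ℝ] P.direction := ((stdOrthonormalBasis ℝ P.direction).reindex (finCongr hk)).repr.symm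
  let J : EN (n+1) →ₗᵢ[ℝ] EN N := P.direction.subtypeₗᵢ.comp L.toLinearIsometry
  have hJ : ∀ y, J y = (L y : EN N) := fun y => rfl
  let ι : EN (n+1) → EN N := fun y => x0 + J y
  have hι : ∀ y, ι y = x0 + J y := fun y => rfl
  have hιd : ∀ x y, ι x - ι y = J (x - y) := fun x y => by simp only [hι, map_sub]; abel
  have hιn : ∀ x y, ‖ι x - ι y‖ = ‖x - y‖ := fun x y => by rw [hιd, J.norm_map]
  have hιi : Isometry ι := Isometry.of_dist_eq fun x y => by rw [dist_eq_norm, dist_eq_norm, hιn]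
  have hιr : range ι = (P : Set (EN N)) := by
    ext z
    constructor
    · rintro ⟨y, rfl⟩
      rw [hι, hJ, add_comm]
      exact AffineSubspace.vadd_mem_of_mem_direction (L y).2 hx0P
    · intro hz
      have h1 : z - x0 ∈ P.direction := AffineSubspace.vsub_mem_direction hz hx0P
      refine ⟨L.symm ⟨z - x0, h1⟩, ?_⟩
      rw [hι, hJ, L.apply_symm_apply]
      simp
  have hιc : Continuous ι := hιi.continuous
  have hιE : MeasurableEmbedding ι := hιi.isClosedEmbedding.measurableEmbedding
  set W : Set (EN (n+1)) := ι ⁻¹' ω with hW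
  have hWo : IsOpen W := by
    have : W = ι ⁻¹' O := by
      rw [hW, hωO, ← hιr, preimage_inter, preimage_range, inter_univ]
    rw [this]; exact hOo.preimage hιc
  have hιcomb : ∀ (x y : EN (n+1)) (a b : ℝ), a + b = 1 → ι (a • x + b • y) = a • ι x + b • ι y := by
    intro x y a b hab
    simp only [hι, map_add, map_smul, smul_add]
    have : x0 = a • x0 + b • x0 := by rw [← add_smul, hab, one_smul]
    conv_lhs => rw [this]
    abel
  have hWc : Convex ℝ W := by
    intro x hx y hy a b ha hb hab
    change ι _ ∈ ω
    rw [hιcomb x y a b hab]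
    exact hωc hx hy ha hb hab
  have hWd : ∀ x ∈ W, ∀ y ∈ W, ‖x - y‖ ≤ Metric.diam ω := by
    intro x hx y hy
    rw [← hιn, ← dist_eq_norm]
    exact Metric.dist_le_diam_of_mem hωb hx hy
  have hWb : IsBounded W := Metric.isBounded_iff.2 ⟨Metric.diam ω, fun x hx y hy => by
    rw [dist_eq_norm]; exact hWd x hx y hy⟩
  have hWne : W.Nonempty := by
    obtain ⟨y, hy⟩ : x0 ∈ range ι := by rw [hιr]; exact hx0P
    exact ⟨y, by change ι y ∈ ω; rw [hy]; exact hx0⟩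
  -- measure transfer
  obtain ⟨c, hc0, hct, hcv⟩ := hausdorff_smul n
  have hmeas : (μH[((n + 1 : ℕ) : ℝ)] : Measure (EN N)).restrict ω = Measure.map ι (c • volume.restrict W) := by
    have h1 := hιi.map_hausdorffMeasure (d := ((n + 1 : ℕ) : ℝ)) (Or.inl (by positivity))
    have h2 : ω ∩ range ι = ω := inter_eq_left.2 (by rw [hιr]; exact fun x hx => (hω hx).2)
    have hωm : MeasurableSet ω := by
      rw [hωO, ← hιr]; exact hOo.measurableSet.inter hιE.measurableSet_range
    have h3 : (μH[((n + 1 : ℕ) : ℝ)] : Measure (EN N)).restrict ω = ((μH[((n + 1 : ℕ) : ℝ)] : Measure (EN N)).restrict (range ι)).restrict ω := by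
      rw [Measure.restrict_restrict hωm, h2]
    rw [h3, ← h1, hιE.restrict_map, hcv, Measure.restrict_smul]
  have hlint : ∀ F : EN N → ℝ≥0∞, ∫⁻ x in ω, F x ∂μH[((n + 1 : ℕ) : ℝ)] = c * ∫⁻ y in W, F (ι y) := by
    intro F
    rw [hmeas, hιE.lintegral_map, lintegral_smul_measure, smul_eq_mul]
  have hbint : ∀ F : EN N → ℝ, ∫ x in ω, F x ∂μH[((n + 1 : ℕ) : ℝ)] = c.toReal * ∫ y in W, F (ι y) := by
    intro F
    rw [hmeas, hιE.integral_map, integral_smul_measure, smul_eq_mul]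
  obtain ⟨hud, hu0, hut, hum⟩ := hu
  by_contra hcon
  rw [not_le] at hcon
  obtain ⟨μ, hμn, hμ1, hμ2⟩ := ENNReal.lt_iff_exists_real_btwn.1 hcon
  have hμ0 : 0 < μ := by
    by_contra hle
    rw [ENNReal.ofReal_of_nonpos (not_lt.1 hle)] at hμ1
    exact not_lt_zero hμ1
  have hμT : μ < 3 * π ^ 2 / Metric.diam Ω ^ 2 + 1 * (Metric.diam Ω - Metric.diam ω) ^ 3 / Metric.diam Ω ^ 5 :=
    (ENNReal.ofReal_lt_ofReal_iff_of_nonneg hμn).1 hμ2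
  unfold tangRQ at hμ1
  rw [ENNReal.div_lt_iff (Or.inl hu0) (Or.inl hut), hlint, hlint] at hμ1
  rw [hlint] at hut
  rw [hbint] at hum
  -- gradient
  set g : EN (n+1) → ℝ := fun y => u (ι y) with hg
  have hgD : ∀ y ∈ W, HasFDerivAt g (((fderiv ℝ u (ι y)).comp P.direction.subtypeL).comp (L : EN (n+1) →L[ℝ] P.direction)) y := by
    intro y hy
    have h1 : HasFDerivAt ι (J.toContinuousLinearMap) y := J.toContinuousLinearMap.hasFDerivAt.const_add x0
    have h2 := (hud (ι y) hy).hasFDerivAt.comp y h1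
    exact h2.congr_fderiv (by ext v; rfl)
  have hgn : ∀ y ∈ W, ‖fderiv ℝ g y‖ = ‖(fderiv ℝ u (ι y)).comp P.direction.subtypeL‖ := by
    intro y hy
    rw [(hgD y hy).fderiv]
    exact ContinuousLinearMap.opNorm_comp_linearIsometryEquiv _ L
  -- powers of h
  have hm' : (m : ℝ) ≠ 0 := by positivity
  have hpow : ∀ x ∈ ω, (h x ^ ((1 : ℝ) / m)) ^ m = h x := by
    intro x hx
    rw [← Real.rpow_natCast, ← Real.rpow_mul (hh x hx).le, one_div_mul_cancel hm', Real.rpow_one]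
  have hconcW : ConcaveOn ℝ W (fun y => h (ι y) ^ ((1 : ℝ) / m)) := by
    refine ⟨hWc, fun x hx y hy a b ha hb hab => ?_⟩
    simp only
    rw [hιcomb x y a b hab]
    exact hconc.2 hx hy ha hb hab
  have H : ND n W (fun y => h (ι y)) (fun y => u1 (ι y)) M (Metric.diam Ω) (Metric.diam ω) μ := by
    refine ⟨hWo, hWc, hWb, fun x hx => hh _ hx, fun x hx => hM _ hx, ?_, ?_, hu1.1.comp hιc, ?_, ?_, hd, hdD, hμ0, hμT, hWd⟩
    · refine ((hconcW.continuousOn hWo).pow m).congr fun y hy => ?_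
      exact (hpow _ hy).symm
    · intro x hx y hy l hl0 hl1
      have hz : ι ((1 - l) • x + l • y) ∈ ω := hWc hx hy (by linarith) hl0.le (by ring)
      have h1 := hconcW.2 hx hy (show 0 ≤ 1 - l by linarith) hl0.le (by ring)
      simp only [smul_eq_mul] at h1
      have px := Real.rpow_pos_of_pos (hh _ hx) ((1 : ℝ) / m)
      have py := Real.rpow_pos_of_pos (hh _ hy) ((1 : ℝ) / m)
      have h2 := (Real.geom_mean_le_arith_mean2_weighted (show 0 ≤ 1 - l by linarith) hl0.le px.le py.le (by ring)).trans h1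
      have h3 := pow_le_pow_left₀ (by positivity) h2 m
      rw [hpow _ hz, mul_pow] at h3
      have e : ∀ (z s : ℝ), 0 < z → (z ^ s) ^ m = (z ^ m) ^ s := by
        intro z s hz
        rw [← Real.rpow_natCast, ← Real.rpow_natCast, ← Real.rpow_mul hz.le, ← Real.rpow_mul hz.le, mul_comm]
      rw [e _ _ px, e _ _ py, hpow _ hx, hpow _ hy] at h3
      exact h3
    · intro x hx
      exact hu1.2.2.2.2.1 _ (hω hx).1
    · intro p hp q hq σ hσ
      have h1 := claimA Ω hΩ hΩb hΩc hD u1 hu1 (ι p) (ι q) (hω hp).1 (hω hq).1 σ hσ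
      rw [hιn] at h1
      have e1 : ι ((1/2:ℝ) • (p + q) + (σ/2) • (p - q)) = (1/2:ℝ) • (ι p + ι q) + (σ/2) • (ι p - ι q) := by
        simp only [hι, map_add, map_smul, map_sub]; module
      have e2 : ι ((1/2:ℝ) • (p + q) - (σ/2) • (p - q)) = (1/2:ℝ) • (ι p + ι q) - (σ/2) • (ι p - ι q) := by
        simp only [hι, map_add, map_smul, map_sub]; module
      rw [← e1, ← e2] at h1
      exact h1
  refine poincare_ND H hWne g (fun x hx => (hgD x hx).differentiableAt) ?_ ?_ ?_
  · intro htop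
    simp only at hut
    exact hut (by rw [htop]; exact ENNReal.mul_top hc0)
  · rcases mul_eq_zero.1 hum with h0 | h0
    · rcases (ENNReal.toReal_eq_zero_iff c).1 h0 with h5 | h5
      · exact absurd h5 hc0
      · exact absurd h5 hct
    · exact h0
  · rw [← mul_assoc, mul_comm (ENNReal.ofReal μ) c, mul_assoc] at hμ1
    have h6 := lt_of_mul_lt_mul_left' hμ1
    have e : (∫⁻ x in W, ENNReal.ofReal (‖fderiv ℝ g x‖ ^ 2 * (h (ι x) * u1 (ι x) ^ 2))) =
        ∫⁻ y in W, ENNReal.ofReal (‖(fderiv ℝ u (ι y)).comp P.direction.subtypeL‖ ^ 2 * (h (ι y) * u1 (ι y) ^ 2)) :=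
      setLIntegral_congr_fun hWo.measurableSet fun y hy => by simp only; rw [hgn y hy]
    rw [e]
    exact h6


/-- Proposition 4.1 / `p:inside`: localized variational version of the
Andrews–Clutterbuck inequality. There is an absolute constant `C > 0` such that, for `N ≥ 2`,
an open bounded convex `Ω ⊂ ℝ^N` of diameter `D`, a `k`-dimensional affine subspace `Π`
(`k ≤ N`), a relatively open convex `ω ⊆ Ω ∩ Π` of diameter `d > 0`, and a bounded weight
`p = h u₁²` with `u₁` the first Dirichlet eigenfunction of `Ω` and `h` positive
`(1/m)`-concave on `ω`, it holds `μ₁(ω, p) ≥ 3π²/D² + C (D-d)³/D⁵`. -/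
theorem localized_andrews_clutterbuck :
    ∃ C : ℝ, 0 < C ∧
      ∀ (N : ℕ), 2 ≤ N →
        ∀ Ω : Set (EuclideanSpace ℝ (Fin N)),
          IsOpen Ω → IsBounded Ω → Convex ℝ Ω → Ω.Nonempty →
          ∀ (P : AffineSubspace ℝ (EuclideanSpace ℝ (Fin N))) (k : ℕ),
            Module.finrank ℝ P.direction = k → k ≤ N →
            ∀ ω : Set (EuclideanSpace ℝ (Fin N)),
              ω ⊆ Ω ∩ (P : Set (EuclideanSpace ℝ (Fin N))) →
              Convex ℝ ω → ω.Nonempty →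
              (∃ O : Set (EuclideanSpace ℝ (Fin N)), IsOpen O ∧
                ω = O ∩ (P : Set (EuclideanSpace ℝ (Fin N)))) →
              0 < Metric.diam ω →
              ∀ u1 : EuclideanSpace ℝ (Fin N) → ℝ, IsFirstDirichletEF Ω u1 →
              ∀ (m : ℕ), 0 < m →
              ∀ h : EuclideanSpace ℝ (Fin N) → ℝ,
                (∀ x ∈ ω, 0 < h x) →
                (∃ M : ℝ, ∀ x ∈ ω, h x ≤ M) →
                ConcaveOn ℝ ω (fun x => h x ^ ((1 : ℝ) / m)) →
                ENNReal.ofReal (3 * π ^ 2 / Metric.diam Ω ^ 2 +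
                    C * (Metric.diam Ω - Metric.diam ω) ^ 3 / Metric.diam Ω ^ 5) ≤
                  tangEV k P.direction ω (fun x => h x * (u1 x) ^ 2) := by
  refine ⟨1, one_pos, ?_⟩
  intro N _ Ω hΩ hΩb hΩc _ P k hk _ ω hω hωc hne hO hd u1 hu1 m hm h hh hM hconc
  obtain ⟨M, hM⟩ := hM
  unfold tangEV
  refine le_iInf fun u => le_iInf fun hu => ?_
  cases k with
  | zero =>
    exfalso
    have hbot : P.direction = ⊥ := Submodule.finrank_eq_zero.1 hk
    have hsub : ω.Subsingleton := by
      intro x hx y hy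
      have h1 : x - y ∈ P.direction := AffineSubspace.vsub_mem_direction (hω hx).2 (hω hy).2
      rw [hbot, Submodule.mem_bot, sub_eq_zero] at h1
      exact h1
    rw [Metric.diam_subsingleton hsub] at hd
    exact lt_irrefl _ hd
  | succ n =>
    exact main_aux N Ω hΩ hΩb hΩc P n hk ω hω hωc hne hO hd u1 hu1 m hm h hh M hM hconc u hu
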